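/- Almost-stabilizers of thin points are elementary (Lemma 6.6): For all real P0, r0, δ > 0 there exist constants ε0 > 0, depending only on P0 and r0, and H0 > 0, depending only on P0, r0 and δ, such that for every δ-hyperbolic GCB-space (X,σ) which is P0-packed at scale r0, every discrete group Γ of σ-isometries of X, every ε with 0 < ε < ε0, and every point x ∈ X for which there exists an infinite-order element g ∈ Γ with d(x, g x) < ε, the subgroup Γ_{R_ε}(x) generated by {h ∈ Γ : d(x, h x) ≤ R_ε} is virtually nilpotent, where R_ε = (1/H0)·log(1/(ε·H0)). -/

import Mathlib

open Metric Filter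

/-- Four-points condition for `δ`-hyperbolicity. -/
def IsDeltaHyperbolic (X : Type*) [MetricSpace X] (δ : ℝ) : Prop :=
  ∀ x y z w : X,
    dist x y + dist z w ≤ max (dist x z + dist y w) (dist x w + dist y z) + 2 * δ

/-- `X` is `P₀`-packed at scale `r₀`: any subset of a closed ball of radius `3r₀` whose
points are pairwise at distance `> 2r₀` has cardinality at most `P₀`. -/
def IsPacked (X : Type*) [MetricSpace X] (P₀ r₀ : ℝ) : Prop :=
  ∀ x : X, ∀ S : Finset X, (↑S ⊆ closedBall x (3 * r₀)) →
    (∀ a ∈ S, ∀ b ∈ S, a ≠ b → 2 * r₀ < dist a b) → (S.card : ℝ) ≤ P₀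

/-- A geodesically complete, convex, consistent, reversible geodesic bicombing on `X`.
Together with completeness of `X` this is the notion of GCB-space. -/
structure IsGCB {X : Type*} [MetricSpace X] (σ : X → X → ℝ → X) : Prop where
  source : ∀ x y : X, σ x y 0 = x
  target : ∀ x y : X, σ x y 1 = y
  geodesic : ∀ x y : X, ∀ t ∈ Set.Icc (0:ℝ) 1, ∀ t' ∈ Set.Icc (0:ℝ) 1,
    dist (σ x y t) (σ x y t') = |t - t'| * dist x y
  convex : ∀ x y x' y' : X,
    ConvexOn ℝ (Set.Icc (0:ℝ) 1) fun t => dist (σ x y t) (σ x' y' t)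
  consistent : ∀ x y : X, ∀ s t l : ℝ, 0 ≤ s → s ≤ t → t ≤ 1 → l ∈ Set.Icc (0:ℝ) 1 →
    σ (σ x y s) (σ x y t) l = σ x y ((1 - l) * s + l * t)
  reversible : ∀ x y : X, ∀ t ∈ Set.Icc (0:ℝ) 1, σ x y t = σ y x (1 - t)
  geodComplete : ∀ x y : X, ∃ γ : ℝ → X, Isometry γ ∧
    (∀ s t : ℝ, s ≤ t → ∀ l ∈ Set.Icc (0:ℝ) 1, σ (γ s) (γ t) l = γ (s + l * (t - s))) ∧
    (∀ t ∈ Set.Icc (0:ℝ) 1, σ x y t = γ (t * dist x y))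

/-- `g` is a `σ`-isometry: a surjective isometry preserving the bicombing `σ`. -/
def IsSigmaIsometry {X : Type*} [MetricSpace X] (σ : X → X → ℝ → X) (g : X ≃ᵢ X) : Prop :=
  ∀ x y : X, ∀ t ∈ Set.Icc (0:ℝ) 1, g (σ x y t) = σ (g x) (g y) t

/-- A group of isometries is discrete if for every `x` and `R` only finitely many of its
elements displace `x` at most `R`. -/
def IsDiscreteSubgroup {X : Type*} [MetricSpace X] (Γ : Subgroup (X ≃ᵢ X)) : Prop :=
  ∀ x : X, ∀ R : ℝ, {g : X ≃ᵢ X | g ∈ Γ ∧ dist x (g x) ≤ R}.Finite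

/-- A group is virtually nilpotent if it has a nilpotent subgroup of finite index. -/
def IsVirtuallyNilpotent (G : Type*) [Group G] : Prop :=
  ∃ H : Subgroup G, H.FiniteIndex ∧ Group.IsNilpotent H

/-- `Γ` is non-elementary: it contains two elements generating a subgroup that is not
virtually nilpotent. -/
def IsNonElementary {X : Type*} [MetricSpace X] (Γ : Subgroup (X ≃ᵢ X)) : Prop :=
  ∃ a b : X ≃ᵢ X, a ∈ Γ ∧ b ∈ Γ ∧
    ¬ IsVirtuallyNilpotent ↥(Subgroup.closure ({a, b} : Set (X ≃ᵢ X)))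

/-- An isometry is non-elliptic if its orbits are unbounded. -/
def IsNonElliptic {X : Type*} [MetricSpace X] (g : X ≃ᵢ X) : Prop :=
  ∀ x : X, ¬ Bornology.IsBounded (Set.range fun n : ℤ => (g ^ n) x)

/-- The `r`-almost stabilizer `Γ_r(x)`, generated by the elements of `Γ` displacing `x`
at most `r`. -/
def almostStabilizer {X : Type*} [MetricSpace X] (Γ : Subgroup (X ≃ᵢ X)) (r : ℝ) (x : X) :
    Subgroup (X ≃ᵢ X) :=
  Subgroup.closure {g : X ≃ᵢ X | g ∈ Γ ∧ dist x (g x) ≤ r}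

/-- The nilpotence radius of `Γ` at `x`. -/
noncomputable def nilrad {X : Type*} [MetricSpace X] (Γ : Subgroup (X ≃ᵢ X)) (x : X) : ℝ :=
  sSup {r : ℝ | 0 ≤ r ∧ IsVirtuallyNilpotent ↥(almostStabilizer Γ r x)}

/-- The Margulis domain `M_ε(g)`. -/
def margulisDomain {X : Type*} [MetricSpace X] (g : X ≃ᵢ X) (ε : ℝ) : Set X :=
  {x : X | dist x (g x) ≤ ε}

/-- The generalized Margulis domain `ℳ_ε(g) = ⋃_{i ≠ 0} M_ε(gⁱ)`. -/
def genMargulisDomain {X : Type*} [MetricSpace X] (g : X ≃ᵢ X) (ε : ℝ) : Set X :=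
  ⋃ i ∈ {i : ℤ | i ≠ 0}, margulisDomain (g ^ i) ε

/-- `f` parameterizes a geodesic segment from `x` to `y` on `[0, dist x y]`. -/
def IsGeodesicFrom {X : Type*} [MetricSpace X] (f : ℝ → X) (x y : X) : Prop :=
  f 0 = x ∧ f (dist x y) = y ∧
    ∀ s ∈ Set.Icc 0 (dist x y), ∀ t ∈ Set.Icc 0 (dist x y), dist (f s) (f t) = |s - t|

/-- `X` is a geodesic space. -/
def IsGeodesicSpace (X : Type*) [MetricSpace X] : Prop :=
  ∀ x y : X, ∃ f : ℝ → X, IsGeodesicFrom f x y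

/-- `C` is `lam`-quasiconvex: any two of its points are joined by a geodesic contained in
the closed `lam`-neighbourhood of `C`. -/
def IsQuasiconvex {X : Type*} [MetricSpace X] (lam : ℝ) (C : Set X) : Prop :=
  ∀ x ∈ C, ∀ y ∈ C, ∃ f : ℝ → X, IsGeodesicFrom f x y ∧
    ∀ t ∈ Set.Icc 0 (dist x y), infDist (f t) C ≤ lam

/-- `C` is a convex subset: any two of its points are joined by a geodesic inside `C`. -/
def IsConvexSubset {X : Type*} [MetricSpace X] (C : Set X) : Prop :=
  ∀ x ∈ C, ∀ y ∈ C, ∃ f : ℝ → X, IsGeodesicFrom f x y ∧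
    ∀ t ∈ Set.Icc 0 (dist x y), f t ∈ C

/-- Arc-length concatenation of three paths, of respective lengths `d₁`, `d₂` and the rest. -/
noncomputable def concatPath {X : Type*} (d₁ d₂ : ℝ) (f₁ f₂ f₃ : ℝ → X) : ℝ → X :=
  fun t => if t ≤ d₁ then f₁ t else if t ≤ d₁ + d₂ then f₂ (t - d₁) else f₃ (t - d₁ - d₂)

set_option linter.unusedSectionVars false

/-! ### Isometric representations and expectations along random walks -/

namespace RandomWalk

open scoped InnerProductSpace Topology

section Expect

variable {G : Type*} [Group G] {V W : Type*} [AddCommGroup V] [Module ℝ V] [AddCommGroup W]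
  [Module ℝ W]

/-- The linear extension of `φ : G → V` to the group algebra; when `f` is a probability
measure this is the expectation of `φ`. -/
noncomputable def expect (φ : G → V) : MonoidAlgebra ℝ G →ₗ[ℝ] V where
  toFun f := f.coeff.sum fun x r => r • φ x
  map_add' f g := by
    rw [MonoidAlgebra.coeff_add, Finsupp.sum_add_index'] <;> simp [add_smul]
  map_smul' c f := by
    rw [MonoidAlgebra.coeff_smul, Finsupp.sum_smul_index' (by simp)]
    simp [Finsupp.smul_sum, mul_smul]

theorem expect_apply (φ : G → V) (f : MonoidAlgebra ℝ G) :
    expect φ f = ∑ x ∈ f.coeff.support, f.coeff x • φ x := rfl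

theorem expect_apply_of_subset (φ : G → V) (f : MonoidAlgebra ℝ G) {s : Finset G}
    (h : f.coeff.support ⊆ s) : expect φ f = ∑ x ∈ s, f.coeff x • φ x :=
  Finsupp.sum_of_support_subset f.coeff h (fun x r => r • φ x) (by simp)

@[simp] theorem expect_single (φ : G → V) (x : G) (r : ℝ) :
    expect φ (MonoidAlgebra.single x r) = r • φ x := by
  simp [expect]

@[simp] theorem expect_one (φ : G → V) : expect φ (1 : MonoidAlgebra ℝ G) = φ 1 := by
  simp [MonoidAlgebra.one_def]

theorem expect_add_fun (φ ψ : G → V) (f : MonoidAlgebra ℝ G) :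
    expect (fun x => φ x + ψ x) f = expect φ f + expect ψ f := by
  simp [expect_apply, Finset.sum_add_distrib]

theorem expect_sub_fun (φ ψ : G → V) (f : MonoidAlgebra ℝ G) :
    expect (fun x => φ x - ψ x) f = expect φ f - expect ψ f := by
  simp [expect_apply, smul_sub]

theorem expect_map (L : V →ₗ[ℝ] W) (φ : G → V) (f : MonoidAlgebra ℝ G) :
    expect (fun x => L (φ x)) f = L (expect φ f) := by
  simp [expect_apply]

theorem expect_const (v : V) (f : MonoidAlgebra ℝ G) :
    expect (fun _ => v) f = expect (fun _ => (1 : ℝ)) f • v := by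
  simp [expect_apply, Finset.sum_smul]

theorem expect_mul (φ : G → V) (f g : MonoidAlgebra ℝ G) :
    expect φ (f * g) = expect (fun x => expect (fun y => φ (x * y)) g) f := by
  induction f using MonoidAlgebra.induction_linear with
  | zero => simp
  | add f₁ f₂ h₁ h₂ => rw [add_mul, map_add, map_add, h₁, h₂]
  | single x r =>
    rw [expect_single]
    induction g using MonoidAlgebra.induction_linear with
    | zero => simp
    | add g₁ g₂ h₁ h₂ => rw [mul_add, map_add, map_add, smul_add, h₁, h₂]
    | single y t => rw [MonoidAlgebra.single_mul_single, expect_single, expect_single, mul_smul]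

theorem expect_congr {φ ψ : G → V} {f : MonoidAlgebra ℝ G}
    (h : ∀ x ∈ f.coeff.support, φ x = ψ x) : expect φ f = expect ψ f := by
  rw [expect_apply, expect_apply]
  exact Finset.sum_congr rfl fun x hx => by rw [h x hx]

theorem expect_mono {φ ψ : G → ℝ} {f : MonoidAlgebra ℝ G} (hf : ∀ x, 0 ≤ f.coeff x)
    (h : ∀ x, φ x ≤ ψ x) : expect φ f ≤ expect ψ f := by
  rw [expect_apply, expect_apply]
  exact Finset.sum_le_sum fun x _ => mul_le_mul_of_nonneg_left (h x) (hf x)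

theorem expect_nonneg {φ : G → ℝ} {f : MonoidAlgebra ℝ G} (hf : ∀ x, 0 ≤ f.coeff x)
    (h : ∀ x, 0 ≤ φ x) : 0 ≤ expect φ f := by
  rw [expect_apply]
  exact Finset.sum_nonneg fun x _ => mul_nonneg (hf x) (h x)

theorem norm_expect_le {E : Type*} [NormedAddCommGroup E] [NormedSpace ℝ E] {φ : G → E}
    {f : MonoidAlgebra ℝ G} (hf : ∀ x, 0 ≤ f.coeff x) :
    ‖expect φ f‖ ≤ expect (fun x => ‖φ x‖) f := by
  rw [expect_apply, expect_apply]
  refine (norm_sum_le _ _).trans (Finset.sum_le_sum fun x _ => ?_)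
  rw [norm_smul, Real.norm_of_nonneg (hf x), smul_eq_mul]

end Expect

/-- A finitely supported symmetric probability measure on a group. -/
structure IsSymmProb {G : Type*} [Group G] (μ : MonoidAlgebra ℝ G) : Prop where
  nonneg : ∀ x, 0 ≤ μ.coeff x
  mass : expect (fun _ => (1 : ℝ)) μ = 1
  symm : ∀ x, μ.coeff x⁻¹ = μ.coeff x

section Walk

variable {G : Type*} [Group G] {μ ν : MonoidAlgebra ℝ G}

theorem mass_mul (f g : MonoidAlgebra ℝ G) : expect (fun _ => (1 : ℝ)) (f * g) =
    expect (fun _ => (1 : ℝ)) f * expect (fun _ => (1 : ℝ)) g := by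
  rw [expect_mul]
  rw [expect_const, smul_eq_mul]

theorem coeff_eq_expect [DecidableEq G] (f : MonoidAlgebra ℝ G) (x : G) :
    f.coeff x = expect (fun y => if y = x then (1 : ℝ) else 0) f := by
  rw [expect_apply]
  simp only [smul_eq_mul, mul_ite, mul_one, mul_zero, Finset.sum_ite_eq']
  split_ifs with h
  · rfl
  · simpa using h

theorem coeff_mul_nonneg (hμ : ∀ x, 0 ≤ μ.coeff x) (hν : ∀ x, 0 ≤ ν.coeff x) (x : G) :
    0 ≤ (μ * ν).coeff x := by
  classical
  rw [coeff_eq_expect, expect_mul]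
  refine expect_nonneg hμ fun y => expect_nonneg hν fun z => ?_
  split_ifs <;> norm_num

theorem coeff_one_nonneg (x : G) : 0 ≤ (1 : MonoidAlgebra ℝ G).coeff x := by
  classical
  rw [coeff_eq_expect, expect_one]
  split_ifs <;> norm_num

theorem IsSymmProb.pow_nonneg (hμ : IsSymmProb μ) (n : ℕ) (x : G) : 0 ≤ (μ ^ n).coeff x := by
  induction n generalizing x with
  | zero => rw [pow_zero]; exact coeff_one_nonneg x
  | succ n ih => rw [pow_succ]; exact coeff_mul_nonneg ih hμ.nonneg x

theorem IsSymmProb.mass_pow (hμ : IsSymmProb μ) (n : ℕ) :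
    expect (fun _ => (1 : ℝ)) (μ ^ n) = 1 := by
  induction n with
  | zero => simp
  | succ n ih => rw [pow_succ, mass_mul, ih, hμ.mass, one_mul]

theorem IsSymmProb.expect_const (hμ : IsSymmProb μ) (n : ℕ) {V : Type*} [AddCommGroup V]
    [Module ℝ V] (v : V) : expect (fun _ => v) (μ ^ n) = v := by
  rw [RandomWalk.expect_const, hμ.mass_pow, one_smul]

theorem IsSymmProb.expect_const' (hμ : IsSymmProb μ) {V : Type*} [AddCommGroup V]
    [Module ℝ V] (v : V) : expect (fun _ => v) μ = v := by
  rw [RandomWalk.expect_const, hμ.mass, one_smul]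

end Walk

section Completion

open UniformSpace

/-- A linear isometry extends to the completion. -/
noncomputable def completionIsometry {E : Type*} [SeminormedAddCommGroup E]
    [InnerProductSpace ℝ E] (f : E →ₗᵢ[ℝ] E) :
    Completion E →ₗᵢ[ℝ] Completion E where
  toFun := Completion.map f
  map_add' x y := by
    refine Completion.induction_on₂ x y (isClosed_eq ?_ ?_) fun a b => ?_
    · exact (Completion.continuous_map (f := f)).comp continuous_add
    · exact ((Completion.continuous_map (f := f)).comp continuous_fst).add
        ((Completion.continuous_map (f := f)).comp continuous_snd)
    · rw [← Completion.coe_add, Completion.map_coe f.isometry.uniformContinuous,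
        Completion.map_coe f.isometry.uniformContinuous,
        Completion.map_coe f.isometry.uniformContinuous, map_add, Completion.coe_add]
  map_smul' c x := by
    refine Completion.induction_on x (isClosed_eq ?_ ?_) fun a => ?_
    · exact (Completion.continuous_map (f := f)).comp (continuous_const_smul c)
    · exact (continuous_const_smul c).comp (Completion.continuous_map (f := f))
    · rw [← Completion.coe_smul, Completion.map_coe f.isometry.uniformContinuous,
        Completion.map_coe f.isometry.uniformContinuous, map_smul, Completion.coe_smul]; rfl
  norm_map' x := by
    refine Completion.induction_on x (isClosed_eq ?_ ?_) fun a => ?_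
    · exact (Completion.continuous_map).norm
    · exact continuous_norm
    · change ‖Completion.map f a‖ = _
      rw [Completion.map_coe f.isometry.uniformContinuous, Completion.norm_coe,
        Completion.norm_coe, f.norm_map]

theorem completionIsometry_coe {E : Type*} [SeminormedAddCommGroup E]
    [InnerProductSpace ℝ E] (f : E →ₗᵢ[ℝ] E) (x : E) :
    completionIsometry f (x : Completion E) = (f x : E) :=
  Completion.map_coe f.isometry.uniformContinuous x

/-- The extension of an isometric representation to the completion. -/
noncomputable def completionRep {G E : Type*} [Group G] [SeminormedAddCommGroup E]
    [InnerProductSpace ℝ E] (π : G →* (E →ₗᵢ[ℝ] E)) :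
    G →* (Completion E →ₗᵢ[ℝ] Completion E) where
  toFun g := completionIsometry (π g)
  map_one' := by
    ext x
    refine Completion.induction_on x (isClosed_eq ?_ ?_) fun a => ?_
    · exact (completionIsometry (π 1)).continuous
    · exact continuous_id
    · rw [completionIsometry_coe, map_one]; rfl
  map_mul' g h := by
    ext x
    refine Completion.induction_on x (isClosed_eq ?_ ?_) fun a => ?_
    · exact (completionIsometry (π (g * h))).continuous
    · exact ((completionIsometry (π g)).continuous.comp (completionIsometry (π h)).continuous)
    · change _ = completionIsometry (π g) (completionIsometry (π h) _)
      rw [completionIsometry_coe, completionIsometry_coe, completionIsometry_coe, map_mul]; rfl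

theorem completionRep_coe {G E : Type*} [Group G] [SeminormedAddCommGroup E]
    [InnerProductSpace ℝ E] (π : G →* (E →ₗᵢ[ℝ] E)) (g : G) (x : E) :
    completionRep π g (x : Completion E) = (π g x : E) :=
  completionIsometry_coe _ _

end Completion

section Ergodic

variable {G : Type*} [Group G] {μ : MonoidAlgebra ℝ G} {K : Type*} [NormedAddCommGroup K]
  [InnerProductSpace ℝ K]

/-- The averaging operator of an isometric representation along a measure. -/
noncomputable def averaging (τ : G →* (K →ₗᵢ[ℝ] K)) (μ : MonoidAlgebra ℝ G) : K →L[ℝ] K :=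
  expect (fun x => (τ x).toContinuousLinearMap) μ

theorem averaging_apply (τ : G →* (K →ₗᵢ[ℝ] K)) (μ : MonoidAlgebra ℝ G) (v : K) :
    averaging τ μ v = expect (fun x => τ x v) μ := by
  simp [averaging, expect_apply]

theorem averaging_mul (τ : G →* (K →ₗᵢ[ℝ] K)) (μ ν : MonoidAlgebra ℝ G) (v : K) :
    averaging τ (μ * ν) v = averaging τ μ (averaging τ ν v) := by
  rw [averaging_apply, expect_mul, averaging_apply, averaging_apply]
  refine expect_congr fun x _ => ?_
  rw [← LinearIsometry.coe_toLinearMap, ← expect_map]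
  refine expect_congr fun y _ => ?_
  rw [map_mul]; rfl

theorem averaging_pow_iterate (τ : G →* (K →ₗᵢ[ℝ] K)) (μ : MonoidAlgebra ℝ G) (n : ℕ) (v : K) :
    averaging τ (μ ^ n) v = (averaging τ μ)^[n] v := by
  induction n with
  | zero => simp [averaging_apply]
  | succ n ih => rw [pow_succ', averaging_mul, ih, Function.iterate_succ_apply']

theorem norm_averaging_le (τ : G →* (K →ₗᵢ[ℝ] K)) (hμ : IsSymmProb μ) : ‖averaging τ μ‖ ≤ 1 := by
  refine ContinuousLinearMap.opNorm_le_bound _ zero_le_one fun v => ?_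
  rw [averaging_apply]
  refine (norm_expect_le hμ.nonneg).trans ?_
  simp [hμ.expect_const']

theorem eq_of_averaging_eq (τ : G →* (K →ₗᵢ[ℝ] K)) (hμ : IsSymmProb μ) {v : K}
    (hv : averaging τ μ v = v) {s : G} (hs : 0 < μ.coeff s) : τ s v = v := by
  have key : expect (fun x => ‖τ x v - v‖ ^ 2) μ = 0 := by
    have h1 : ∀ x, ‖τ x v - v‖ ^ 2 = 2 * ‖v‖ ^ 2 - 2 * ⟪v, τ x v⟫_ℝ := fun x => by
      rw [norm_sub_sq_real, (τ x).norm_map, real_inner_comm]; ring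
    simp_rw [h1]
    rw [expect_sub_fun, hμ.expect_const']
    have h2 := expect_map ((2 : ℝ) • (innerₛₗ ℝ v)) (fun x => τ x v) μ
    rw [← averaging_apply, hv] at h2
    simp only [LinearMap.smul_apply, innerₛₗ_apply_apply, smul_eq_mul] at h2
    rw [h2, real_inner_self_eq_norm_sq]; ring
  rw [expect_apply, Finset.sum_eq_zero_iff_of_nonneg
    (fun x _ => smul_nonneg (hμ.nonneg x) (sq_nonneg _))] at key
  have := key s (by simpa using hs.ne')
  rw [smul_eq_mul, mul_eq_zero, or_iff_right hs.ne', sq_eq_zero_iff, norm_eq_zero, sub_eq_zero]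
    at this
  exact this

theorem exists_tendsto_average [CompleteSpace K] (τ : G →* (K →ₗᵢ[ℝ] K)) (hμ : IsSymmProb μ)
    (v : K) : ∃ R : K, Tendsto (fun n : ℕ => (n : ℝ)⁻¹ • ∑ k ∈ Finset.range n,
      averaging τ (μ ^ k) v) atTop (𝓝 R) ∧ ∀ s, 0 < μ.coeff s → τ s R = R := by
  have h := ContinuousLinearMap.tendsto_birkhoffAverage_orthogonalProjection (averaging τ μ)
    (norm_averaging_le τ hμ) v
  refine ⟨_, h.congr fun n => ?_, fun s hs => eq_of_averaging_eq τ hμ ?_ hs⟩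
  · simp [birkhoffAverage, birkhoffSum, averaging_pow_iterate]
  · exact (((averaging τ μ).eqLocus (1 : K →L[ℝ] K)).orthogonalProjectionOnto v).2

end Ergodic

end RandomWalk

namespace RandomWalk

open scoped InnerProductSpace Topology

variable {G : Type*} [Group G] {μ : MonoidAlgebra ℝ G}

/-- The Shannon entropy of a finitely supported measure. -/
noncomputable def entropy (f : MonoidAlgebra ℝ G) : ℝ :=
  ∑ x ∈ f.coeff.support, Real.negMulLog (f.coeff x)

theorem entropy_eq_of_subset (f : MonoidAlgebra ℝ G) {s : Finset G}
    (h : f.coeff.support ⊆ s) : entropy f = ∑ x ∈ s, Real.negMulLog (f.coeff x) := by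
  refine Finset.sum_subset h fun x _ hx => ?_
  rw [Finsupp.notMem_support_iff.1 hx, Real.negMulLog_zero]

theorem sqrt_sub_sqrt_sq_le_mul_log {p q : ℝ} (hp : 0 ≤ p) (hq : 0 ≤ q) (h : q = 0 → p = 0) :
    p - q + (√p - √q) ^ 2 ≤ -Real.negMulLog p - p * Real.log q := by
  rcases hp.eq_or_lt with rfl | hp
  · simp [Real.negMulLog_zero, Real.sq_sqrt hq]
  have hq : 0 < q := hq.lt_of_ne fun h0 => hp.ne' (h h0.symm)
  have h1 : Real.log (√q / √p) ≤ √q / √p - 1 :=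
    Real.log_le_sub_one_of_pos (div_pos (Real.sqrt_pos.2 hq) (Real.sqrt_pos.2 hp))
  rw [Real.log_div (Real.sqrt_pos.2 hq).ne' (Real.sqrt_pos.2 hp).ne', Real.log_sqrt hq.le,
    Real.log_sqrt hp.le] at h1
  have h2 : p * (√q / √p) = √p * √q := by
    rw [← mul_div_assoc, div_eq_iff (Real.sqrt_pos.2 hp).ne', mul_right_comm,
      Real.mul_self_sqrt hp.le]
  have h3 := mul_le_mul_of_nonneg_left h1 hp.le
  have h4 : p * (√q / √p - 1) = √p * √q - p := by rw [mul_sub, h2, mul_one]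
  rw [h4] at h3
  rw [Real.negMulLog, sub_sq, Real.sq_sqrt hp.le, Real.sq_sqrt hq.le]
  nlinarith

theorem entropy_le_log_card {f : MonoidAlgebra ℝ G} (hf : ∀ x, 0 ≤ f.coeff x)
    (hm : expect (fun _ => (1 : ℝ)) f = 1) {s : Finset G} (h : f.coeff.support ⊆ s) :
    entropy f ≤ Real.log s.card := by
  rw [entropy_eq_of_subset f h]
  rw [expect_apply_of_subset _ f h] at hm
  simp only [smul_eq_mul, mul_one] at hm
  have hs : 0 < (s.card : ℝ) := by
    rcases s.eq_empty_or_nonempty with rfl | hs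
    · simp at hm
    · exact_mod_cast hs.card_pos
  have key : ∀ x ∈ s, f.coeff x - (s.card : ℝ)⁻¹ ≤
      -Real.negMulLog (f.coeff x) + f.coeff x * Real.log s.card := fun x _ => by
    have := sqrt_sub_sqrt_sq_le_mul_log (hf x) (inv_pos.2 hs).le
      fun h0 => absurd h0 (inv_pos.2 hs).ne'
    rw [Real.log_inv] at this
    nlinarith [sq_nonneg (√(f.coeff x) - √((s.card : ℝ)⁻¹))]
  have := Finset.sum_le_sum key
  rw [Finset.sum_sub_distrib, Finset.sum_add_distrib, hm, ← Finset.sum_mul, hm,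
    Finset.sum_neg_distrib, Finset.sum_const, nsmul_eq_mul, mul_inv_cancel₀ hs.ne'] at this
  linarith

theorem coeff_single_mul_inv_mul (f : MonoidAlgebra ℝ G) (s x : G) :
    (MonoidAlgebra.single s 1 * f).coeff x = f.coeff (s⁻¹ * x) := by
  classical
  rw [coeff_eq_expect, expect_mul, expect_single, one_smul, coeff_eq_expect]
  refine expect_congr fun y _ => ?_
  simp [eq_inv_mul_iff_mul_eq]

theorem coeff_mul_eq_sum (f g : MonoidAlgebra ℝ G) (x : G) :
    (f * g).coeff x = ∑ s ∈ f.coeff.support, f.coeff s * g.coeff (s⁻¹ * x) := by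
  classical
  rw [coeff_eq_expect, expect_mul, expect_apply]
  refine Finset.sum_congr rfl fun s _ => ?_
  rw [smul_eq_mul, coeff_eq_expect g]
  congr 1
  refine expect_congr fun y _ => ?_
  simp [eq_inv_mul_iff_mul_eq]

theorem entropy_single_mul (f : MonoidAlgebra ℝ G) (s : G) :
    entropy (MonoidAlgebra.single s 1 * f) = entropy f := by
  refine (Finset.sum_bij' (fun x _ => s * x) (fun x _ => s⁻¹ * x) ?_ ?_ ?_ ?_ ?_).symm <;>
  simp

/-- The Hellinger distance between a translate of a measure and its convolution is controlled by
the increment of the entropy. -/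
theorem exists_hellinger_le (hμ : IsSymmProb μ) {f : MonoidAlgebra ℝ G}
    (hf : ∀ x, 0 ≤ f.coeff x) (hm : expect (fun _ => (1 : ℝ)) f = 1) {s : G}
    (hs : 0 < μ.coeff s) : ∃ B : Finset G,
    (MonoidAlgebra.single s 1 * f).coeff.support ⊆ B ∧ (μ * f).coeff.support ⊆ B ∧
    μ.coeff s * ∑ x ∈ B, (√((MonoidAlgebra.single s 1 * f).coeff x) - √((μ * f).coeff x)) ^ 2 ≤
      entropy (μ * f) - entropy f := by
  classical
  let B : Finset G := μ.coeff.support.biUnion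
    (fun t => (MonoidAlgebra.single t 1 * f).coeff.support) ∪ (μ * f).coeff.support
  have hB : ∀ t ∈ μ.coeff.support, (MonoidAlgebra.single t 1 * f).coeff.support ⊆ B :=
    fun t ht => (Finset.subset_biUnion_of_mem
      (fun t => (MonoidAlgebra.single t 1 * f).coeff.support) ht).trans Finset.subset_union_left
  have hB' : (μ * f).coeff.support ⊆ B := Finset.subset_union_right
  have hs' : s ∈ μ.coeff.support := by simpa using hs.ne'
  refine ⟨B, hB s hs', hB', ?_⟩
  let D : G → ℝ := fun t =>
    ∑ x ∈ B, (√((MonoidAlgebra.single t 1 * f).coeff x) - √((μ * f).coeff x)) ^ 2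
  have h1 : ∀ t ∈ μ.coeff.support, μ.coeff t * D t ≤ μ.coeff t * (-entropy f) -
      ∑ x ∈ B, (μ.coeff t * f.coeff (t⁻¹ * x)) * Real.log ((μ * f).coeff x) := by
    intro t ht
    have hpt : 0 < μ.coeff t := (hμ.nonneg t).lt_of_ne (Finsupp.mem_support_iff.1 ht).symm
    simp_rw [mul_assoc]
    rw [← Finset.mul_sum, ← mul_sub]
    refine mul_le_mul_of_nonneg_left ?_ hpt.le
    rw [← entropy_single_mul f t, entropy_eq_of_subset _ (hB t ht), ← Finset.sum_neg_distrib,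
      ← Finset.sum_sub_distrib]
    have h3 : ∑ x ∈ B, ((MonoidAlgebra.single t 1 * f).coeff x - (μ * f).coeff x) = 0 := by
      rw [Finset.sum_sub_distrib]
      have e1 := expect_apply_of_subset (fun _ => (1 : ℝ)) _ (hB t ht)
      have e2 := expect_apply_of_subset (fun _ => (1 : ℝ)) _ hB'
      rw [mass_mul, hm] at e1 e2
      rw [hμ.mass] at e2
      simp only [expect_single, smul_eq_mul, mul_one] at e1 e2
      rw [← e1, ← e2, sub_self]
    rw [← zero_add (D t), ← h3]
    simp only [D]
    rw [← Finset.sum_add_distrib]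
    refine Finset.sum_le_sum fun x _ => ?_
    have h4 := sqrt_sub_sqrt_sq_le_mul_log (p := (MonoidAlgebra.single t 1 * f).coeff x)
      (q := (μ * f).coeff x) (by rw [coeff_single_mul_inv_mul]; exact hf _)
      (coeff_mul_nonneg hμ.nonneg hf x) (fun h0 => by
        rw [coeff_mul_eq_sum, Finset.sum_eq_zero_iff_of_nonneg
          (fun y _ => mul_nonneg (hμ.nonneg y) (hf _))] at h0
        have := h0 t ht
        rw [mul_eq_zero, or_iff_right hpt.ne'] at this
        rw [coeff_single_mul_inv_mul, this])
    rwa [coeff_single_mul_inv_mul] at h4 ⊢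
  have h2 := Finset.sum_le_sum h1
  rw [Finset.sum_sub_distrib, Finset.sum_comm] at h2
  simp_rw [← Finset.sum_mul, ← coeff_mul_eq_sum] at h2
  have hm' := hμ.mass
  rw [expect_apply] at hm'
  simp only [smul_eq_mul, mul_one] at hm'
  rw [hm', one_mul] at h2
  have h5 : entropy (μ * f) = - ∑ x ∈ B, (μ * f).coeff x * Real.log ((μ * f).coeff x) := by
    rw [entropy_eq_of_subset _ hB', ← Finset.sum_neg_distrib]
    simp [Real.negMulLog]
  have h6 : μ.coeff s * D s ≤ ∑ t ∈ μ.coeff.support, μ.coeff t * D t :=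
    Finset.single_le_sum (f := fun t => μ.coeff t * D t)
      (fun t _ => mul_nonneg (hμ.nonneg t) (Finset.sum_nonneg fun x _ => sq_nonneg _)) hs'
  change μ.coeff s * D s ≤ _
  linarith

theorem sq_expect_sub_le (hμ : IsSymmProb μ) {f : MonoidAlgebra ℝ G}
    (hf : ∀ x, 0 ≤ f.coeff x) (hm : expect (fun _ => (1 : ℝ)) f = 1) {s : G}
    (hs : 0 < μ.coeff s) (φ : G → ℝ) :
    (expect φ (MonoidAlgebra.single s 1 * f) - expect φ (μ * f)) ^ 2 ≤
      2 * ((entropy (μ * f) - entropy f) / μ.coeff s) *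
        (expect (fun x => φ x ^ 2) (MonoidAlgebra.single s 1 * f) +
          expect (fun x => φ x ^ 2) (μ * f)) := by
  obtain ⟨B, h1, h2, h3⟩ := exists_hellinger_le hμ hf hm hs
  have h3' : ∑ x ∈ B, (√((MonoidAlgebra.single s 1 * f).coeff x) - √((μ * f).coeff x)) ^ 2 ≤
      (entropy (μ * f) - entropy f) / μ.coeff s := by
    rw [le_div_iff₀ hs]; linarith
  rw [expect_apply_of_subset _ _ h1, expect_apply_of_subset _ _ h2,
    expect_apply_of_subset _ _ h1, expect_apply_of_subset _ _ h2, ← Finset.sum_sub_distrib,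
    ← Finset.sum_add_distrib]
  simp only [smul_eq_mul]
  generalize hp : (MonoidAlgebra.single s 1 * f).coeff = p at *
  have hp0 : ∀ x, 0 ≤ p x := fun x => by
    rw [← hp, coeff_single_mul_inv_mul]; exact hf _
  have hq0 : ∀ x, 0 ≤ (μ * f).coeff x := coeff_mul_nonneg hμ.nonneg hf
  generalize (μ * f).coeff = q at *
  have e : ∀ x, p x * φ x - q x * φ x = (√(p x) - √(q x)) * ((√(p x) + √(q x)) * φ x) := by
    intro x
    rw [← mul_assoc, ← sub_mul]
    congr 1
    nlinarith [Real.mul_self_sqrt (hp0 x), Real.mul_self_sqrt (hq0 x)]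
  simp_rw [e]
  refine (Finset.sum_mul_sq_le_sq_mul_sq _ _ _).trans ?_
  have h4 : ∑ x ∈ B, ((√(p x) + √(q x)) * φ x) ^ 2 ≤
      2 * ∑ x ∈ B, (p x * φ x ^ 2 + q x * φ x ^ 2) := by
    rw [Finset.mul_sum]
    refine Finset.sum_le_sum fun x _ => ?_
    rw [mul_pow, ← add_mul, ← mul_assoc]
    refine mul_le_mul_of_nonneg_right ?_ (sq_nonneg _)
    nlinarith [Real.sq_sqrt (hp0 x), Real.sq_sqrt (hq0 x), sq_nonneg (√(p x) - √(q x))]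
  have h5 : 0 ≤ ∑ x ∈ B, ((√(p x) + √(q x)) * φ x) ^ 2 :=
    Finset.sum_nonneg fun x _ => sq_nonneg _
  have h6 : 0 ≤ (entropy (μ * f) - entropy f) / μ.coeff s :=
    (Finset.sum_nonneg fun x _ => sq_nonneg _).trans h3'
  calc _ ≤ ((entropy (μ * f) - entropy f) / μ.coeff s) *
        (2 * ∑ x ∈ B, (p x * φ x ^ 2 + q x * φ x ^ 2)) :=
        mul_le_mul h3' h4 h5 h6
    _ = _ := by ring

/-- A sequence growing at most logarithmically has infinitely many small increments. -/
theorem frequently_increment_le {h : ℕ → ℝ} {d C : ℝ} (hd0 : 0 ≤ d)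
    (hh : ∀ n : ℕ, 1 ≤ n → h n ≤ d * Real.log n + C) :
    ∃ᶠ n : ℕ in atTop, h (n + 1) - h n ≤ (d + 1) / n := by
  intro hcon
  rw [eventually_atTop] at hcon
  obtain ⟨a, ha⟩ := hcon
  have hd : 0 < d + 1 := by linarith
  let m := max a 1
  have hm1 : 1 ≤ m := le_max_right _ _
  have hlow : ∀ k : ℕ, h m + (d + 1) * (Real.log (m + k : ℕ) - Real.log m) ≤ h (m + k) := by
    intro k
    induction k with
    | zero => simp
    | succ k ih =>
      have h1 := ha (m + k) ((le_max_left a 1).trans (Nat.le_add_right _ _))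
      push Not at h1
      have hpos : (0 : ℝ) < (m + k : ℕ) := by exact_mod_cast (by omega : 0 < m + k)
      have h2 : Real.log ((m + (k + 1) : ℕ) : ℝ) - Real.log (m + k : ℕ) ≤ 1 / (m + k : ℕ) := by
        rw [← Real.log_div (by positivity) hpos.ne']
        refine (Real.log_le_sub_one_of_pos (by positivity)).trans (le_of_eq ?_)
        rw [← add_assoc]
        push_cast at hpos ⊢
        field_simp
        ring
      have h3 := mul_le_mul_of_nonneg_left h2 hd.le
      rw [mul_one_div] at h3
      rw [← add_assoc]
      rw [← add_assoc] at h3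
      linarith
  have hlim : Tendsto (fun n : ℕ => Real.log n) atTop atTop :=
    Real.tendsto_log_atTop.comp tendsto_natCast_atTop_atTop
  have hlim2 := (tendsto_add_atTop_iff_nat m).2 hlim
  obtain ⟨k, hk⟩ := (hlim2.eventually_gt_atTop (C - h m + (d + 1) * Real.log m)).exists
  have h1 := hlow k
  have h2 := hh (m + k) (by omega)
  rw [add_comm k m] at hk
  linarith

end RandomWalk

namespace RandomWalk

open scoped InnerProductSpace Topology TensorProduct

variable {G : Type*} [Group G] {μ : MonoidAlgebra ℝ G}
variable {H : Type*} [NormedAddCommGroup H] [InnerProductSpace ℝ H]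

theorem expect_inner (φ : G → H) (f : MonoidAlgebra ℝ G) (v : H) :
    expect (fun x => ⟪φ x, v⟫_ℝ) f = ⟪expect φ f, v⟫_ℝ := by
  simp_rw [real_inner_comm v]
  exact expect_map (innerₛₗ ℝ v) φ f

theorem expect_clm {H' : Type*} [NormedAddCommGroup H'] [NormedSpace ℝ H'] (L : H →L[ℝ] H')
    (φ : G → H) (f : MonoidAlgebra ℝ G) : expect (fun x => L (φ x)) f = L (expect φ f) :=
  expect_map L.toLinearMap φ f

theorem expect_mul_left (c : ℝ) (φ : G → ℝ) (f : MonoidAlgebra ℝ G) :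
    expect (fun x => c * φ x) f = c * expect φ f :=
  expect_map (LinearMap.lsmul ℝ ℝ c) φ f

/-- A cocycle with values in an orthogonal representation. -/
def IsCocycle (π : G →* (H →ₗᵢ[ℝ] H)) (b : G → H) : Prop :=
  ∀ x y, b (x * y) = b x + π x (b y)

section Cocycle

variable {π : G →* (H →ₗᵢ[ℝ] H)} {b : G → H}

theorem IsCocycle.expect_mul (hb : IsCocycle π b) (f g : MonoidAlgebra ℝ G)
    (hg : expect (fun _ => (1 : ℝ)) g = 1) :
    expect b (f * g) = expect b f + expect (fun x => π x (expect b g)) f := by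
  rw [RandomWalk.expect_mul, ← expect_add_fun]
  refine expect_congr fun x _ => ?_
  simp_rw [hb x]
  rw [expect_add_fun, RandomWalk.expect_const, hg, one_smul]
  congr 1
  exact expect_clm (π x).toContinuousLinearMap b g

theorem IsCocycle.map_one (hb : IsCocycle π b) : b 1 = 0 := by
  have := hb 1 1
  rw [mul_one, _root_.map_one] at this
  simpa using this

theorem IsCocycle.expect_pow (hb : IsCocycle π b) (hμ : IsSymmProb μ) (h0 : expect b μ = 0)
    (n : ℕ) : expect b (μ ^ n) = 0 := by
  induction n with
  | zero => simp [hb.map_one]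
  | succ n ih =>
    rw [pow_succ, hb.expect_mul _ _ hμ.mass, ih, h0, zero_add]
    simp only [map_zero]
    rw [RandomWalk.expect_const, smul_zero]

variable (π) in
/-- The diagonal representation on the completed tensor square. -/
noncomputable def tensorRep : G →* (UniformSpace.Completion (H ⊗[ℝ] H) →ₗᵢ[ℝ]
    UniformSpace.Completion (H ⊗[ℝ] H)) :=
  completionRep
    { toFun := fun g => TensorProduct.mapIsometry (π g) (π g)
      map_one' := by
        rw [_root_.map_one]
        exact TensorProduct.mapIsometry_id_id
      map_mul' := fun x y => by
        ext v
        rw [_root_.map_mul]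
        change TensorProduct.map ((π x).toLinearMap ∘ₗ (π y).toLinearMap)
          ((π x).toLinearMap ∘ₗ (π y).toLinearMap) v = _
        rw [TensorProduct.map_comp]
        rfl }

/-- Pure tensors in the completed tensor square, as a continuous bilinear map. -/
noncomputable def pureTensor (u v : H) : UniformSpace.Completion (H ⊗[ℝ] H) :=
  ((u ⊗ₜ[ℝ] v : H ⊗[ℝ] H) : UniformSpace.Completion (H ⊗[ℝ] H))

theorem inner_pureTensor (u v u' v' : H) :
    ⟪pureTensor u v, pureTensor u' v'⟫_ℝ = ⟪u, u'⟫_ℝ * ⟪v, v'⟫_ℝ := by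
  simp [pureTensor]

theorem norm_pureTensor (u v : H) : ‖pureTensor u v‖ = ‖u‖ * ‖v‖ := by
  simp [pureTensor]

theorem tensorRep_pureTensor (g : G) (u v : H) :
    tensorRep π g (pureTensor u v) = pureTensor (π g u) (π g v) := by
  rw [tensorRep, pureTensor, completionRep_coe]
  rfl

/-- Pure tensors as a bilinear map. -/
noncomputable def pureTensorHom : H →ₗ[ℝ] H →ₗ[ℝ] UniformSpace.Completion (H ⊗[ℝ] H) :=
  (TensorProduct.mk ℝ H H).compr₂
    (UniformSpace.Completion.toComplL (𝕜 := ℝ) (E := H ⊗[ℝ] H)).toLinearMap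

theorem pureTensorHom_apply (u v : H) : pureTensorHom u v = pureTensor u v := rfl

theorem IsCocycle.expect_tensorSq_mul (hb : IsCocycle π b) (f g : MonoidAlgebra ℝ G)
    (hg : expect (fun _ => (1 : ℝ)) g = 1) (h0 : expect b g = 0) :
    expect (fun x => pureTensor (b x) (b x)) (f * g) =
      expect (fun x => pureTensor (b x) (b x)) f +
        averaging (tensorRep π) f (expect (fun x => pureTensor (b x) (b x)) g) := by
  rw [RandomWalk.expect_mul, averaging_apply, ← expect_add_fun]
  refine expect_congr fun x _ => ?_
  have h1 : ∀ y, pureTensor (b (x * y)) (b (x * y)) = pureTensor (b x) (b x) +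
      (pureTensorHom (b x) (π x (b y)) + pureTensorHom.flip (b x) (π x (b y))) +
      tensorRep π x (pureTensor (b y) (b y)) := by
    intro y
    rw [tensorRep_pureTensor, hb, ← pureTensorHom_apply, ← pureTensorHom_apply,
      ← pureTensorHom_apply, LinearMap.flip_apply]
    simp only [map_add, LinearMap.add_apply]
    abel
  simp_rw [h1]
  have h2 : expect (fun y => π x (b y)) g = 0 := by
    rw [show expect (fun y => π x (b y)) g = π x (expect b g) from
      expect_clm (π x).toContinuousLinearMap b g, h0, map_zero]
  rw [expect_add_fun, expect_add_fun, expect_add_fun, expect_map (pureTensorHom (b x)),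
    expect_map (pureTensorHom.flip (b x)), h2, RandomWalk.expect_const, hg, one_smul, map_zero,
    map_zero, add_zero, add_zero]
  congr 1
  exact expect_clm (tensorRep π x).toContinuousLinearMap _ g

theorem IsCocycle.expect_tensorSq_pow (hb : IsCocycle π b) (hμ : IsSymmProb μ)
    (h0 : expect b μ = 0) (n : ℕ) :
    expect (fun x => pureTensor (b x) (b x)) (μ ^ n) = ∑ k ∈ Finset.range n,
      averaging (tensorRep π) (μ ^ k) (expect (fun x => pureTensor (b x) (b x)) μ) := by
  induction n with
  | zero =>
    simp only [pow_zero, expect_one, hb.map_one, Finset.range_zero, Finset.sum_empty]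
    rw [← pureTensorHom_apply, map_zero]
  | succ n ih => rw [pow_succ, hb.expect_tensorSq_mul _ _ hμ.mass h0, ih, Finset.sum_range_succ]

theorem expect_sq_inner (f : MonoidAlgebra ℝ G) (v : H) :
    expect (fun x => ⟪b x, v⟫_ℝ ^ 2) f =
      ⟪expect (fun x => pureTensor (b x) (b x)) f, pureTensor v v⟫_ℝ := by
  rw [← expect_inner]
  simp_rw [inner_pureTensor, sq]

/-- A bound for a harmonic cocycle in terms of the mean square displacement, along times at which
the entropy increment is small. -/
theorem IsCocycle.sq_inner_le (hb : IsCocycle π b) (hμ : IsSymmProb μ) (h0 : expect b μ = 0)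
    {s : G} (hs : 0 < μ.coeff s) (v : H) {n : ℕ} :
    ⟪b s, v⟫_ℝ ^ 2 ≤ 2 * ((entropy (μ ^ (n + 1)) - entropy (μ ^ n)) / μ.coeff s) *
      (2 * ⟪b s, v⟫_ℝ ^ 2 + 2 * ⟪tensorRep π s (expect (fun x => pureTensor (b x) (b x)) (μ ^ n)),
        pureTensor v v⟫_ℝ +
        ⟪expect (fun x => pureTensor (b x) (b x)) (μ ^ (n + 1)), pureTensor v v⟫_ℝ) := by
  have h := sq_expect_sub_le hμ (hμ.pow_nonneg n) (hμ.mass_pow n) hs (fun x => ⟪b x, v⟫_ℝ)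
  obtain ⟨B, -, -, h3⟩ := exists_hellinger_le hμ (hμ.pow_nonneg n) (hμ.mass_pow n) hs
  rw [← pow_succ'] at h h3
  have hinc : 0 ≤ (entropy (μ ^ (n + 1)) - entropy (μ ^ n)) / μ.coeff s := by
    refine div_nonneg (le_trans ?_ h3) hs.le
    exact mul_nonneg hs.le (Finset.sum_nonneg fun x _ => sq_nonneg _)
  rw [expect_inner, expect_inner, hb.expect_mul _ _ (hμ.mass_pow n), hb.expect_pow hμ h0,
    hb.expect_pow hμ h0, expect_sq_inner (μ ^ (n + 1))] at h
  simp only [expect_single, one_smul, map_zero, add_zero, inner_zero_left, sub_zero] at h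
  refine h.trans (mul_le_mul_of_nonneg_left (add_le_add ?_ le_rfl) (by positivity))
  rw [RandomWalk.expect_mul, expect_single, one_smul]
  have h1 : ⟪tensorRep π s (expect (fun x => pureTensor (b x) (b x)) (μ ^ n)),
      pureTensor v v⟫_ℝ = expect (fun x => ⟪π s (b x), v⟫_ℝ ^ 2) (μ ^ n) := by
    rw [← LinearIsometry.coe_toContinuousLinearMap, ← expect_clm, ← expect_inner]
    refine expect_congr fun x _ => ?_
    rw [LinearIsometry.coe_toContinuousLinearMap, tensorRep_pureTensor, inner_pureTensor, sq]
  have h2 : expect (fun x => 2 * ⟪b s, v⟫_ℝ ^ 2 + 2 * ⟪π s (b x), v⟫_ℝ ^ 2) (μ ^ n) =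
      2 * ⟪b s, v⟫_ℝ ^ 2 + 2 * expect (fun x => ⟪π s (b x), v⟫_ℝ ^ 2) (μ ^ n) := by
    rw [expect_add_fun, hμ.expect_const, expect_mul_left]
  rw [h1, ← h2]
  refine expect_mono (hμ.pow_nonneg n) fun x => ?_
  rw [hb, inner_add_left]
  nlinarith [sq_nonneg (⟪b s, v⟫_ℝ - ⟪π s (b x), v⟫_ℝ)]

end Cocycle

end RandomWalk

namespace RandomWalk

open scoped InnerProductSpace Topology TensorProduct

variable {G : Type*} [Group G] {μ : MonoidAlgebra ℝ G}
variable {H : Type*} [NormedAddCommGroup H] [InnerProductSpace ℝ H]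
variable {π : G →* (H →ₗᵢ[ℝ] H)} {b : G → H}

theorem norm_le_of_inner_eq {T : H →L[ℝ] H} {ζ : UniformSpace.Completion (H ⊗[ℝ] H)}
    (h : ∀ u v, ⟪T u, v⟫_ℝ = ⟪ζ, pureTensor u v⟫_ℝ) : ‖T‖ ≤ ‖ζ‖ := by
  refine ContinuousLinearMap.opNorm_le_of_re_inner_le (𝕜 := ℝ) (norm_nonneg _) fun x y hx hy => ?_
  rw [h]
  refine (real_inner_le_norm ζ (pureTensor x y)).trans ?_
  rw [norm_pureTensor, hx, hy, mul_one, mul_one]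

theorem inner_expect_rankOne (f : MonoidAlgebra ℝ G) (u v : H) :
    ⟪expect (fun x => InnerProductSpace.rankOne ℝ (b x) (b x)) f u, v⟫_ℝ =
      ⟪expect (fun x => pureTensor (b x) (b x)) f, pureTensor u v⟫_ℝ := by
  have h1 : expect (fun x => InnerProductSpace.rankOne ℝ (b x) (b x)) f u =
      expect (fun x => InnerProductSpace.rankOne ℝ (b x) (b x) u) f := by
    simp only [expect_apply, sum_apply, smul_apply]
  rw [h1, ← expect_inner, ← expect_inner]
  refine expect_congr fun x _ => ?_
  rw [inner_pureTensor, InnerProductSpace.rankOne_apply, inner_smul_left]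
  rfl

theorem isCompactOperator_expect_rankOne (f : MonoidAlgebra ℝ G) :
    IsCompactOperator (expect (fun x => InnerProductSpace.rankOne ℝ (b x) (b x)) f) := by
  rw [expect_apply]
  suffices h : ∀ s : Finset G, IsCompactOperator
      (∑ x ∈ s, f.coeff x • InnerProductSpace.rankOne ℝ (b x) (b x) : H →L[ℝ] H) from h _
  intro s
  classical
  induction s using Finset.induction_on with
  | empty => exact isCompactOperator_zero
  | insert a s ha ih =>
    rw [Finset.sum_insert ha]
    refine IsCompactOperator.add (IsCompactOperator.smul ?_ _) ih
    rw [InnerProductSpace.rankOne_def']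
    exact (isCompactOperator_of_locallyCompactSpace_dom (innerSL ℝ (b a))).clm_comp
      (ContinuousLinearMap.toSpanSingleton ℝ (b a))

/-- The asymptotic mean square displacement of a harmonic cocycle. -/
theorem IsCocycle.exists_limit_tensor (hb : IsCocycle π b) (hμ : IsSymmProb μ)
    (h0 : expect b μ = 0) (hgen : Subgroup.closure {s | 0 < μ.coeff s} = ⊤)
    {d C : ℝ} (hd : 0 ≤ d) (hent : ∀ n : ℕ, 1 ≤ n → entropy (μ ^ n) ≤ d * Real.log n + C) :
    ∃ R : UniformSpace.Completion (H ⊗[ℝ] H),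
      Tendsto (fun n : ℕ => (n : ℝ)⁻¹ • expect (fun x => pureTensor (b x) (b x)) (μ ^ n))
        atTop (𝓝 R) ∧ (∀ g, tensorRep π g R = R) ∧
      ∀ s, 0 < μ.coeff s → ∀ v, ⟪b s, v⟫_ℝ ^ 2 ≤
        6 * ((d + 1) / μ.coeff s) * ⟪R, pureTensor v v⟫_ℝ := by
  obtain ⟨R, hR, hinv⟩ := exists_tendsto_average (tensorRep π) hμ
    (expect (fun x => pureTensor (b x) (b x)) μ)
  simp_rw [← hb.expect_tensorSq_pow hμ h0] at hR
  have hinv' : ∀ g, tensorRep π g R = R := by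
    intro g
    have hg : g ∈ Subgroup.closure {s | 0 < μ.coeff s} := hgen ▸ Subgroup.mem_top g
    induction hg using Subgroup.closure_induction with
    | mem s hs => exact hinv s hs
    | one => simp
    | mul x y _ _ hx hy => rw [map_mul]; change tensorRep π x (tensorRep π y R) = R; rw [hy, hx]
    | inv x _ hx =>
      have : tensorRep π (x⁻¹ * x) R = R := by simp
      rw [map_mul] at this
      change tensorRep π x⁻¹ (tensorRep π x R) = R at this
      rwa [hx] at this
  refine ⟨R, hR, hinv', fun s hs v => ?_⟩
  have hfreq := frequently_increment_le hd hent
  set Q : ℕ → UniformSpace.Completion (H ⊗[ℝ] H) := fun n =>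
    expect (fun x => pureTensor (b x) (b x)) (μ ^ n) with hQ
  have hQ0 : ∀ n, 0 ≤ ⟪Q n, pureTensor v v⟫_ℝ := fun n => by
    rw [hQ]
    simp only
    rw [← expect_sq_inner]
    exact expect_nonneg (hμ.pow_nonneg n) fun _ => sq_nonneg _
  have hτ0 : ∀ n, 0 ≤ ⟪tensorRep π s (Q n), pureTensor v v⟫_ℝ := fun n => by
    rw [hQ]
    simp only
    rw [← LinearIsometry.coe_toContinuousLinearMap, ← expect_clm, ← expect_inner]
    refine expect_nonneg (hμ.pow_nonneg n) fun x => ?_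
    rw [LinearIsometry.coe_toContinuousLinearMap, tensorRep_pureTensor, inner_pureTensor]
    exact mul_self_nonneg _
  let F : ℕ → ℝ := fun n => 2 * ((d + 1) / μ.coeff s) * ((n : ℝ)⁻¹ * (2 * ⟪b s, v⟫_ℝ ^ 2) +
    2 * ⟪tensorRep π s ((n : ℝ)⁻¹ • Q n), pureTensor v v⟫_ℝ +
    (((n + 1 : ℕ) : ℝ) * (n : ℝ)⁻¹) * ⟪(((n + 1 : ℕ) : ℝ))⁻¹ • Q (n + 1), pureTensor v v⟫_ℝ)
  have hF : ∃ᶠ n in atTop, ⟪b s, v⟫_ℝ ^ 2 ≤ F n := by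
    refine (hfreq.and_eventually (eventually_ge_atTop 1)).mono fun n ⟨hn, hn1⟩ => ?_
    refine (hb.sq_inner_le hμ h0 hs v (n := n)).trans ?_
    have hn0 : (0 : ℝ) < n := by exact_mod_cast hn1
    have e : F n = 2 * ((d + 1) / n / μ.coeff s) * (2 * ⟪b s, v⟫_ℝ ^ 2 +
        2 * ⟪tensorRep π s (Q n), pureTensor v v⟫_ℝ + ⟪Q (n + 1), pureTensor v v⟫_ℝ) := by
      simp only [F, map_smul, inner_smul_left, RCLike.conj_to_real]
      have : ((n + 1 : ℕ) : ℝ) ≠ 0 := by positivity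
      field_simp
    rw [e]
    have := hQ0 (n + 1)
    have := hτ0 n
    gcongr
  have hlim : Tendsto F atTop (𝓝 (2 * ((d + 1) / μ.coeff s) * (0 * (2 * ⟪b s, v⟫_ℝ ^ 2) +
      2 * ⟪tensorRep π s R, pureTensor v v⟫_ℝ + 1 * ⟪R, pureTensor v v⟫_ℝ))) := by
    have hi : Tendsto (fun n : ℕ => (n : ℝ)⁻¹) atTop (𝓝 0) := tendsto_inv_atTop_nhds_zero_nat
    have hi2 : Tendsto (fun n : ℕ => ((n + 1 : ℕ) : ℝ) * (n : ℝ)⁻¹) atTop (𝓝 1) := by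
      have : Tendsto (fun n : ℕ => 1 + (n : ℝ)⁻¹) atTop (𝓝 (1 + 0)) := hi.const_add 1
      rw [add_zero] at this
      refine this.congr' ?_
      filter_upwards [eventually_gt_atTop 0] with n hn
      have : (n : ℝ) ≠ 0 := by positivity
      push_cast
      field_simp
    have hR' : Tendsto (fun n : ℕ => (((n + 1 : ℕ) : ℝ))⁻¹ • Q (n + 1)) atTop (𝓝 R) :=
      (tendsto_add_atTop_iff_nat 1).2 hR
    have hτ : Tendsto (fun n : ℕ => tensorRep π s ((n : ℝ)⁻¹ • Q n)) atTop
        (𝓝 (tensorRep π s R)) := ((tensorRep π s).continuous.tendsto R).comp hR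
    exact (((hi.mul_const _).add ((hτ.inner tendsto_const_nhds).const_mul 2)).add
      (hi2.mul (hR'.inner tendsto_const_nhds))).const_mul _
  rw [hinv'] at hlim
  have := ge_of_tendsto_of_frequently hlim hF
  linarith

/-- The cocycle version of Shalom's property for groups with slow entropy growth: a nonzero harmonic
cocycle gives an infinite cocycle in a finite-dimensional subrepresentation. -/
theorem IsCocycle.exists_finiteDimensional [CompleteSpace H] (hb : IsCocycle π b)
    (hμ : IsSymmProb μ) (h0 : expect b μ = 0)
    (hgen : Subgroup.closure {s | 0 < μ.coeff s} = ⊤) (hne : ∃ s, 0 < μ.coeff s ∧ b s ≠ 0)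
    {d C : ℝ} (hd : 0 ≤ d) (hent : ∀ n : ℕ, 1 ≤ n → entropy (μ ^ n) ≤ d * Real.log n + C) :
    ∃ E : Submodule ℝ H, FiniteDimensional ℝ E ∧ (∀ g, ∀ v ∈ E, π g v ∈ E) ∧
      ∃ b' : G → H, IsCocycle π b' ∧ (∀ g, b' g ∈ E) ∧ (Set.range b').Infinite := by
  obtain ⟨R, hR, hinv, hle⟩ := hb.exists_limit_tensor hμ h0 hgen hd hent
  let Tn : ℕ → (H →L[ℝ] H) := fun n =>
    (n : ℝ)⁻¹ • expect (fun x => InnerProductSpace.rankOne ℝ (b x) (b x)) (μ ^ n)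
  have hTn : ∀ n u v, ⟪Tn n u, v⟫_ℝ = ⟪(n : ℝ)⁻¹ •
      expect (fun x => pureTensor (b x) (b x)) (μ ^ n), pureTensor u v⟫_ℝ := by
    intro n u v
    simp only [Tn, smul_apply, inner_smul_left, inner_expect_rankOne]
  have hcauchy : CauchySeq Tn := by
    have hc := hR.cauchySeq
    rw [Metric.cauchySeq_iff'] at hc ⊢
    intro ε hε
    obtain ⟨N, hN⟩ := hc ε hε
    refine ⟨N, fun n hn => lt_of_le_of_lt ?_ (hN n hn)⟩
    rw [dist_eq_norm, dist_eq_norm]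
    refine norm_le_of_inner_eq fun u v => ?_
    rw [sub_apply, inner_sub_left, inner_sub_left, hTn, hTn]
  obtain ⟨T, hT⟩ := cauchySeq_tendsto_of_complete hcauchy
  have hTR : ∀ u v, ⟪T u, v⟫_ℝ = ⟪R, pureTensor u v⟫_ℝ := by
    intro u v
    have h1 : Tendsto (fun n => ⟪Tn n u, v⟫_ℝ) atTop (𝓝 ⟪T u, v⟫_ℝ) :=
      (((ContinuousLinearMap.apply ℝ H u).continuous.tendsto T).comp hT).inner tendsto_const_nhds
    simp_rw [hTn] at h1
    exact tendsto_nhds_unique h1 (hR.inner tendsto_const_nhds)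
  have hcompact : IsCompactOperator T :=
    isCompactOperator_of_tendsto hT (Eventually.of_forall fun n =>
      (isCompactOperator_expect_rankOne (μ ^ n)).smul _)
  have hsymm : (T : H →ₗ[ℝ] H).IsSymmetric := by
    intro u v
    change ⟪T u, v⟫_ℝ = ⟪u, T v⟫_ℝ
    rw [← real_inner_comm u (T v), hTR, hTR]
    refine tendsto_nhds_unique (hR.inner tendsto_const_nhds) ?_
    refine (hR.inner (tendsto_const_nhds (x := pureTensor v u))).congr fun n => ?_
    rw [inner_smul_left, inner_smul_left, ← expect_inner, ← expect_inner]
    congr 1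
    refine expect_congr fun x _ => ?_
    rw [inner_pureTensor, inner_pureTensor, mul_comm]
  have hcomm : ∀ g u, T (π g u) = π g (T u) := by
    intro g u
    refine ext_inner_right ℝ fun w => ?_
    have hw : π g (π g⁻¹ w) = w := by
      change (π g * π g⁻¹) w = w
      rw [← map_mul, mul_inv_cancel, _root_.map_one]
      rfl
    rw [← hw, (π g).inner_map_map, hTR, hTR, ← tensorRep_pureTensor]
    nth_rw 1 [← hinv g]
    rw [(tensorRep π g).inner_map_map]
  have hT0 : T ≠ 0 := by
    rintro rfl
    obtain ⟨s, hs, hbs⟩ := hne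
    have h1 := hle s hs (b s)
    rw [← hTR] at h1
    simp only [zero_apply, inner_zero_left, mul_zero] at h1
    exact hbs (inner_self_eq_zero.1 (pow_eq_zero_iff two_ne_zero |>.1
      (le_antisymm h1 (sq_nonneg _))))
  have hev := mt (ContinuousLinearMap.eq_zero_of_forall_hasEigenvalue_eq_zero hcompact
    hsymm).1 hT0
  push Not at hev
  obtain ⟨l, hl, hl0⟩ := hev
  let E := Module.End.eigenspace (T : H →ₗ[ℝ] H) l
  have hEfin : FiniteDimensional ℝ E :=
    ContinuousLinearMap.finite_dimensional_eigenspace hcompact l hl0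
  have hEmem : ∀ v, v ∈ E ↔ T v = l • v := fun v => Module.End.mem_eigenspace_iff
  have hEinv : ∀ g, ∀ v ∈ E, π g v ∈ E := by
    intro g v hv
    rw [hEmem] at hv ⊢
    rw [hcomm, hv, map_smul]
  refine ⟨E, hEfin, hEinv, fun g => E.starProjection (b g), ?_, fun g =>
    E.starProjection_apply_mem _, ?_⟩
  · intro x y
    change E.starProjection (b (x * y)) = E.starProjection (b x) + π x (E.starProjection (b y))
    rw [hb, map_add]
    congr 1
    refine (Submodule.eq_starProjection_of_mem_orthogonal
      (hEinv x (E.starProjection (b y)) (E.starProjection_apply_mem _)) ?_)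
    rw [Submodule.mem_orthogonal']
    intro w hw
    have h2 : π x (π x⁻¹ w) = w := by
      change (π x * π x⁻¹) w = w
      rw [← map_mul, mul_inv_cancel, _root_.map_one]
      rfl
    rw [← h2, ← map_sub, (π x).inner_map_map]
    exact (Submodule.mem_orthogonal' _ _).1 (Submodule.sub_starProjection_mem_orthogonal (b y)) _
      (hEinv _ _ hw)
  · intro hfin
    obtain ⟨e, he, he0⟩ := hl.exists_hasEigenvector
    obtain ⟨M, hM⟩ := (hfin.image norm).bddAbove
    have hbd : ∀ x, ⟪b x, e⟫_ℝ ^ 2 ≤ (M * ‖e‖) ^ 2 := by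
      intro x
      have h3 : ⟪b x, e⟫_ℝ = ⟪E.starProjection (b x), e⟫_ℝ := by
        rw [← sub_eq_zero, ← inner_sub_left]
        exact (Submodule.mem_orthogonal' _ _).1
          (Submodule.sub_starProjection_mem_orthogonal (b x)) _ he
      rw [h3]
      refine sq_le_sq' ?_ ?_
      · refine neg_le_of_neg_le ?_
        refine (neg_le_abs _).trans ((abs_real_inner_le_norm _ _).trans ?_)
        exact mul_le_mul_of_nonneg_right (hM ⟨_, ⟨x, rfl⟩, rfl⟩) (norm_nonneg _)
      · refine (real_inner_le_norm _ _).trans ?_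
        exact mul_le_mul_of_nonneg_right (hM ⟨_, ⟨x, rfl⟩, rfl⟩) (norm_nonneg _)
    have h4 : ⟪R, pureTensor e e⟫_ℝ ≤ 0 := by
      have h5 : Tendsto (fun n : ℕ => (n : ℝ)⁻¹ * (M * ‖e‖) ^ 2) atTop
          (𝓝 (0 * (M * ‖e‖) ^ 2)) := tendsto_inv_atTop_nhds_zero_nat.mul_const _
      rw [zero_mul] at h5
      refine le_of_tendsto_of_tendsto' (hR.inner tendsto_const_nhds) h5 fun n => ?_
      rw [inner_smul_left, ← expect_sq_inner]
      refine mul_le_mul_of_nonneg_left ?_ (by simp)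
      rw [← hμ.expect_const n ((M * ‖e‖) ^ 2)]
      exact expect_mono (hμ.pow_nonneg n) hbd
    have h6 : ∀ v, 0 ≤ ⟪R, pureTensor v v⟫_ℝ := fun v => by
      refine ge_of_tendsto' (hR.inner tendsto_const_nhds) fun n => ?_
      rw [inner_smul_left, ← expect_sq_inner]
      exact mul_nonneg (by simp) (expect_nonneg (hμ.pow_nonneg n) fun _ => sq_nonneg _)
    have h7 := le_antisymm h4 (h6 e)
    rw [← hTR, (hEmem e).1 he, inner_smul_left] at h7
    rcases mul_eq_zero.1 h7 with h | h
    · exact hl0 h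
    · exact he0 (inner_self_eq_zero.1 h)

end RandomWalk

namespace RandomWalk

open scoped InnerProductSpace Topology

universe u

variable {G : Type u} [Group G]

/-- The Hilbert space completion of a representation with an invariant positive semidefinite
form. -/
theorem exists_completion_of_form {V : Type u} [AddCommGroup V] [Module ℝ V]
    (ρ : G →* (V →ₗ[ℝ] V)) (B : V →ₗ[ℝ] V →ₗ[ℝ] ℝ) (hsymm : ∀ v w, B v w = B w v)
    (hpos : ∀ v, 0 ≤ B v v) (hinv : ∀ g v w, B (ρ g v) (ρ g w) = B v w) :
    ∃ (H : Type u) (_ : NormedAddCommGroup H) (_ : InnerProductSpace ℝ H) (_ : CompleteSpace H)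
      (π : G →* (H →ₗᵢ[ℝ] H)) (ι : V →ₗ[ℝ] H), (∀ v w, ⟪ι v, ι w⟫_ℝ = B v w) ∧
      ∀ g v, π g (ι v) = ι (ρ g v) := by
  let core : PreInnerProductSpace.Core ℝ V :=
    { inner := fun v w => B v w
      conj_inner_symm := fun v w => hsymm w v
      re_inner_nonneg := hpos
      add_left := fun v w z => by simp
      smul_left := fun v w r => by simp }
  let : SeminormedAddCommGroup V :=
    @InnerProductSpace.Core.toSeminormedAddCommGroup ℝ V _ _ _ core
  let : InnerProductSpace ℝ V := InnerProductSpace.ofCore core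
  let π : G →* (V →ₗᵢ[ℝ] V) :=
    { toFun := fun g => (ρ g).isometryOfInner fun v w => hinv g v w
      map_one' := by
        ext v
        change ρ 1 v = v
        rw [map_one]
        rfl
      map_mul' := fun x y => by
        ext v
        change ρ (x * y) v = ρ x (ρ y v)
        rw [map_mul]
        rfl }
  exact ⟨UniformSpace.Completion V, inferInstance, inferInstance, inferInstance, completionRep π,
    (UniformSpace.Completion.toComplL (𝕜 := ℝ) (E := V)).toLinearMap,
    fun v w => UniformSpace.Completion.inner_coe v w, fun g v => completionRep_coe π g v⟩

/-- The form on the group algebra with a given kernel. -/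
noncomputable def kernelForm (K : G → G → ℝ) :
    MonoidAlgebra ℝ G →ₗ[ℝ] MonoidAlgebra ℝ G →ₗ[ℝ] ℝ :=
  expect fun x => expect fun y => K x y

theorem kernelForm_apply (K : G → G → ℝ) (f g : MonoidAlgebra ℝ G) :
    kernelForm K f g = expect (fun x => expect (fun y => K x y) g) f := by
  rw [kernelForm, expect_apply, expect_apply]
  simp

theorem kernelForm_single (K : G → G → ℝ) (x y : G) :
    kernelForm K (MonoidAlgebra.single x 1) (MonoidAlgebra.single y 1) = K x y := by
  simp [kernelForm_apply]

theorem kernelForm_symm {K : G → G → ℝ} (hK : ∀ x y, K x y = K y x) (f g : MonoidAlgebra ℝ G) :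
    kernelForm K f g = kernelForm K g f := by
  rw [kernelForm_apply, kernelForm_apply]
  simp only [expect_apply, smul_eq_mul, Finset.mul_sum]
  rw [Finset.sum_comm]
  refine Finset.sum_congr rfl fun x _ => Finset.sum_congr rfl fun y _ => ?_
  rw [hK y x]
  ring

theorem expect_single_mul {V : Type*} [AddCommGroup V] [Module ℝ V] (φ : G → V) (g : G)
    (f : MonoidAlgebra ℝ G) :
    expect φ (MonoidAlgebra.single g 1 * f) = expect (fun x => φ (g * x)) f := by
  rw [expect_mul, expect_single, one_smul]

/-- A positive semidefinite kernel with the right equivariance is the Gram kernel of a cocycle. -/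
theorem exists_cocycle_of_kernel {K : G → G → ℝ} (hK : ∀ x y, K x y = K y x)
    (hK1 : ∀ x, K 1 x = 0) (hpos : ∀ f : MonoidAlgebra ℝ G, 0 ≤ kernelForm K f f)
    (hinv : ∀ g x y, K (g * x) (g * y) = K x y + K (g * x) g + K g (g * y) - K g g) :
    ∃ (H : Type u) (_ : NormedAddCommGroup H) (_ : InnerProductSpace ℝ H) (_ : CompleteSpace H)
      (π : G →* (H →ₗᵢ[ℝ] H)) (b : G → H), IsCocycle π b ∧ ∀ x y, ⟪b x, b y⟫_ℝ = K x y := by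
  let mass : MonoidAlgebra ℝ G →ₗ[ℝ] ℝ := expect fun _ => (1 : ℝ)
  let V := LinearMap.ker mass
  have hV : ∀ (g : G), ∀ v ∈ V, LinearMap.mulLeft ℝ (MonoidAlgebra.single g 1) v ∈ V := by
    intro g v hv
    change expect (fun _ => (1 : ℝ)) (MonoidAlgebra.single g 1 * v) = 0
    rw [expect_single_mul]
    exact hv
  let ρ : G →* (V →ₗ[ℝ] V) :=
    { toFun := fun g => (LinearMap.mulLeft ℝ (MonoidAlgebra.single g 1)).restrict (hV g)
      map_one' := by
        ext v
        simp [← MonoidAlgebra.one_def]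
      map_mul' := fun x y => by
        ext1 v
        refine Subtype.ext ?_
        change MonoidAlgebra.single (x * y) 1 * (v : MonoidAlgebra ℝ G) =
          MonoidAlgebra.single x 1 * (MonoidAlgebra.single y 1 * (v : MonoidAlgebra ℝ G))
        rw [← mul_assoc, MonoidAlgebra.single_mul_single, mul_one] }
  let B : V →ₗ[ℝ] V →ₗ[ℝ] ℝ := (kernelForm K).compl₁₂ V.subtype V.subtype
  have hB : ∀ v w : V, B v w = kernelForm K v w := fun v w => rfl
  obtain ⟨H, i1, i2, i3, π, ι, h1, h2⟩ := exists_completion_of_form ρ B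
    (fun v w => kernelForm_symm hK _ _) (fun v => hpos _) (by
      intro g v w
      have hv : expect (fun _ => (1 : ℝ)) (v : MonoidAlgebra ℝ G) = 0 := v.2
      have hw : expect (fun _ => (1 : ℝ)) (w : MonoidAlgebra ℝ G) = 0 := w.2
      rw [hB, hB]
      change kernelForm K (MonoidAlgebra.single g 1 * (v : MonoidAlgebra ℝ G))
        (MonoidAlgebra.single g 1 * (w : MonoidAlgebra ℝ G)) = _
      rw [kernelForm_apply, kernelForm_apply, expect_single_mul]
      simp_rw [expect_single_mul, hinv g]
      have e1 : ∀ x, expect (fun y => K x y + K (g * x) g + K g (g * y) - K g g)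
          (w : MonoidAlgebra ℝ G) = expect (fun y => K x y) (w : MonoidAlgebra ℝ G) +
            expect (fun y => K g (g * y)) (w : MonoidAlgebra ℝ G) := by
        intro x
        rw [expect_sub_fun, expect_add_fun, expect_add_fun, expect_const (K (g * x) g),
          expect_const (K g g), hw, zero_smul, zero_smul, add_zero, sub_zero]
      simp_rw [e1]
      rw [expect_add_fun, expect_const (expect (fun y => K g (g * y)) (w : MonoidAlgebra ℝ G)), hv,
        zero_smul, add_zero])
  let e : G → V := fun x => ⟨MonoidAlgebra.single x 1 - MonoidAlgebra.single 1 1, by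
    change expect (fun _ => (1 : ℝ)) _ = 0
    rw [map_sub, expect_single, expect_single, sub_self]⟩
  refine ⟨H, i1, i2, i3, π, fun x => ι (e x), ?_, ?_⟩
  · intro x y
    change ι (e (x * y)) = ι (e x) + π x (ι (e y))
    rw [h2, ← map_add]
    refine congrArg ι (Subtype.ext ?_)
    change MonoidAlgebra.single (x * y) (1 : ℝ) - MonoidAlgebra.single (1 : G) (1 : ℝ) =
      (MonoidAlgebra.single x (1 : ℝ) - MonoidAlgebra.single (1 : G) (1 : ℝ)) +
        MonoidAlgebra.single x (1 : ℝ) *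
          (MonoidAlgebra.single y (1 : ℝ) - MonoidAlgebra.single (1 : G) (1 : ℝ))
    rw [mul_sub, MonoidAlgebra.single_mul_single, MonoidAlgebra.single_mul_single, mul_one, mul_one]
    abel
  · intro x y
    rw [h1, hB]
    change kernelForm K (MonoidAlgebra.single x 1 - MonoidAlgebra.single 1 1)
      (MonoidAlgebra.single y 1 - MonoidAlgebra.single 1 1) = _
    simp only [map_sub, LinearMap.sub_apply, kernelForm_single, hK1, hK x 1, sub_zero]

end RandomWalk

namespace RandomWalk

open scoped InnerProductSpace Topology

universe u

variable {G : Type u} [Group G]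

theorem expect_inv_of_symm {V : Type*} [AddCommGroup V] [Module ℝ V] {f : MonoidAlgebra ℝ G}
    (hf : ∀ x, f.coeff x⁻¹ = f.coeff x) (φ : G → V) : expect (fun x => φ x⁻¹) f = expect φ f := by
  rw [expect_apply, expect_apply]
  refine Finset.sum_bij' (fun x _ => x⁻¹) (fun x _ => x⁻¹) ?_ ?_ ?_ ?_ ?_ <;> simp [hf]

theorem expect_single_eq (f : MonoidAlgebra ℝ G) :
    expect (fun x => MonoidAlgebra.single x (1 : ℝ)) f = f := by
  induction f using MonoidAlgebra.induction_linear with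
  | zero => simp
  | add f₁ f₂ h₁ h₂ => rw [map_add, h₁, h₂]
  | single x r => simp

theorem expect_single_mul_eq (f g : MonoidAlgebra ℝ G) :
    expect (fun x => MonoidAlgebra.single x (1 : ℝ) * g) f = f * g := by
  rw [show expect (fun x => MonoidAlgebra.single x (1 : ℝ) * g) f =
    LinearMap.mulRight ℝ g (expect (fun x => MonoidAlgebra.single x (1 : ℝ)) f) from
    expect_map (LinearMap.mulRight ℝ g) _ f, expect_single_eq]
  rfl

theorem kernelForm_of_bilin {V : Type*} [AddCommGroup V] [Module ℝ V] (B : V →ₗ[ℝ] V →ₗ[ℝ] ℝ)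
    (φ : G → V) (f g : MonoidAlgebra ℝ G) :
    kernelForm (fun x y => B (φ x) (φ y)) f g = B (expect φ f) (expect φ g) := by
  rw [kernelForm_apply]
  have h1 : ∀ x, expect (fun y => B (φ x) (φ y)) g = B.flip (expect φ g) (φ x) :=
    fun x => expect_map (B (φ x)) φ g
  simp_rw [h1]
  rw [expect_map (B.flip (expect φ g))]
  rfl

open Classical in
/-- The standard inner product on the group algebra. -/
noncomputable def dotForm : MonoidAlgebra ℝ G →ₗ[ℝ] MonoidAlgebra ℝ G →ₗ[ℝ] ℝ :=
  kernelForm fun x y => if x = y then 1 else 0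

theorem dotForm_apply (f g : MonoidAlgebra ℝ G) : dotForm f g = expect g.coeff f := by
  classical
  rw [dotForm, kernelForm_apply]
  refine expect_congr fun x _ => ?_
  rw [coeff_eq_expect]
  simp_rw [eq_comm]

theorem dotForm_symm (f g : MonoidAlgebra ℝ G) : dotForm f g = dotForm g f :=
  kernelForm_symm (fun x y => by classical exact if_congr eq_comm rfl rfl) f g

theorem dotForm_self (f : MonoidAlgebra ℝ G) :
    dotForm f f = ∑ x ∈ f.coeff.support, f.coeff x ^ 2 := by
  simp only [dotForm_apply, expect_apply, smul_eq_mul, sq]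

theorem dotForm_self_nonneg (f : MonoidAlgebra ℝ G) : 0 ≤ dotForm f f := by
  rw [dotForm_self]
  exact Finset.sum_nonneg fun _ _ => sq_nonneg _

theorem dotForm_translate (s : G) (f g : MonoidAlgebra ℝ G) :
    dotForm (MonoidAlgebra.single s 1 * f) g = dotForm f (MonoidAlgebra.single s⁻¹ 1 * g) := by
  rw [dotForm_apply, dotForm_apply, expect_single_mul]
  refine expect_congr fun x _ => ?_
  rw [coeff_single_mul_inv_mul, inv_inv]

theorem dotForm_translate_translate (s : G) (f g : MonoidAlgebra ℝ G) :
    dotForm (MonoidAlgebra.single s 1 * f) (MonoidAlgebra.single s 1 * g) = dotForm f g := by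
  rw [dotForm_translate, ← mul_assoc, MonoidAlgebra.single_mul_single, inv_mul_cancel, mul_one,
    ← MonoidAlgebra.one_def, one_mul]

theorem dotForm_mul_left {u : MonoidAlgebra ℝ G} (hu : ∀ x, u.coeff x⁻¹ = u.coeff x)
    (f g : MonoidAlgebra ℝ G) : dotForm (u * f) g = dotForm f (u * g) := by
  rw [← expect_single_mul_eq u f, ← expect_single_mul_eq u g,
    show dotForm (expect (fun x => MonoidAlgebra.single x (1 : ℝ) * f) u) g =
      expect (fun x => dotForm (MonoidAlgebra.single x (1 : ℝ) * f) g) u from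
      (expect_map (dotForm.flip g) _ u).symm, ← expect_map (dotForm f)]
  simp_rw [dotForm_translate]
  exact expect_inv_of_symm hu fun x => dotForm f (MonoidAlgebra.single x (1 : ℝ) * g)

theorem dotForm_add_le (f g : MonoidAlgebra ℝ G) :
    dotForm (f + g) (f + g) ≤ 2 * dotForm f f + 2 * dotForm g g := by
  have h := dotForm_self_nonneg (f - g)
  simp only [map_add, map_sub, LinearMap.add_apply, LinearMap.sub_apply] at h ⊢
  linarith

theorem sum_coeff_le {f : MonoidAlgebra ℝ G} (hf : ∀ x, 0 ≤ f.coeff x) (F : Finset G) :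
    ∑ x ∈ F, f.coeff x ≤ expect (fun _ => (1 : ℝ)) f := by
  classical
  rw [expect_apply_of_subset _ f (s := f.coeff.support ∪ F) Finset.subset_union_left]
  simp only [smul_eq_mul, mul_one]
  exact Finset.sum_le_sum_of_subset_of_nonneg Finset.subset_union_right fun x _ _ => hf x

section Walk

variable {c : MonoidAlgebra ℝ G}

theorem IsSymmProb.mul_self (hc : IsSymmProb c) : IsSymmProb (c * c) where
  nonneg := coeff_mul_nonneg hc.nonneg hc.nonneg
  mass := by rw [mass_mul, hc.mass, mul_one]
  symm x := by
    have key : ∀ y, (c * c).coeff y = dotForm c (MonoidAlgebra.single y 1 * c) := by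
      intro y
      rw [dotForm_apply, coeff_mul_eq_sum, expect_apply]
      refine Finset.sum_congr rfl fun s _ => ?_
      rw [coeff_single_mul_inv_mul, smul_eq_mul, ← hc.symm (s⁻¹ * y), mul_inv_rev, inv_inv]
    rw [key, key, dotForm_symm c (MonoidAlgebra.single x 1 * c), dotForm_translate]

variable (c) in
/-- The return probability of the walk at even times. -/
noncomputable def returnProb (m : ℕ) : ℝ := dotForm (c ^ m) (c ^ m)

variable (c) in
/-- The translation cocycle of a power of the walk. -/
noncomputable def walkCocycle (m : ℕ) (x : G) : MonoidAlgebra ℝ G :=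
  MonoidAlgebra.single x 1 * c ^ m - c ^ m

theorem walkCocycle_mul (m : ℕ) (x y : G) : walkCocycle c m (x * y) =
    walkCocycle c m x + MonoidAlgebra.single x 1 * walkCocycle c m y := by
  simp only [walkCocycle, mul_sub, ← mul_assoc, MonoidAlgebra.single_mul_single, mul_one]
  abel

theorem walkCocycle_one (m : ℕ) : walkCocycle c m 1 = 0 := by
  rw [walkCocycle, ← MonoidAlgebra.one_def, one_mul, sub_self]

theorem dotForm_pow (hc : IsSymmProb c) (a b : ℕ) :
    dotForm (c ^ (a + 1)) (c ^ b) = dotForm (c ^ a) (c ^ (b + 1)) := by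
  rw [pow_succ', pow_succ', dotForm_mul_left hc.symm]

theorem dotForm_pow_two (hc : IsSymmProb c) (m : ℕ) :
    dotForm (c ^ m) (c ^ (m + 2)) = returnProb c (m + 1) := by
  rw [returnProb, dotForm_pow hc]

theorem dotForm_walkCocycle_self (m : ℕ) (x : G) :
    dotForm (walkCocycle c m x) (walkCocycle c m x) =
      2 * returnProb c m - 2 * dotForm (c ^ m) (MonoidAlgebra.single x 1 * c ^ m) := by
  simp only [walkCocycle, map_sub, LinearMap.sub_apply, dotForm_translate_translate, returnProb]
  rw [dotForm_symm (MonoidAlgebra.single x 1 * c ^ m) (c ^ m)]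
  ring

theorem expect_walkCocycle (hc : IsSymmProb c) (m : ℕ) :
    expect (walkCocycle c m) (c * c) = c ^ (m + 2) - c ^ m := by
  change expect (fun x => MonoidAlgebra.single x 1 * c ^ m - c ^ m) (c * c) = _
  rw [expect_sub_fun, expect_single_mul_eq, hc.mul_self.expect_const', pow_add, sq,
    ((Commute.refl c).pow_right m).mul_left ((Commute.refl c).pow_right m) |>.eq]

theorem expect_dotForm_walkCocycle (hc : IsSymmProb c) (m : ℕ) :
    expect (fun x => dotForm (walkCocycle c m x) (walkCocycle c m x)) (c * c) =
      2 * (returnProb c m - returnProb c (m + 1)) := by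
  simp_rw [dotForm_walkCocycle_self]
  rw [expect_sub_fun, hc.mul_self.expect_const', expect_mul_left,
    show expect (fun x => dotForm (c ^ m) (MonoidAlgebra.single x 1 * c ^ m)) (c * c) =
      dotForm (c ^ m) (expect (fun x => MonoidAlgebra.single x 1 * c ^ m) (c * c)) from
      expect_map (dotForm (c ^ m)) _ _, expect_single_mul_eq, ← dotForm_pow_two hc, pow_add, sq,
    ((Commute.refl c).pow_right m).mul_left ((Commute.refl c).pow_right m) |>.eq]
  ring

theorem returnProb_succ_le (hc : IsSymmProb c) (m : ℕ) :
    returnProb c (m + 1) ≤ returnProb c m := by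
  have h := expect_dotForm_walkCocycle hc m
  have h2 := expect_nonneg hc.mul_self.nonneg fun x => dotForm_self_nonneg (walkCocycle c m x)
  linarith

theorem dotForm_expect_walkCocycle (hc : IsSymmProb c) (m : ℕ) :
    dotForm (expect (walkCocycle c m) (c * c)) (expect (walkCocycle c m) (c * c)) =
      (returnProb c m - returnProb c (m + 1)) - (returnProb c (m + 1) - returnProb c (m + 2)) := by
  rw [expect_walkCocycle hc]
  simp only [map_sub, LinearMap.sub_apply]
  rw [dotForm_symm (c ^ (m + 2)) (c ^ m), dotForm_pow_two hc]
  simp only [returnProb]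
  ring

theorem exists_walkCocycle_le (hc : IsSymmProb c)
    (hgen : Subgroup.closure {s | 0 < (c * c).coeff s} = ⊤) (x : G) :
    ∃ M : ℝ, 0 ≤ M ∧ ∀ m, dotForm (walkCocycle c m x) (walkCocycle c m x) ≤
      M * (returnProb c m - returnProb c (m + 1)) := by
  have hx : x ∈ Subgroup.closure {s | 0 < (c * c).coeff s} := hgen ▸ Subgroup.mem_top x
  induction hx using Subgroup.closure_induction with
  | mem s hs =>
    have hs' : 0 < (c * c).coeff s := hs
    refine ⟨2 / (c * c).coeff s, by positivity, fun m => ?_⟩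
    have h := expect_dotForm_walkCocycle hc m
    rw [expect_apply] at h
    have h1 := Finset.single_le_sum (s := (c * c).coeff.support)
      (f := fun x => (c * c).coeff x • dotForm (walkCocycle c m x) (walkCocycle c m x))
      (fun x _ => mul_nonneg (hc.mul_self.nonneg x) (dotForm_self_nonneg _))
      (by simpa using hs'.ne' : s ∈ (c * c).coeff.support)
    rw [h] at h1
    simp only [smul_eq_mul] at h1
    rw [div_mul_eq_mul_div, le_div_iff₀ hs']
    linarith
  | one => exact ⟨0, le_rfl, fun m => by simp [walkCocycle_one]⟩
  | mul x y _ _ hx hy =>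
    obtain ⟨M, hM, h1⟩ := hx
    obtain ⟨N, hN, h2⟩ := hy
    refine ⟨2 * M + 2 * N, by positivity, fun m => ?_⟩
    rw [walkCocycle_mul]
    refine (dotForm_add_le _ _).trans ?_
    rw [dotForm_translate_translate]
    linarith [h1 m, h2 m]
  | inv x _ hx =>
    obtain ⟨M, hM, h1⟩ := hx
    refine ⟨M, hM, fun m => ?_⟩
    rw [dotForm_walkCocycle_self, ← dotForm_translate, dotForm_symm, ← dotForm_walkCocycle_self]
    exact h1 m

theorem returnProb_nonneg (m : ℕ) : 0 ≤ returnProb c m := dotForm_self_nonneg _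

theorem tendsto_returnProb [Infinite G] (hc : IsSymmProb c)
    (hgen : Subgroup.closure {s | 0 < (c * c).coeff s} = ⊤) :
    Tendsto (returnProb c) atTop (𝓝 0) := by
  have hanti : Antitone (returnProb c) := antitone_nat_of_succ_le (returnProb_succ_le hc)
  have hlim := tendsto_atTop_ciInf hanti ⟨0, by rintro _ ⟨m, rfl⟩; exact returnProb_nonneg m⟩
  set L := ⨅ m, returnProb c m with hL
  have hL0 : 0 ≤ L := le_ciInf returnProb_nonneg
  rcases hL0.eq_or_lt with h | hLpos
  · rwa [← h] at hlim
  exfalso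
  have hq : Tendsto (fun m => returnProb c m - returnProb c (m + 1)) atTop (𝓝 (L - L)) :=
    hlim.sub ((tendsto_add_atTop_iff_nat 1).2 hlim)
  rw [sub_self] at hq
  have hw : ∀ x, Tendsto (fun m => dotForm (c ^ m) (MonoidAlgebra.single x 1 * c ^ m)) atTop
      (𝓝 L) := by
    intro x
    obtain ⟨M, hM, h1⟩ := exists_walkCocycle_le hc hgen x
    have h2 : Tendsto (fun m => dotForm (walkCocycle c m x) (walkCocycle c m x)) atTop (𝓝 0) := by
      refine squeeze_zero (fun m => dotForm_self_nonneg _) h1 ?_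
      simpa using hq.const_mul M
    have h3 := hlim.sub (h2.const_mul (1 / 2))
    simp only [mul_zero, sub_zero] at h3
    refine h3.congr fun m => ?_
    rw [dotForm_walkCocycle_self]
    ring
  obtain ⟨N, hN⟩ := exists_nat_gt (1 / L)
  obtain ⟨F, hF⟩ := Infinite.exists_subset_card_eq G N
  have h4 := tendsto_finsetSum F fun x _ => hw x
  have h5 : ∑ x ∈ F, L ≤ 1 := by
    refine le_of_tendsto' h4 fun m => ?_
    simp_rw [dotForm_apply]
    simp only [expect_apply, smul_eq_mul]
    rw [Finset.sum_comm]
    simp_rw [coeff_single_mul_inv_mul, ← Finset.mul_sum]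
    have h6 : ∀ y, ∑ x ∈ F, (c ^ m).coeff (x⁻¹ * y) ≤ 1 := by
      intro y
      classical
      rw [← Finset.sum_image (s := F) (g := fun x => x⁻¹ * y) (f := fun z => (c ^ m).coeff z)
        (fun a _ b _ hab => by simpa using hab), ← hc.mass_pow m]
      exact sum_coeff_le (hc.pow_nonneg m) _
    refine (Finset.sum_le_sum fun y _ =>
      mul_le_mul_of_nonneg_left (h6 y) (hc.pow_nonneg m y)).trans ?_
    have := hc.mass_pow m
    rw [expect_apply] at this
    exact this.le
  rw [Finset.sum_const, hF, nsmul_eq_mul] at h5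
  rw [div_lt_iff₀ hLpos] at hN
  linarith

theorem one_le_card_mul_returnProb (hc : IsSymmProb c) (m : ℕ) :
    1 ≤ ((c ^ m).coeff.support.card : ℝ) * returnProb c m := by
  have h := hc.mass_pow m
  rw [expect_apply] at h
  simp only [smul_eq_mul, mul_one] at h
  have h2 := sq_sum_le_card_mul_sum_sq (s := (c ^ m).coeff.support) (f := (c ^ m).coeff)
  rw [h, one_pow] at h2
  rwa [returnProb, dotForm_self]

end Walk

end RandomWalk

namespace RandomWalk

open scoped InnerProductSpace Topology

universe u

theorem exists_decrement_le {p : ℕ → ℝ} (hlim : Tendsto p atTop (𝓝 0))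
    (hanti : ∀ m, p (m + 1) ≤ p m) {C : ℝ} {d : ℕ}
    (hp : ∀ m : ℕ, 1 ≤ m → 1 ≤ C * m ^ d * p m) {η : ℝ} (hη : 0 < η) :
    ∃ m, (p m - p (m + 1)) - (p (m + 1) - p (m + 2)) ≤ η * (p m - p (m + 1)) := by
  by_contra! h
  have hq : ∀ m, 0 ≤ p m - p (m + 1) := fun m => sub_nonneg.2 (hanti m)
  rcases le_or_gt 1 η with h1 | h1
  · have h2 := h 0
    have h3 := hq 1
    have h4 := hq 0
    norm_num at h2 h3 h4
    nlinarith
  have hpow : ∀ m, p m - p (m + 1) ≤ (1 - η) ^ m * (p 0 - p 1) := by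
    intro m
    induction m with
    | zero => simp
    | succ m ih =>
      have h2 := h m
      have h3 := mul_le_mul_of_nonneg_left ih (sub_nonneg.2 h1.le)
      rw [pow_succ']
      linarith
  have hmono : Monotone fun m => η * p m - (p m - p (m + 1)) := by
    refine monotone_nat_of_le_succ fun m => ?_
    have := h m
    linarith
  have hlim2 : Tendsto (fun m => η * p m - (p m - p (m + 1))) atTop (𝓝 0) := by
    have := (hlim.const_mul η).sub (hlim.sub ((tendsto_add_atTop_iff_nat 1).2 hlim))
    simpa using this
  have hle : ∀ m, η * p m ≤ (1 - η) ^ m * (p 0 - p 1) := by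
    intro m
    have := hmono.ge_of_tendsto hlim2 m
    have := hpow m
    linarith
  have hC : 0 ≤ C := by
    have h2 := hp 1 le_rfl
    have h3 : 0 ≤ p 1 := (antitone_nat_of_succ_le hanti).le_of_tendsto hlim 1
    norm_num at h2
    by_contra! hC
    nlinarith
  have hz := tendsto_pow_const_mul_const_pow_of_abs_lt_one d (r := 1 - η)
    (by rw [abs_of_pos (by linarith)]; linarith)
  have hz2 := hz.const_mul (C * (p 0 - p 1))
  rw [mul_zero] at hz2
  obtain ⟨m, hm1, hm2⟩ := ((hz2.eventually (gt_mem_nhds hη)).and (eventually_ge_atTop 1)).exists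
  have h2 := mul_le_mul_of_nonneg_left (hle m) (show 0 ≤ C * (m : ℝ) ^ d by positivity)
  have h3 := mul_le_mul_of_nonneg_left (hp m hm2) hη.le
  nlinarith

theorem decrement_pos {p : ℕ → ℝ} (hlim : Tendsto p atTop (𝓝 0))
    (hanti : ∀ m, p (m + 1) ≤ p m) (hpos : ∀ m, 0 < p m)
    (hconv : ∀ m, p (m + 1) - p (m + 2) ≤ p m - p (m + 1)) (m : ℕ) : 0 < p m - p (m + 1) := by
  have hq : ∀ m, 0 ≤ p m - p (m + 1) := fun m => sub_nonneg.2 (hanti m)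
  rcases (hq m).lt_or_eq with h | h
  · exact h
  exfalso
  have hqa : Antitone fun m => p m - p (m + 1) := antitone_nat_of_succ_le hconv
  have hconst : ∀ k, p (m + k) = p m := by
    intro k
    induction k with
    | zero => rfl
    | succ k ih =>
      have h1 := hqa (show m ≤ m + k by omega)
      have h2 := hq (m + k)
      simp only at h1
      rw [← add_assoc]
      linarith
  have h1 : Tendsto (fun k => p (m + k)) atTop (𝓝 0) := by
    simpa only [add_comm m] using (tendsto_add_atTop_iff_nat m).2 hlim
  simp_rw [hconst] at h1
  have := tendsto_nhds_unique h1 tendsto_const_nhds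
  exact (hpos m).ne this

theorem exists_tendsto_hyperfilter {a : ℕ → ℝ} {B : ℝ} (h : ∀ n, |a n| ≤ B) :
    ∃ L, Tendsto a (hyperfilter ℕ) (𝓝 L) := by
  obtain ⟨L, -, hL⟩ := (isCompact_Icc (a := -B) (b := B)).ultrafilter_le_nhds
    ((hyperfilter ℕ).map a) (by
      refine le_principal_iff.2 ?_
      change a ⁻¹' Set.Icc (-B) B ∈ (hyperfilter ℕ : Filter ℕ)
      exact univ_mem' fun n => abs_le.1 (h n))
  exact ⟨L, hL⟩

variable {G : Type u} [Group G]

theorem tendsto_expect {ι : Type*} {l : Filter ι} {φ : ι → G → ℝ} {ψ : G → ℝ}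
    (h : ∀ x, Tendsto (fun i => φ i x) l (𝓝 (ψ x))) (f : MonoidAlgebra ℝ G) :
    Tendsto (fun i => expect (φ i) f) l (𝓝 (expect ψ f)) := by
  simp only [expect_apply]
  exact tendsto_finsetSum _ fun x _ => (h x).const_smul _

theorem tendsto_kernelForm {ι : Type*} {l : Filter ι} {K : ι → G → G → ℝ} {L : G → G → ℝ}
    (h : ∀ x y, Tendsto (fun i => K i x y) l (𝓝 (L x y))) (f g : MonoidAlgebra ℝ G) :
    Tendsto (fun i => kernelForm (K i) f g) l (𝓝 (kernelForm L f g)) := by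
  simp only [kernelForm_apply]
  exact tendsto_expect (fun x => tendsto_expect (h x) g) f

theorem dotForm_abs_le (f g : MonoidAlgebra ℝ G) :
    |dotForm f g| ≤ dotForm f f + dotForm g g := by
  have h1 := dotForm_self_nonneg (f + g)
  have h2 := dotForm_self_nonneg (f - g)
  have h3 := dotForm_self_nonneg f
  have h4 := dotForm_self_nonneg g
  simp only [map_add, map_sub, LinearMap.add_apply, LinearMap.sub_apply, dotForm_symm g f] at h1 h2
  rw [abs_le]
  constructor <;> linarith

variable {c : MonoidAlgebra ℝ G}

/-- A random walk with polynomially growing support has a nontrivial harmonic cocycle. -/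
theorem exists_harmonic_cocycle [Infinite G] (hc : IsSymmProb c)
    (hgen : Subgroup.closure {s | 0 < (c * c).coeff s} = ⊤) {C : ℝ} {d : ℕ}
    (hcard : ∀ m : ℕ, 1 ≤ m → ((c ^ m).coeff.support.card : ℝ) ≤ C * m ^ d) :
    ∃ (H : Type u) (_ : NormedAddCommGroup H) (_ : InnerProductSpace ℝ H) (_ : CompleteSpace H)
      (π : G →* (H →ₗᵢ[ℝ] H)) (b : G → H), IsCocycle π b ∧ expect b (c * c) = 0 ∧
        ∃ s, 0 < (c * c).coeff s ∧ b s ≠ 0 := by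
  set p := returnProb c with hpdef
  have hlim : Tendsto p atTop (𝓝 0) := tendsto_returnProb hc hgen
  have hanti : ∀ m, p (m + 1) ≤ p m := returnProb_succ_le hc
  have hpos : ∀ m, 0 < p m := by
    intro m
    refine lt_of_le_of_ne (returnProb_nonneg m) fun h => ?_
    have h1 := one_le_card_mul_returnProb hc m
    rw [← hpdef, ← h] at h1
    norm_num at h1
  have hp : ∀ m : ℕ, 1 ≤ m → 1 ≤ C * m ^ d * p m := fun m hm =>
    (one_le_card_mul_returnProb hc m).trans (mul_le_mul_of_nonneg_right (hcard m hm) (hpos m).le)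
  have hconv : ∀ m, p (m + 1) - p (m + 2) ≤ p m - p (m + 1) := by
    intro m
    have h1 := dotForm_expect_walkCocycle hc m
    have h2 := dotForm_self_nonneg (expect (walkCocycle c m) (c * c))
    rw [h1] at h2
    linarith
  have hq := decrement_pos hlim hanti hpos hconv
  choose m hm using fun j : ℕ => exists_decrement_le hlim hanti hp
    (show (0 : ℝ) < 1 / ((j : ℝ) + 1) by positivity)
  let q : ℕ → ℝ := fun j => p (m j) - p (m j + 1)
  have hqpos : ∀ j, 0 < q j := fun j => hq (m j)
  let B : ℕ → MonoidAlgebra ℝ G →ₗ[ℝ] MonoidAlgebra ℝ G →ₗ[ℝ] ℝ := fun j => (q j)⁻¹ • dotForm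
  have hB : ∀ j f g, B j f g = (q j)⁻¹ * dotForm f g := fun j f g => rfl
  let w : ℕ → G → MonoidAlgebra ℝ G := fun j => walkCocycle c (m j)
  let Kj : ℕ → G → G → ℝ := fun j x y => B j (w j x) (w j y)
  choose M hM0 hM using exists_walkCocycle_le hc hgen
  have hbd : ∀ x y j, |Kj j x y| ≤ M x + M y := by
    intro x y j
    have h1 := dotForm_abs_le (w j x) (w j y)
    have h2 := hM x (m j)
    have h3 := hM y (m j)
    change |(q j)⁻¹ * dotForm (w j x) (w j y)| ≤ _
    rw [abs_mul, abs_of_pos (inv_pos.2 (hqpos j)), inv_mul_le_iff₀ (hqpos j)]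
    change _ ≤ M x * q j at h2
    change _ ≤ M y * q j at h3
    linarith
  choose K hK using fun x y => exists_tendsto_hyperfilter (hbd x y)
  have hform : ∀ j f g, kernelForm (Kj j) f g = B j (expect (w j) f) (expect (w j) g) :=
    fun j f g => kernelForm_of_bilin (B j) (w j) f g
  have hformlim : ∀ f g, Tendsto (fun j => B j (expect (w j) f) (expect (w j) g)) (hyperfilter ℕ)
      (𝓝 (kernelForm K f g)) := fun f g => by
    simpa only [hform] using tendsto_kernelForm hK f g
  obtain ⟨H, i1, i2, i3, π, b, hb, hbK⟩ := exists_cocycle_of_kernel (K := K)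
    (fun x y => tendsto_nhds_unique (hK x y) (by
      simpa only [Kj, hB, dotForm_symm] using hK y x))
    (fun x => tendsto_nhds_unique (hK 1 x) (by
      simp only [Kj, w, walkCocycle_one, map_zero, LinearMap.zero_apply]
      exact tendsto_const_nhds))
    (fun f => ge_of_tendsto' (hformlim f f) fun j => by
      rw [hB]
      exact mul_nonneg (inv_pos.2 (hqpos j)).le (dotForm_self_nonneg _))
    (fun g x y => tendsto_nhds_unique (hK (g * x) (g * y)) (by
      refine (((hK x y).add (hK (g * x) g)).add (hK g (g * y))).sub (hK g g) |>.congr fun j => ?_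
      simp only [Kj, hB, w, walkCocycle_mul, map_add, LinearMap.add_apply,
        dotForm_translate_translate]
      ring))
  refine ⟨H, i1, i2, i3, π, b, hb, ?_, ?_⟩
  · have h1 : kernelForm K (c * c) (c * c) = ⟪expect b (c * c), expect b (c * c)⟫_ℝ := by
      rw [show K = fun x y => innerₗ H (b x) (b y) from
        funext fun x => funext fun y => (hbK x y).symm, kernelForm_of_bilin]
      rfl
    have h2 : Tendsto (fun j => B j (expect (w j) (c * c)) (expect (w j) (c * c)))
        (hyperfilter ℕ) (𝓝 0) := by
      refine Tendsto.mono_left ?_ (Nat.hyperfilter_le_atTop)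
      refine squeeze_zero (fun j => ?_) (fun j => ?_) tendsto_one_div_add_atTop_nhds_zero_nat
      · rw [hB]
        exact mul_nonneg (inv_pos.2 (hqpos j)).le (dotForm_self_nonneg _)
      · rw [hB, dotForm_expect_walkCocycle hc, inv_mul_le_iff₀ (hqpos j), mul_comm]
        exact hm j
    have h3 := tendsto_nhds_unique (hformlim (c * c) (c * c)) h2
    rw [h1] at h3
    exact inner_self_eq_zero.1 h3
  · by_contra! hcon
    have h1 : expect (fun x => K x x) (c * c) = 0 := by
      rw [expect_apply]
      refine Finset.sum_eq_zero fun x hx => ?_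
      have hx0 : 0 < (c * c).coeff x :=
        lt_of_le_of_ne (hc.mul_self.nonneg x) (Finsupp.mem_support_iff.1 hx).symm
      rw [← hbK, hcon x hx0, inner_zero_left, smul_zero]
    have h2 := tendsto_expect (fun x => hK x x) (c * c)
    have h3 : ∀ j, expect (fun x => Kj j x x) (c * c) = 2 := by
      intro j
      have h4 := expect_dotForm_walkCocycle hc (m j)
      change expect (fun x => (q j)⁻¹ * dotForm (w j x) (w j x)) (c * c) = 2
      have h5 := expect_map (LinearMap.mulLeft ℝ (q j)⁻¹)
        (fun x => dotForm (w j x) (w j x)) (c * c)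
      simp only [LinearMap.mulLeft_apply] at h5
      rw [h5, h4]
      change (q j)⁻¹ * (2 * q j) = 2
      have := (hqpos j).ne'
      field_simp
    simp_rw [h3, h1] at h2
    have := tendsto_nhds_unique h2 tendsto_const_nhds
    norm_num at this

end RandomWalk

namespace RandomWalk

open scoped Pointwise

universe u

/-- Every finite subset of the group has polynomial growth of degree at most `d`. -/
def PolyGrowth (G : Type*) [Group G] (d : ℕ) : Prop :=
  ∀ T : Set G, T.Finite → ∃ C : ℝ, ∀ n : ℕ, 1 ≤ n → ((T ^ n).ncard : ℝ) ≤ C * n ^ d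

theorem finite_pow {G : Type*} [Group G] {T : Set G} (hT : T.Finite) (n : ℕ) : (T ^ n).Finite := by
  induction n with
  | zero => simp
  | succ n ih => rw [pow_succ]; exact ih.mul hT

theorem PolyGrowth.of_injective {G H : Type*} [Group G] [Group H] {d : ℕ} (h : PolyGrowth G d)
    (f : H →* G) (hf : Function.Injective f) : PolyGrowth H d := by
  intro T hT
  obtain ⟨C, hC⟩ := h (f '' T) (hT.image f)
  refine ⟨C, fun n hn => ?_⟩
  rw [← Set.ncard_image_of_injective _ hf, Set.image_pow]
  exact hC n hn

theorem PolyGrowth.subgroup {G : Type*} [Group G] {d : ℕ} (h : PolyGrowth G d) (H : Subgroup G) :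
    PolyGrowth H d := h.of_injective H.subtype H.subtype_injective

theorem PolyGrowth.of_surjective {G H : Type*} [Group G] [Group H] {d : ℕ} (h : PolyGrowth G d)
    (f : G →* H) (hf : Function.Surjective f) : PolyGrowth H d := by
  intro T hT
  obtain ⟨C, hC⟩ := h (Function.surjInv hf '' T) (hT.image _)
  refine ⟨C, fun n hn => le_trans ?_ (hC n hn)⟩
  have h1 : f '' (Function.surjInv hf '' T) = T := by
    rw [Set.image_image]
    simp [Function.surjInv_eq hf]
  have h2 : T ^ n = f '' ((Function.surjInv hf '' T) ^ n) := by rw [Set.image_pow, h1]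
  rw [h2]
  exact_mod_cast Set.ncard_image_le (finite_pow (hT.image _) n)

section Uniform

variable {G : Type u} [Group G]

open Classical in
/-- The uniform probability on a finite set. -/
noncomputable def uniform (S : Finset G) : MonoidAlgebra ℝ G :=
  ∑ s ∈ S, MonoidAlgebra.single s (S.card : ℝ)⁻¹

open Classical in
theorem uniform_coeff (S : Finset G) (x : G) :
    (uniform S).coeff x = if x ∈ S then (S.card : ℝ)⁻¹ else 0 := by
  rw [coeff_eq_expect, uniform, map_sum]
  simp [Finset.sum_ite_eq']

theorem uniform_isSymmProb {S : Finset G} (hne : S.Nonempty) (hS : ∀ s ∈ S, s⁻¹ ∈ S) :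
    IsSymmProb (uniform S) where
  nonneg x := by
    classical
    rw [uniform_coeff]
    split_ifs <;> positivity
  mass := by
    have : (S.card : ℝ) ≠ 0 := by exact_mod_cast hne.card_pos.ne'
    rw [uniform, map_sum]
    simp [this]
  symm x := by
    classical
    have : x⁻¹ ∈ S ↔ x ∈ S := ⟨fun h => by simpa using hS _ h, hS x⟩
    simp only [uniform_coeff, this]

theorem coeff_pow_support (S : Finset G) (n : ℕ) :
    ∀ x, ((uniform S) ^ n).coeff x ≠ 0 → x ∈ (S : Set G) ^ n := by
  classical
  induction n with
  | zero =>
    intro x hx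
    rw [pow_zero, coeff_eq_expect, expect_one] at hx
    by_contra h
    rw [pow_zero, Set.mem_one] at h
    simp [Ne.symm h] at hx
  | succ n ih =>
    intro x hx
    rw [pow_succ', coeff_mul_eq_sum] at hx
    obtain ⟨s, hs, h⟩ := Finset.exists_ne_zero_of_sum_ne_zero hx
    have h1 : s ∈ S := by
      by_contra hcon
      rw [uniform_coeff, if_neg hcon, zero_mul] at h
      exact h rfl
    rw [pow_succ']
    exact ⟨s, h1, s⁻¹ * x, ih _ (right_ne_zero_of_mul h), by simp⟩

/-- An infinite finitely generated group of polynomial growth has an infinite affine isometric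
action on a finite-dimensional Euclidean space. -/
theorem exists_affine_action [Infinite G] [Group.FG G] {d : ℕ} (h : PolyGrowth G d) :
    ∃ (E : Type u) (_ : NormedAddCommGroup E) (_ : InnerProductSpace ℝ E)
      (_ : FiniteDimensional ℝ E) (π : G →* (E →ₗᵢ[ℝ] E)) (b : G → E),
      IsCocycle π b ∧ (Set.range b).Infinite := by
  classical
  obtain ⟨S₀, hS₀⟩ := Group.fg_def.1 ‹Group.FG G›
  let S : Finset G := insert 1 (S₀ ∪ S₀.image fun x => x⁻¹)
  have h1S : 1 ∈ S := Finset.mem_insert_self _ _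
  have hSinv : ∀ s ∈ S, s⁻¹ ∈ S := by
    intro s hs
    simp only [S, Finset.mem_insert, Finset.mem_union, Finset.mem_image] at hs ⊢
    rcases hs with rfl | hs | ⟨t, ht, rfl⟩
    · simp
    · exact Or.inr (Or.inr ⟨s, hs, rfl⟩)
    · simp [ht]
  have hc := uniform_isSymmProb ⟨1, h1S⟩ hSinv
  set c := uniform S with hcdef
  have hcpos : ∀ s ∈ S, 0 < c.coeff s := by
    intro s hs
    rw [hcdef, uniform_coeff, if_pos hs]
    have : 0 < S.card := Finset.card_pos.2 ⟨1, h1S⟩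
    positivity
  have hgen : Subgroup.closure {s | 0 < (c * c).coeff s} = ⊤ := by
    rw [eq_top_iff, ← hS₀, Subgroup.closure_le]
    intro s hs
    refine Subgroup.subset_closure ?_
    have hs' : s ∈ S := Finset.mem_insert_of_mem (Finset.mem_union_left _ hs)
    rw [Set.mem_ofPred_eq, coeff_mul_eq_sum]
    refine Finset.sum_pos' (fun t _ => mul_nonneg (hc.nonneg _) (hc.nonneg _)) ⟨1, ?_, ?_⟩
    · exact Finsupp.mem_support_iff.2 (hcpos 1 h1S).ne'
    · simpa using mul_pos (hcpos 1 h1S) (hcpos s hs')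
  obtain ⟨C, hC⟩ := h S S.finite_toSet
  have hcard : ∀ m : ℕ, 1 ≤ m → ((c ^ m).coeff.support.card : ℝ) ≤ C * m ^ d := by
    intro m hm
    refine le_trans ?_ (hC m hm)
    rw [← Set.ncard_coe_finset]
    refine Nat.cast_le.2 (Set.ncard_le_ncard (fun x hx => ?_) (finite_pow S.finite_toSet m))
    exact coeff_pow_support S m x (Finsupp.mem_support_iff.1 hx)
  have hcardpos : ∀ m : ℕ, 0 < ((c ^ m).coeff.support.card : ℝ) := by
    intro m
    have := one_le_card_mul_returnProb hc m
    rcases (Nat.cast_nonneg ((c ^ m).coeff.support.card) : (0 : ℝ) ≤ _).lt_or_eq with h | h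
    · exact h
    · rw [← h] at this; norm_num at this
  have hCpos : 0 < C := by
    have h1 := hcard 1 le_rfl
    have h2 := hcardpos 1
    rw [Nat.cast_one, one_pow, mul_one] at h1
    exact h2.trans_le h1
  obtain ⟨H, i1, i2, i3, π, b, hb, h0, hne⟩ := exists_harmonic_cocycle hc hgen hcard
  have hent : ∀ n : ℕ, 1 ≤ n →
      entropy ((c * c) ^ n) ≤ (d : ℝ) * Real.log n + Real.log (C * 2 ^ d) := by
    intro n hn
    have h1 := entropy_le_log_card (hc.mul_self.pow_nonneg n) (hc.mul_self.mass_pow n)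
      (Finset.Subset.refl _)
    refine h1.trans ?_
    rw [← pow_two, ← pow_mul]
    have hn' : (0 : ℝ) < n := by exact_mod_cast hn
    rw [← Real.log_pow, ← Real.log_mul (by positivity) (by positivity)]
    refine Real.log_le_log (hcardpos _) ((hcard (2 * n) (by omega)).trans (le_of_eq ?_))
    push_cast
    ring
  obtain ⟨E, hE, hinv, b', hb', hbE, hinf⟩ :=
    hb.exists_finiteDimensional hc.mul_self h0 hgen hne (Nat.cast_nonneg d) hent
  let π' : G →* (E →ₗᵢ[ℝ] E) :=
    { toFun := fun g =>
        { toLinearMap := (π g).toLinearMap.restrict (hinv g)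
          norm_map' := fun v => (π g).norm_map v }
      map_one' := by ext v; simp
      map_mul' := fun g k => by ext v; simp; rfl }
  refine ⟨E, inferInstance, inferInstance, hE, π', fun g => ⟨b' g, hbE g⟩, ?_, ?_⟩
  · intro x y
    exact Subtype.ext (hb' x y)
  · intro hfin
    refine hinf ((hfin.image Subtype.val).subset ?_)
    rintro _ ⟨g, rfl⟩
    exact ⟨_, ⟨g, rfl⟩, rfl⟩

end Uniform

end RandomWalk

namespace RandomWalk

open scoped Pointwise commutatorElement

/-- A length function for which commutators of short elements are much shorter. -/
structure IsCommLength {G : Type*} [Group G] (l : G → ℝ) : Prop where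
  nonneg : ∀ g, 0 ≤ l g
  one : l 1 = 0
  mul_le : ∀ g h, l (g * h) ≤ l g + l h
  inv : ∀ g, l g⁻¹ = l g
  comm_le : ∀ g h, l ⁅g, h⁆ ≤ 2 * l g * l h
  le_pow : ∀ (g) (i : ℕ), i * l g ≤ 1 / 2 → i * l g / 2 ≤ l (g ^ i)

/-- Iterated left-normed commutators of a sequence. -/
def iterComm {G : Type*} [Group G] (f : ℕ → G) : ℕ → G
  | 0 => f 0
  | k + 1 => ⁅iterComm f k, f (k + 1)⁆

variable {G : Type*} [Group G] {l : G → ℝ}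

theorem IsCommLength.pow_le (hl : IsCommLength l) (g : G) (i : ℕ) : l (g ^ i) ≤ i * l g := by
  induction i with
  | zero => simp [hl.one]
  | succ i ih =>
    rw [pow_succ]
    push_cast
    linarith [hl.mul_le (g ^ i) g]

theorem IsCommLength.injOn (hl : IsCommLength l) {h : G} (hpos : 0 < l h) {M : ℕ}
    (hM : M * l h ≤ 1 / 2) {A : Set G} (hA : ∀ a ∈ A, l a ≤ l h / 8) {i i' : ℕ} (hi : i ≤ M)
    (hi' : i' ≤ M) {a a' : G} (ha : a ∈ A) (ha' : a' ∈ A) (heq : h ^ i * a = h ^ i' * a') :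
    i = i' ∧ a = a' := by
  have key : ∀ i i' : ℕ, i' ≤ M → ∀ a ∈ A, ∀ a' ∈ A, h ^ i * a = h ^ i' * a' → i' ≤ i := by
    intro i i' hi' a ha a' ha' heq
    by_contra! hlt
    obtain ⟨k, rfl⟩ := Nat.exists_eq_add_of_lt hlt
    have h1 : h ^ (k + 1) = a * a'⁻¹ := by
      rw [add_assoc, pow_add, mul_assoc] at heq
      rw [mul_left_cancel heq, mul_inv_cancel_right]
    have hk : ((k + 1 : ℕ) : ℝ) * l h ≤ 1 / 2 :=
      (mul_le_mul_of_nonneg_right (Nat.cast_le.2 (by omega)) hpos.le).trans hM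
    have h2 := hl.le_pow h (k + 1) hk
    have h3 := hl.mul_le a a'⁻¹
    rw [hl.inv, ← h1] at h3
    have h4 := hA a ha
    have h5 := hA a' ha'
    push_cast at h2
    have : 0 ≤ (k : ℝ) * l h := by positivity
    nlinarith
  have h1 : i = i' := le_antisymm (key i' i hi a' ha' a ha heq.symm) (key i i' hi' a ha a' ha' heq)
  subst h1
  exact ⟨rfl, mul_left_cancel heq⟩

theorem pow_subset_pow_of_le {T : Set G} (h1 : (1 : G) ∈ T) {m n : ℕ} (h : m ≤ n) :
    T ^ m ⊆ T ^ n := Set.pow_subset_pow_right h1 h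

theorem iterComm_mem_pow {T : Set G} (h1 : (1 : G) ∈ T) (hinv : T⁻¹ = T) {f : ℕ → G}
    (hf : ∀ i, f i ∈ T) (k : ℕ) : iterComm f k ∈ T ^ 4 ^ k := by
  induction k with
  | zero => simpa [iterComm] using hf 0
  | succ k ih =>
    have h2 : (iterComm f k)⁻¹ ∈ T ^ 4 ^ k := by
      rw [← hinv, inv_pow, Set.mem_inv, inv_inv]
      exact ih
    have h3 : (f (k + 1))⁻¹ ∈ T := by
      rw [← hinv, Set.mem_inv, inv_inv]
      exact hf _
    have h4 : iterComm f (k + 1) ∈ T ^ (4 ^ k + 1 + 4 ^ k + 1) := by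
      rw [pow_succ, pow_add, pow_succ]
      exact Set.mul_mem_mul (Set.mul_mem_mul (Set.mul_mem_mul ih (hf _)) h2) h3
    refine pow_subset_pow_of_le h1 ?_ h4
    have := Nat.one_le_pow k 4 (by norm_num)
    rw [pow_succ]
    omega

/-- In a group of polynomial growth generated by short elements, long iterated commutators of the
generators have length zero. -/
theorem IsCommLength.exists_iterComm_eq_zero (hl : IsCommLength l) {d : ℕ} (hG : PolyGrowth G d)
    {S : Set G} (hS : S.Finite) (hε : ∀ s ∈ S, 2 * l s ≤ (1 / 4) ^ ((d + 1) * d + 1)) :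
    ∃ k, ∀ f : ℕ → G, (∀ i, f i ∈ S) → l (iterComm f k) = 0 := by
  set e := (d + 1) * d + 1 with he
  let T : Set G := insert 1 (S ∪ S⁻¹)
  have hT : T.Finite := (hS.union hS.inv).insert 1
  have h1T : (1 : G) ∈ T := Set.mem_insert _ _
  have hTinv : T⁻¹ = T := by
    simp only [T, Set.inv_insert, inv_one, Set.union_inv, inv_inv, Set.union_comm]
  obtain ⟨C, hC⟩ := hG T hT
  obtain ⟨q₀, hq₀⟩ := pow_unbounded_of_one_lt (16 * C * ((d : ℝ) + 1) ^ d)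
    (show (1 : ℝ) < 4 by norm_num)
  set q := q₀ + 2 with hq
  set m := d + 1 with hm
  refine ⟨m * q, fun f hf => ?_⟩
  by_contra hne
  have hstep : ∀ k, l (iterComm f (k + 1)) ≤ (1 / 4) ^ e * l (iterComm f k) := by
    intro k
    refine (hl.comm_le _ _).trans ?_
    have := mul_le_mul_of_nonneg_left (hε _ (hf (k + 1))) (hl.nonneg (iterComm f k))
    linarith
  have hpos : ∀ k ≤ m * q, 0 < l (iterComm f k) := by
    intro k hk
    refine lt_of_le_of_ne (hl.nonneg _) fun h0 => hne ?_
    have : ∀ j, l (iterComm f (k + j)) = 0 := by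
      intro j
      induction j with
      | zero => exact h0.symm
      | succ j ih =>
        refine le_antisymm ?_ (hl.nonneg _)
        have := hstep (k + j)
        rwa [ih, mul_zero] at this
    have h := this (m * q - k)
    rwa [Nat.add_sub_cancel' hk] at h
  have hsteps : ∀ k j, l (iterComm f (k + j)) ≤ ((1 / 4) ^ e) ^ j * l (iterComm f k) := by
    intro k j
    induction j with
    | zero => simp
    | succ j ih =>
      refine (hstep (k + j)).trans ?_
      rw [pow_succ' _ j, mul_assoc]
      exact mul_le_mul_of_nonneg_left ih (pow_nonneg (by norm_num) _)
  set M : ℕ := 4 ^ (e * q - 2) with hM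
  have heq2 : 2 ≤ e * q := by
    have : 1 ≤ e := by omega
    nlinarith
  have hMq : (M : ℝ) * ((1 / 4) ^ e) ^ q = 1 / 16 := by
    have : (4 : ℝ) ^ (e * q) = 4 ^ (e * q - 2) * 16 := by
      rw [show (16 : ℝ) = 4 ^ 2 by norm_num, ← pow_add, Nat.sub_add_cancel heq2]
    rw [hM, ← pow_mul, one_div, inv_pow, this]
    push_cast
    field_simp
  have hM1 : 1 ≤ M := Nat.one_le_pow _ _ (by norm_num)
  set L : ℕ := 4 ^ (m * q) with hL
  let h : ℕ → G := fun j => iterComm f ((m - j) * q)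
  have hidx : ∀ j, (m - j) * q ≤ m * q := fun j => Nat.mul_le_mul_right q (Nat.sub_le m j)
  have hhpos : ∀ j, 0 < l (h j) := fun j => hpos _ (hidx j)
  have hhle : ∀ j < m, l (h j) ≤ ((1 / 4) ^ e) ^ q * l (h (j + 1)) := by
    intro j hj
    have := hsteps ((m - (j + 1)) * q) q
    rwa [show (m - (j + 1)) * q + q = (m - j) * q by
      rw [show m - j = (m - (j + 1)) + 1 by omega, add_mul, one_mul]] at this
  have hl0 : ∀ k, l (iterComm f k) ≤ 1 := by
    intro k
    have h1 := hsteps 0 k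
    rw [zero_add] at h1
    have h2 : ((1 / 4 : ℝ) ^ e) ^ k ≤ 1 := by
      rw [← pow_mul]; exact pow_le_one₀ (by norm_num) (by norm_num)
    have h3 : (1 / 4 : ℝ) ^ e ≤ 1 := pow_le_one₀ (by norm_num) (by norm_num)
    have h4 := hε _ (hf 0)
    have h5 : l (iterComm f 0) = l (f 0) := rfl
    have h6 := hl.nonneg (f 0)
    rw [h5] at h1
    nlinarith
  have hMh : ∀ j < m, (M : ℝ) * l (h j) ≤ 1 / 2 := by
    intro j hj
    have h1 := mul_le_mul_of_nonneg_left ((hhle j hj).trans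
      (mul_le_of_le_one_right (by positivity) (hl0 _))) (Nat.cast_nonneg (α := ℝ) M)
    rw [hMq] at h1
    linarith
  have hhT : ∀ j, h j ∈ T ^ L := fun j =>
    pow_subset_pow_of_le h1T (Nat.pow_le_pow_right (by norm_num) (hidx j))
      (iterComm_mem_pow h1T hTinv (fun i => Set.mem_insert_of_mem _ (Or.inl (hf i))) _)
  have hA : ∀ j ≤ m, ∃ A : Finset G, A.card = (M + 1) ^ j ∧ (∀ a ∈ A, l a ≤ l (h j) / 8) ∧
      (A : Set G) ⊆ T ^ (j * (M * L)) := by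
    classical
    intro j
    induction j with
    | zero =>
      intro _
      refine ⟨{1}, by simp, ?_, by simp⟩
      intro a ha
      rw [Finset.mem_singleton.1 ha, hl.one]
      have := hhpos 0
      positivity
    | succ j ih =>
      intro hj
      obtain ⟨A, hAc, hAl, hAT⟩ := ih (by omega)
      have hjm : j < m := by omega
      refine ⟨(Finset.range (M + 1) ×ˢ A).image fun x => h j ^ x.1 * x.2, ?_, ?_, ?_⟩
      · rw [Finset.card_image_of_injOn, Finset.card_product, Finset.card_range, hAc, pow_succ']
        rintro ⟨i, a⟩ hia ⟨i', a'⟩ hia' heq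
        simp only [Finset.coe_product, Set.mem_prod, Finset.mem_coe, Finset.mem_range] at hia hia'
        obtain ⟨h1, h2⟩ := hl.injOn (hhpos j) (hMh j hjm) (A := A) hAl (by omega : i ≤ M)
          (by omega : i' ≤ M) hia.2 hia'.2 heq
        rw [h1, h2]
      · intro x hx
        obtain ⟨⟨i, a⟩, hia, rfl⟩ := Finset.mem_image.1 hx
        simp only [Finset.mem_product, Finset.mem_range] at hia
        have h1 := hl.mul_le (h j ^ i) a
        have h2 := hl.pow_le (h j) i
        have h3 := hAl a hia.2
        have h4 : (i : ℝ) * l (h j) ≤ M * l (h j) :=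
          mul_le_mul_of_nonneg_right (Nat.cast_le.2 (by omega)) (hhpos j).le
        have h5 : l (h j) ≤ M * l (h j) :=
          le_mul_of_one_le_left (hhpos j).le (by exact_mod_cast hM1)
        have h6 := mul_le_mul_of_nonneg_left (hhle j hjm) (Nat.cast_nonneg (α := ℝ) M)
        rw [← mul_assoc, hMq] at h6
        have h7 := hhpos (j + 1)
        simp only
        linarith
      · intro x hx
        obtain ⟨⟨i, a⟩, hia, rfl⟩ := Finset.mem_image.1 (Finset.mem_coe.1 hx)
        simp only [Finset.mem_product, Finset.mem_range] at hia
        rw [add_mul, one_mul, add_comm, pow_add]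
        refine Set.mul_mem_mul ?_ (hAT hia.2)
        have : h j ^ i ∈ (T ^ L) ^ i := Set.pow_mem_pow (hhT j)
        rw [← pow_mul] at this
        refine pow_subset_pow_of_le h1T ?_ this
        rw [mul_comm M]
        exact Nat.mul_le_mul_left L (by omega)
  obtain ⟨A, hAc, -, hAT⟩ := hA m le_rfl
  have hLpos : 1 ≤ L := Nat.one_le_pow _ _ (by norm_num)
  have hcount := hC (m * (M * L)) (Nat.mul_pos (by omega) (Nat.mul_pos hM1 hLpos))
  have h1 : ((A.card : ℕ) : ℝ) ≤ ((T ^ (m * (M * L))).ncard : ℝ) := by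
    rw [← Set.ncard_coe_finset]
    exact Nat.cast_le.2 (Set.ncard_le_ncard hAT (finite_pow hT _))
  have h2 := h1.trans hcount
  rw [hAc] at h2
  push_cast at h2
  have hMpos : (0 : ℝ) < (M : ℝ) ^ d := by
    have : (0 : ℝ) < M := by exact_mod_cast hM1
    positivity
  have h3 : (M : ℝ) * (M : ℝ) ^ d ≤ ((M : ℝ) + 1) ^ m := by
    rw [hm, ← pow_succ']
    exact pow_le_pow_left₀ (Nat.cast_nonneg M) (by linarith) _
  have h4 : (M : ℝ) * (M : ℝ) ^ d ≤ (C * m ^ d * L ^ d) * (M : ℝ) ^ d := by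
    refine h3.trans (h2.trans (le_of_eq ?_))
    rw [mul_pow, mul_pow]
    ring
  have h5 := le_of_mul_le_mul_right h4 hMpos
  have h6 : (16 : ℝ) * M = 4 ^ q * L ^ d := by
    rw [hM, hL]
    push_cast
    rw [← pow_mul, ← pow_add, show (16 : ℝ) = 4 ^ 2 by norm_num, ← pow_add]
    congr 1
    have : e * q = q + m * q * d := by rw [he]; ring
    omega
  have hLd : (0 : ℝ) < (L : ℝ) ^ d := by
    have : (0 : ℝ) < L := by exact_mod_cast hLpos
    positivity
  have h7 : (4 : ℝ) ^ q * L ^ d ≤ (16 * C * m ^ d) * L ^ d := by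
    rw [← h6]; nlinarith
  have h8 := le_of_mul_le_mul_right h7 hLd
  have h9 : (4 : ℝ) ^ q₀ ≤ 4 ^ q := pow_le_pow_right₀ (by norm_num) (by omega)
  rw [hm] at h8
  push_cast at h8
  linarith

end RandomWalk

namespace RandomWalk

open scoped Pointwise commutatorElement Topology

section Length

variable {G : Type*} [Group G] {A : Type*} [NormedRing A] [NormedAlgebra ℝ A]

theorem isCommLength_norm_sub_one (ρ : G →* A) (hρ : ∀ g, ‖ρ g‖ ≤ 1) :
    IsCommLength fun g => ‖ρ g - 1‖ := by
  have hmul : ∀ g a, ‖ρ g * a‖ ≤ ‖a‖ := fun g a =>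
    (norm_mul_le _ _).trans (mul_le_of_le_one_left (norm_nonneg a) (hρ g))
  have hmul' : ∀ g a, ‖a * ρ g‖ ≤ ‖a‖ := fun g a =>
    (norm_mul_le _ _).trans (mul_le_of_le_one_right (norm_nonneg a) (hρ g))
  have hcancel : ∀ g, ρ g * ρ g⁻¹ = 1 := fun g => by rw [← map_mul, mul_inv_cancel, map_one]
  have hinvle : ∀ g, ‖ρ g⁻¹ - 1‖ ≤ ‖ρ g - 1‖ := by
    intro g
    have h1 : ρ g⁻¹ - 1 = -((ρ g - 1) * ρ g⁻¹) := by rw [sub_mul, hcancel]; noncomm_ring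
    rw [h1, norm_neg]
    exact hmul' _ _
  refine ⟨fun g => norm_nonneg _, by simp, fun g h => ?_, fun g => ?_, fun g h => ?_, ?_⟩
  · have h1 : ρ (g * h) - 1 = ρ g * (ρ h - 1) + (ρ g - 1) := by rw [map_mul]; noncomm_ring
    rw [h1, add_comm ‖ρ g - 1‖]
    exact (norm_add_le _ _).trans (add_le_add (hmul _ _) le_rfl)
  · exact le_antisymm (hinvle g) (by simpa using hinvle g⁻¹)
  · have h1 : ρ ⁅g, h⁆ - 1 =
        ((ρ g - 1) * (ρ h - 1) - (ρ h - 1) * (ρ g - 1)) * ρ g⁻¹ * ρ h⁻¹ := by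
      have h2 : (ρ g - 1) * (ρ h - 1) - (ρ h - 1) * (ρ g - 1) = ρ g * ρ h - ρ h * ρ g := by
        noncomm_ring
      rw [h2, commutatorElement_def, map_mul, map_mul, map_mul, sub_mul, sub_mul,
        mul_assoc (ρ h) (ρ g), hcancel, mul_one, hcancel]
    rw [h1]
    refine (hmul' _ _).trans ((hmul' _ _).trans ((norm_sub_le _ _).trans ?_))
    have h2 := norm_mul_le (ρ g - 1) (ρ h - 1)
    have h3 := norm_mul_le (ρ h - 1) (ρ g - 1)
    linarith
  · intro g i hi
    have hi1 : ∀ i : ℕ, ‖ρ g ^ i - 1‖ ≤ i * ‖ρ g - 1‖ := by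
      intro i
      induction i with
      | zero => simp
      | succ i ih =>
        have h1 : ρ g ^ (i + 1) - 1 = ρ g * (ρ g ^ i - 1) + (ρ g - 1) := by
          rw [pow_succ']; noncomm_ring
        rw [h1]
        refine (norm_add_le _ _).trans ?_
        push_cast
        linarith [hmul g (ρ g ^ i - 1)]
    have hi2 : ∀ i : ℕ, ‖ρ g ^ i - 1 - (i : A) * (ρ g - 1)‖ ≤ (i * ‖ρ g - 1‖) ^ 2 := by
      intro i
      induction i with
      | zero => simp
      | succ i ih =>
        have h1 : ρ g ^ (i + 1) - 1 - ((i + 1 : ℕ) : A) * (ρ g - 1) =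
            (ρ g ^ i - 1 - (i : A) * (ρ g - 1)) + (ρ g ^ i - 1) * (ρ g - 1) := by
          rw [pow_succ]; push_cast; noncomm_ring
        rw [h1]
        refine (norm_add_le _ _).trans ?_
        have h2 := norm_mul_le (ρ g ^ i - 1) (ρ g - 1)
        have h3 := mul_le_mul_of_nonneg_right (hi1 i) (norm_nonneg (ρ g - 1))
        push_cast
        nlinarith [sq_nonneg ‖ρ g - 1‖, mul_nonneg (Nat.cast_nonneg (α := ℝ) i)
          (sq_nonneg ‖ρ g - 1‖)]
    have h1 : (i : A) * (ρ g - 1) = (i : ℝ) • (ρ g - 1) := by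
      rw [Nat.cast_smul_eq_nsmul, nsmul_eq_mul]
    have h2 := hi2 i
    rw [h1] at h2
    have h3 := norm_sub_norm_le ((i : ℝ) • (ρ g - 1)) (ρ g ^ i - 1)
    rw [norm_sub_rev ((i : ℝ) • (ρ g - 1)), norm_smul, Real.norm_natCast] at h3
    rw [map_pow]
    have h4 : 0 ≤ (i : ℝ) * ‖ρ g - 1‖ := by positivity
    nlinarith

theorem finiteIndex_closure_norm_sub_one_lt [ProperSpace A] (ρ : G →* A) (hρ : ∀ g, ‖ρ g‖ ≤ 1)
    {ε : ℝ} (hε : 0 < ε) : (Subgroup.closure {g | ‖ρ g - 1‖ < ε}).FiniteIndex := by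
  set H := Subgroup.closure {g | ‖ρ g - 1‖ < ε}
  obtain ⟨t, ht, hcov⟩ := Metric.totallyBounded_iff.1
    (isCompact_closedBall (0 : A) 1).totallyBounded (ε / 2) (by positivity)
  have hc : ∀ q : G ⧸ H, ∃ c ∈ t, dist (ρ q.out) c < ε / 2 := by
    intro q
    have h1 : ρ q.out ∈ closedBall (0 : A) 1 := by simpa using hρ q.out
    simpa using hcov h1
  choose c hct hcd using hc
  have hinj : Function.Injective c := by
    intro q q' h
    have h1 : dist (ρ q'.out) (ρ q.out) < ε := by
      have h2 := dist_triangle_right (ρ q'.out) (ρ q.out) (c q)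
      have h3 := hcd q'
      rw [← h] at h3
      linarith [hcd q]
    have h2 : ρ (q.out⁻¹ * q'.out) - 1 = ρ q.out⁻¹ * (ρ q'.out - ρ q.out) := by
      rw [mul_sub, ← map_mul, ← map_mul, inv_mul_cancel, map_one]
    have h3 : q.out⁻¹ * q'.out ∈ H := by
      refine Subgroup.subset_closure ?_
      change ‖_‖ < ε
      rw [h2]
      refine ((norm_mul_le _ _).trans (mul_le_of_le_one_left (norm_nonneg _) (hρ _))).trans_lt ?_
      rwa [← dist_eq_norm]
    rw [← q.out_eq', ← q'.out_eq']
    exact QuotientGroup.eq.2 h3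
  have : Finite (G ⧸ H) := by
    have := ht.to_subtype
    exact Finite.of_injective (fun q => (⟨c q, hct q⟩ : t)) fun q q' h =>
      hinj (congrArg Subtype.val h)
  exact Subgroup.finiteIndex_of_finite_quotient

end Length

theorem map_iterComm {G H : Type*} [Group G] [Group H] (φ : G →* H) (f : ℕ → G) (k : ℕ) :
    φ (iterComm f k) = iterComm (fun i => φ (f i)) k := by
  induction k with
  | zero => rfl
  | succ k ih => rw [iterComm, iterComm, map_commutatorElement, ih]

theorem iterComm_congr {G : Type*} [Group G] {f f' : ℕ → G} {k : ℕ} (h : ∀ i ≤ k, f i = f' i) :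
    iterComm f k = iterComm f' k := by
  induction k with
  | zero => exact h 0 le_rfl
  | succ k ih => rw [iterComm, iterComm, ih fun i hi => h i (by omega), h (k + 1) le_rfl]

theorem isNilpotent_of_iterComm (k : ℕ) : ∀ {G : Type*} [Group G] (S : Set G),
    Subgroup.closure S = ⊤ → (∀ f : ℕ → G, (∀ i, f i ∈ S) → iterComm f k = 1) →
    Group.IsNilpotent G := by
  induction k with
  | zero =>
    intro G _ S hS h
    have h1 : S ⊆ {1} := fun s hs => h (fun _ => s) fun _ => hs
    have h2 : (⊤ : Subgroup G) = ⊥ := by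
      rw [← hS, eq_bot_iff]
      exact (Subgroup.closure_le _).2 h1
    have : Subsingleton G := Subgroup.subsingleton_iff.1 (subsingleton_of_bot_eq_top h2.symm)
    infer_instance
  | succ k ih =>
    intro G _ S hS h
    refine Group.of_quotient_center_nilpotent (ih (QuotientGroup.mk '' S) ?_ ?_)
    · have h1 := MonoidHom.map_closure (QuotientGroup.mk' (Subgroup.center G)) S
      rw [hS, Subgroup.map_top_of_surjective _ (QuotientGroup.mk'_surjective _)] at h1
      exact h1.symm
    · intro f hf
      choose f' hf' hff' using hf
      have h1 : iterComm f k = QuotientGroup.mk' (Subgroup.center G) (iterComm f' k) := by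
        rw [map_iterComm]
        congr 1
        funext i
        exact (hff' i).symm
      rw [h1, QuotientGroup.mk'_apply, QuotientGroup.eq_one_iff]
      have h2 : S ⊆ Subgroup.centralizer {iterComm f' k} := by
        intro s hs
        have h3 := h (Function.update f' (k + 1) s) fun i => by
          by_cases hi : i = k + 1
          · subst hi; simpa using hs
          · simpa [Function.update_of_ne hi] using hf' i
        rw [iterComm, Function.update_self, iterComm_congr (f' := f') fun i hi =>
          Function.update_of_ne (by omega) _ _, commutatorElement_eq_one_iff_mul_comm] at h3
        exact Subgroup.mem_centralizer_iff.2 fun x hx => by rw [Set.mem_singleton_iff.1 hx, h3]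
      have h3 : Subgroup.centralizer {iterComm f' k} = ⊤ := by
        rw [eq_top_iff, ← hS]
        exact (Subgroup.closure_le _).2 h2
      rw [Subgroup.mem_center_iff]
      intro g
      have h4 : g ∈ Subgroup.centralizer {iterComm f' k} := by rw [h3]; trivial
      exact (Subgroup.mem_centralizer_iff.1 h4 _ rfl).symm

end RandomWalk

namespace RandomWalk

open scoped Pointwise commutatorElement Topology

theorem exists_finite_subset_mem_closure {G : Type*} [Group G] {S : Set G} {x : G}
    (hx : x ∈ Subgroup.closure S) : ∃ T ⊆ S, T.Finite ∧ x ∈ Subgroup.closure T := by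
  induction hx using Subgroup.closure_induction with
  | mem x hx => exact ⟨{x}, by simpa using hx, Set.finite_singleton x, Subgroup.subset_closure rfl⟩
  | one => exact ⟨∅, by simp, Set.finite_empty, one_mem _⟩
  | mul x y _ _ hx hy =>
    obtain ⟨T, hTS, hT, hxT⟩ := hx
    obtain ⟨T', hTS', hT', hyT'⟩ := hy
    exact ⟨T ∪ T', Set.union_subset hTS hTS', hT.union hT',
      mul_mem (Subgroup.closure_mono Set.subset_union_left hxT)
        (Subgroup.closure_mono Set.subset_union_right hyT')⟩
  | inv x _ hx =>
    obtain ⟨T, hTS, hT, hxT⟩ := hx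
    exact ⟨T, hTS, hT, inv_mem hxT⟩

theorem exists_finite_subset_closure_eq {G : Type*} [Group G] {S : Set G}
    (h : (Subgroup.closure S).FG) :
    ∃ T ⊆ S, T.Finite ∧ Subgroup.closure T = Subgroup.closure S := by
  obtain ⟨F, hF⟩ := h
  have h1 : ∀ x : F, ∃ T ⊆ S, T.Finite ∧ (x : G) ∈ Subgroup.closure T := fun x =>
    exists_finite_subset_mem_closure (by rw [← hF]; exact Subgroup.subset_closure x.2)
  choose T hTS hT hxT using h1
  refine ⟨⋃ x, T x, Set.iUnion_subset hTS, Set.finite_iUnion hT,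
    le_antisymm (Subgroup.closure_mono (Set.iUnion_subset hTS)) ?_⟩
  rw [← hF, Subgroup.closure_le]
  exact fun x hx => Subgroup.closure_mono (Set.subset_iUnion T ⟨x, hx⟩) (hxT ⟨x, hx⟩)

theorem exists_derivedSeries_le_ker {G : Type*} [Group G] [Group.FG G] {d : ℕ}
    (h : PolyGrowth G d) {A : Type*} [NormedRing A] [NormedAlgebra ℝ A] [ProperSpace A]
    (ρ : G →* A) (hρ : ∀ g, ‖ρ g‖ ≤ 1) :
    ∃ (G₁ : Subgroup G) (n : ℕ), G₁.FiniteIndex ∧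
      derivedSeries G₁ n ≤ (ρ.comp G₁.subtype).ker := by
  set ε : ℝ := (1 / 4) ^ ((d + 1) * d + 1) / 2 with hε
  set U : Set G := {g | ‖ρ g - 1‖ < ε}
  have hfin : (Subgroup.closure U).FiniteIndex :=
    finiteIndex_closure_norm_sub_one_lt ρ hρ (by positivity)
  obtain ⟨T, hTU, hT, hTc⟩ := exists_finite_subset_closure_eq (S := U)
    ((Group.fg_iff_subgroup_fg _).1 (Subgroup.fg_of_index_ne_zero _))
  set G₁ := Subgroup.closure U
  obtain ⟨k, hk⟩ := (isCommLength_norm_sub_one ρ hρ).exists_iterComm_eq_zero h hT fun s hs => by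
    have h1 : ‖ρ s - 1‖ < ε := hTU hs
    have h2 : (0 : ℝ) < (1 / 4) ^ ((d + 1) * d + 1) := by positivity
    linarith
  set ρ₁ : G₁ →* A := ρ.comp G₁.subtype
  have hnil : Group.IsNilpotent (G₁ ⧸ ρ₁.ker) := by
    refine isNilpotent_of_iterComm k (QuotientGroup.mk' ρ₁.ker '' (G₁.subtype ⁻¹' T)) ?_ ?_
    · rw [← MonoidHom.map_closure]
      have h1 : Subgroup.closure (G₁.subtype ⁻¹' T) = ⊤ := by
        refine Subgroup.map_injective G₁.subtype_injective ?_
        have h2 : T ⊆ G₁ := by rw [← hTc]; exact Subgroup.subset_closure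
        have h3 : T ⊆ Set.range G₁.subtype := by simpa using h2
        rw [MonoidHom.map_closure, Set.image_preimage_eq_of_subset h3, hTc,
          ← MonoidHom.range_eq_map, Subgroup.range_subtype]
      rw [h1, Subgroup.map_top_of_surjective _ (QuotientGroup.mk'_surjective _)]
    · intro f hf
      choose f' hf' hff' using hf
      have h1 : iterComm f k = QuotientGroup.mk' ρ₁.ker (iterComm f' k) := by
        rw [map_iterComm]
        congr 1
        funext i
        exact (hff' i).symm
      rw [h1, QuotientGroup.mk'_apply, QuotientGroup.eq_one_iff, MonoidHom.mem_ker]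
      have h2 := hk (fun i => f' i) hf'
      rw [norm_eq_zero, sub_eq_zero] at h2
      rw [← h2]
      exact congrArg ρ (map_iterComm G₁.subtype f' k)
  obtain ⟨n, hn⟩ := (inferInstance : Group.IsSolvable (G₁ ⧸ ρ₁.ker)).solvable
  refine ⟨G₁, n, hfin, fun x hx => ?_⟩
  have h1 := map_derivedSeries_le_derivedSeries (QuotientGroup.mk' ρ₁.ker) n
    (Subgroup.mem_map_of_mem _ hx)
  rw [hn, Subgroup.mem_bot, QuotientGroup.mk'_apply, QuotientGroup.eq_one_iff] at h1
  exact h1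

universe u

theorem exists_solvable_quotient {G : Type u} [Group G] [Infinite G] [Group.FG G] {d : ℕ}
    (h : PolyGrowth G d) : ∃ G₁ : Subgroup G, G₁.FiniteIndex ∧ ∃ N : Subgroup G₁, ∃ _ : N.Normal,
      Infinite (G₁ ⧸ N) ∧ Group.IsSolvable (G₁ ⧸ N) := by
  obtain ⟨E, _, _, _, π, b, hb, hinf⟩ := exists_affine_action h
  have : ProperSpace (E →L[ℝ] E) := FiniteDimensional.proper ℝ _
  let ρ : G →* (E →L[ℝ] E) :=
    { toFun := fun g => (π g).toContinuousLinearMap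
      map_one' := by ext; simp
      map_mul' := fun x y => by ext; simp }
  obtain ⟨G₁, n, hG₁, hn⟩ := exists_derivedSeries_le_ker h ρ fun g =>
    LinearIsometry.norm_toContinuousLinearMap_le _
  let Φ : G →* Function.End E :=
    { toFun := fun g v => π g v + b g
      map_one' := by funext v; simp [hb.map_one]; rfl
      map_mul' := fun x y => by
        funext v
        change _ = π x (π y v + b y) + b x
        rw [hb x y, map_mul, map_add]
        simp only [LinearIsometry.coe_mul, Function.comp_apply]
        abel }
  set N := (Φ.comp G₁.subtype).ker
  have hker : ∀ g : G₁, g ∈ N ↔ ∀ v, π g v + b g = v := fun g => by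
    rw [MonoidHom.mem_ker]
    exact funext_iff
  refine ⟨G₁, hG₁, N, inferInstance, ?_, ?_⟩
  · by_contra hfin
    rw [not_infinite_iff_finite] at hfin
    refine hinf ((Set.finite_range fun p : (G ⧸ G₁) × (G₁ ⧸ N) =>
      b (p.1.out * (p.2.out : G))).subset ?_)
    rintro _ ⟨g, rfl⟩
    obtain ⟨x, hx⟩ := QuotientGroup.mk_out_eq_mul G₁ g
    set y := (x⁻¹ : G₁)
    obtain ⟨z, hz⟩ := QuotientGroup.mk_out_eq_mul N y
    refine ⟨((g : G ⧸ G₁), (y : G₁ ⧸ N)), ?_⟩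
    have h1 := (hker z).1 z.2 0
    rw [map_zero, zero_add] at h1
    simp only
    rw [hz, hx]
    simp only [Subgroup.coe_mul]
    rw [mul_assoc, hb, hb x, hb (y : G), h1, map_zero, add_zero, ← hb x, ← Subgroup.coe_mul,
      mul_inv_cancel, Subgroup.coe_one, hb.map_one, map_zero, add_zero]
  · have h1 : derivedSeries G₁ (n + 1) ≤ N := by
      rw [derivedSeries_succ, Subgroup.commutator_le]
      intro x hx y hy
      have hπ : ∀ z ∈ derivedSeries G₁ n, ∀ v, π z v = v := fun z hz v => by
        have h2 : ρ z = 1 := hn hz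
        exact DFunLike.congr_fun h2 v
      have hc : ⁅x, y⁆ ∈ derivedSeries G₁ n := mul_mem (mul_mem (mul_mem hx hy) (inv_mem hx))
        (inv_mem hy)
      rw [hker]
      intro v
      rw [hπ _ hc]
      have h2 : ∀ z ∈ derivedSeries G₁ n, ∀ w : G₁, b (z * w : G₁) = b z + b w := fun z hz w => by
        rw [Subgroup.coe_mul, hb, hπ z hz]
      have h3 : b (⁅x, y⁆ * (y * x) : G₁) = b (x * y : G₁) := by
        rw [commutatorElement_def]; congr 2; group
      rw [h2 _ hc, h2 _ hy, h2 _ hx, add_comm (b (x : G)), add_eq_right] at h3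
      rw [h3, add_zero]
    refine ⟨⟨n + 1, ?_⟩⟩
    rw [← map_derivedSeries_eq (QuotientGroup.mk'_surjective N), Subgroup.map_eq_bot_iff,
      QuotientGroup.ker_mk']
    exact h1

end RandomWalk

namespace RandomWalk

open scoped Pointwise commutatorElement Topology DirectSum

/-- Some finite index subgroup surjects onto the integers. -/
def VirtuallyOntoInt (G : Type*) [Group G] : Prop :=
  ∃ H : Subgroup G, H.FiniteIndex ∧ ∃ f : H →* Multiplicative ℤ, Function.Surjective f

theorem VirtuallyOntoInt.of_subgroup {G : Type*} [Group G] (K : Subgroup G) [K.FiniteIndex]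
    (h : VirtuallyOntoInt K) : VirtuallyOntoInt G := by
  obtain ⟨H, hH, f, hf⟩ := h
  refine ⟨H.map K.subtype, ⟨?_⟩,
    f.comp (H.equivMapOfInjective K.subtype K.subtype_injective).symm.toMonoidHom,
    hf.comp (MulEquiv.surjective _)⟩
  rw [Subgroup.index_map_subtype]
  exact mul_ne_zero hH.index_ne_zero (Subgroup.FiniteIndex.index_ne_zero)

theorem VirtuallyOntoInt.of_surjective {G Q : Type*} [Group G] [Group Q] (φ : G →* Q)
    (hφ : Function.Surjective φ) (h : VirtuallyOntoInt Q) : VirtuallyOntoInt G := by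
  obtain ⟨H, hH, f, hf⟩ := h
  refine ⟨H.comap φ, ⟨?_⟩, f.comp (φ.subgroupComap H), hf.comp ?_⟩
  · rw [Subgroup.index_comap_of_surjective _ hφ]
    exact hH.index_ne_zero
  · rintro ⟨x, hx⟩
    obtain ⟨y, rfl⟩ := hφ x
    exact ⟨⟨y, hx⟩, rfl⟩

theorem exists_surjective_int {A : Type*} [AddCommGroup A] [AddGroup.FG A] [Infinite A] :
    ∃ f : A →+ ℤ, Function.Surjective f := by
  obtain ⟨n, ι, _, p, hp, e, ⟨φ⟩⟩ := AddCommGroup.equiv_free_prod_directSum_zmod A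
  have hn : n ≠ 0 := by
    rintro rfl
    have : ∀ i, NeZero (p i ^ e i) := fun i => ⟨pow_ne_zero _ (hp i).ne_zero⟩
    have : Finite (⨁ i : ι, ZMod (p i ^ e i)) :=
      Finite.of_injective (fun x i => x i) DFunLike.coe_injective
    exact not_finite_iff_infinite.2 ‹Infinite A› (Finite.of_equiv _ φ.symm.toEquiv)
  refine ⟨(Finsupp.applyAddHom ⟨0, Nat.pos_of_ne_zero hn⟩).comp
    ((AddMonoidHom.fst _ _).comp φ.toAddMonoidHom), fun m =>
    ⟨φ.symm (Finsupp.single ⟨0, Nat.pos_of_ne_zero hn⟩ m, 0), by simp⟩⟩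

theorem map_derivedSeries_commutator_le {G : Type*} [Group G] (n : ℕ) :
    (derivedSeries (commutator G) n).map (commutator G).subtype ≤ derivedSeries G (n + 1) := by
  induction n with
  | zero =>
    rw [derivedSeries_zero, ← MonoidHom.range_eq_map, Subgroup.range_subtype, derivedSeries_one]
  | succ n ih =>
    rw [derivedSeries_succ, derivedSeries_succ _ (n + 1), Subgroup.map_commutator]
    exact Subgroup.commutator_mono ih ih

theorem virtuallyOntoInt_of_derivedSeries (n : ℕ) : ∀ {Q : Type*} [Group Q] [Group.FG Q]
    [Infinite Q], derivedSeries Q n = ⊥ → VirtuallyOntoInt Q := by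
  induction n with
  | zero =>
    intro Q _ _ _ h
    have : Subsingleton Q := Subgroup.subsingleton_iff.1 (subsingleton_of_bot_eq_top h.symm)
    exact (not_finite Q).elim
  | succ n ih =>
    intro Q _ _ _ h
    have hfg : Group.FG (Abelianization Q) :=
      Group.fg_of_surjective (QuotientGroup.mk'_surjective (commutator Q))
    rcases finite_or_infinite (Abelianization Q) with hfin | hinf
    · have : (commutator Q).FiniteIndex :=
        Subgroup.finiteIndex_iff_finite_quotient.2 hfin
      have h1 : Group.FG (commutator Q) := Subgroup.fg_of_index_ne_zero _
      have h2 : Infinite (commutator Q) := by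
        rw [← not_finite_iff_infinite]
        intro h3
        exact not_finite_iff_infinite.2 ‹Infinite Q›
          ((Subgroup.finite_iff_finite_and_finiteIndex (H := commutator Q)).2 ⟨h3, this⟩)
      refine VirtuallyOntoInt.of_subgroup (commutator Q) (ih ?_)
      have h3 := map_derivedSeries_commutator_le (G := Q) n
      rw [h, le_bot_iff, Subgroup.map_eq_bot_iff_of_injective _ (Subgroup.subtype_injective _)]
        at h3
      exact h3
    · obtain ⟨f, hf⟩ := exists_surjective_int (A := Additive (Abelianization Q))
      refine VirtuallyOntoInt.of_surjective (QuotientGroup.mk' (commutator Q))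
        (QuotientGroup.mk'_surjective _) ⟨⊤, inferInstance,
          (AddMonoidHom.toMultiplicativeRight f).comp (Subgroup.subtype ⊤), ?_⟩
      intro m
      obtain ⟨x, hx⟩ := hf m.toAdd
      exact ⟨⟨x.toMul, trivial⟩, hx⟩

universe u

theorem PolyGrowth.virtuallyOntoInt {G : Type u} [Group G] [Infinite G] [Group.FG G] {d : ℕ}
    (h : PolyGrowth G d) : VirtuallyOntoInt G := by
  obtain ⟨G₁, _, N, _, _, ⟨n, hn⟩⟩ := exists_solvable_quotient h
  have h1 : Group.FG G₁ := Subgroup.fg_of_index_ne_zero _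
  have h2 : Group.FG (G₁ ⧸ N) := Group.fg_of_surjective (QuotientGroup.mk'_surjective N)
  exact (virtuallyOntoInt_of_derivedSeries n hn).of_surjective (QuotientGroup.mk' N)
    (QuotientGroup.mk'_surjective N) |>.of_subgroup

end RandomWalk

namespace RandomWalk

open scoped Pointwise commutatorElement Topology

section Word

variable {G : Type*} [Group G]

/-- The product of the `t * u ^ e i` for `i < n`. -/
def word (t u : G) (e : ℕ → ℕ) : ℕ → G
  | 0 => 1
  | n + 1 => word t u e n * (t * u ^ e n)

theorem word_congr (t u : G) {e e' : ℕ → ℕ} {n : ℕ} (h : ∀ i < n, e i = e' i) :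
    word t u e n = word t u e' n := by
  induction n with
  | zero => rfl
  | succ n ih => rw [word, word, ih fun i hi => h i (by omega), h n (by omega)]

theorem word_add (t u : G) (e : ℕ → ℕ) (j m : ℕ) :
    word t u e (j + m) = word t u e j * word t u (fun i => e (j + i)) m := by
  induction m with
  | zero => simp [word]
  | succ m ih => rw [← add_assoc, word, word, ih]; group

theorem word_mem_pow (t u : G) (e : ℕ → ℕ) (he : ∀ i, e i ≤ 1) (n : ℕ) :
    word t u e n ∈ ({t, t * u} : Set G) ^ n := by
  induction n with
  | zero => exact rfl
  | succ n ih =>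
    rw [word, pow_succ]
    refine Set.mul_mem_mul ih ?_
    have h := he n
    interval_cases e n <;> simp

theorem exists_pow_lt_two_pow (C : ℝ) (d : ℕ) : ∃ n : ℕ, 1 ≤ n ∧ C * (n : ℝ) ^ d < 2 ^ n := by
  have h1 := tendsto_pow_const_div_const_pow_of_one_lt d (one_lt_two (α := ℝ))
  have h2 := h1.const_mul C
  rw [mul_zero] at h2
  obtain ⟨n, hn, hn1⟩ := ((h2.eventually (gt_mem_nhds one_pos)).and (eventually_ge_atTop 1)).exists
  refine ⟨n, hn1, ?_⟩
  rwa [← mul_div_assoc, div_lt_one (by positivity)] at hn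

theorem PolyGrowth.exists_word_eq {d : ℕ} (h : PolyGrowth G d) (t u : G) :
    ∃ (m : ℕ) (e e' : ℕ → ℕ), (∀ i, e i ≤ 1) ∧ (∀ i, e' i ≤ 1) ∧
      u * word t u e m = word t u e' m := by
  obtain ⟨C, hC⟩ := h {t, t * u} (Set.toFinite _)
  obtain ⟨n, hn1, hn⟩ := exists_pow_lt_two_pow C d
  let E : (Fin n → Bool) → ℕ → ℕ := fun f i => if h : i < n then (f ⟨i, h⟩).toNat else 0
  have hE : ∀ f i, E f i ≤ 1 := by
    intro f i
    simp only [E]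
    split_ifs
    · exact Bool.toNat_le _
    · simp
  have hni : ¬ Function.Injective fun f => word t u (E f) n := by
    intro hinj
    have h1 : (Set.range fun f => word t u (E f) n).ncard ≤ (({t, t * u} : Set G) ^ n).ncard :=
      Set.ncard_le_ncard (Set.range_subset_iff.2 fun f => word_mem_pow t u _ (hE f) n)
        (finite_pow (Set.toFinite _) n)
    rw [← Set.image_univ, Set.ncard_image_of_injective _ hinj, Set.ncard_univ] at h1
    simp only [Nat.card_eq_fintype_card, Fintype.card_fun, Fintype.card_bool,
      Fintype.card_fin] at h1
    have h2 : ((2 ^ n : ℕ) : ℝ) ≤ _ := (Nat.cast_le.2 h1).trans (hC n hn1)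
    push_cast at h2
    linarith
  rw [Function.Injective] at hni
  push Not at hni
  obtain ⟨f, f', hff, hne⟩ := hni
  have hex : ∃ j, E f j ≠ E f' j := by
    by_contra! hcon
    refine hne (funext fun i => ?_)
    have h1 := hcon i
    simp only [E, i.2, dite_true] at h1
    cases h2 : f i <;> cases h3 : f' i <;> simp_all
  classical
  set j := Nat.find hex with hj
  have hj1 : E f j ≠ E f' j := Nat.find_spec hex
  have hj2 : ∀ i < j, E f i = E f' i := fun i hi => not_not.1 (Nat.find_min hex hi)
  have hjn : j < n := by
    by_contra hcon
    exact hj1 (by simp [E, hcon])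
  obtain ⟨m, hm⟩ := Nat.exists_eq_add_of_lt hjn
  have h1 : word t u (E f) n = word t u (E f') n := hff
  have hsplit : ∀ e : ℕ → ℕ,
      word t u e n = word t u e j * (t * u ^ e j) * word t u (fun i => e (j + 1 + i)) m := by
    intro e
    rw [hm, add_right_comm, word_add, word]
  rw [hsplit, hsplit, word_congr t u hj2, mul_assoc, mul_assoc (word t u (E f') j),
    mul_right_inj, mul_assoc, mul_assoc, mul_right_inj] at h1
  have ha := hE f j
  have hb := hE f' j
  rcases Nat.lt_or_gt_of_ne hj1 with hlt | hlt
  · rw [show E f j = 0 by omega, show E f' j = 1 by omega, pow_zero, one_mul, pow_one] at h1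
    exact ⟨m, _, _, fun i => hE f' _, fun i => hE f _, h1.symm⟩
  · rw [show E f j = 1 by omega, show E f' j = 0 by omega, pow_zero, one_mul, pow_one] at h1
    exact ⟨m, _, _, fun i => hE f _, fun i => hE f' _, h1⟩

theorem word_mul_mem_closure (t u : G) (e : ℕ → ℕ) (n : ℕ) :
    word t u e n * (t ^ n)⁻¹ ∈
      Subgroup.closure ((fun i : ℕ => t ^ i * u * (t ^ i)⁻¹) '' Set.Icc 1 n) := by
  induction n with
  | zero => simp [word]
  | succ n ih =>
    have h1 : word t u e (n + 1) * (t ^ (n + 1))⁻¹ =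
        word t u e n * (t ^ n)⁻¹ * (t ^ (n + 1) * u * (t ^ (n + 1))⁻¹) ^ e n := by
      rw [word, conj_pow, pow_succ]; group
    rw [h1]
    refine mul_mem (Subgroup.closure_mono (Set.image_mono (Set.Icc_subset_Icc_right
      (Nat.le_succ n))) ih) (pow_mem (Subgroup.subset_closure ?_) _)
    exact ⟨n + 1, ⟨by omega, le_rfl⟩, rfl⟩

theorem PolyGrowth.exists_mem_closure_conj {d : ℕ} (h : PolyGrowth G d) (t u : G) :
    ∃ n, ∀ m ≥ n, u ∈ Subgroup.closure ((fun i : ℕ => t ^ i * u * (t ^ i)⁻¹) '' Set.Icc 1 m) := by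
  obtain ⟨n, e, e', -, -, hn⟩ := h.exists_word_eq t u
  refine ⟨n, fun m hm => Subgroup.closure_mono (Set.image_mono (Set.Icc_subset_Icc_right hm)) ?_⟩
  have h1 : u = (word t u e' n * (t ^ n)⁻¹) * (word t u e n * (t ^ n)⁻¹)⁻¹ := by
    rw [← hn]; group
  have h2 := mul_mem (word_mul_mem_closure t u e' n) (inv_mem (word_mul_mem_closure t u e n))
  rwa [← h1] at h2

theorem PolyGrowth.ker_fg [hfg : Group.FG G] {d : ℕ} (h : PolyGrowth G d)
    (f : G →* Multiplicative ℤ) {t : G} (ht : f t = Multiplicative.ofAdd 1) : f.ker.FG := by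
  obtain ⟨S, hS, hSfin⟩ := Group.fg_iff.1 hfg
  set p : G → G := fun s => s * (t ^ (f s).toAdd)⁻¹ with hp
  have hfp : ∀ s, f (p s) = 1 := fun s => by
    rw [hp, map_mul, map_inv, map_zpow, ht, ← ofAdd_zsmul, smul_eq_mul, mul_one, ofAdd_toAdd,
      mul_inv_cancel]
  have h1 : ∀ s : S, ∃ n, ∀ m ≥ n, p s ∈ Subgroup.closure
      ((fun i : ℕ => t ^ i * p s * (t ^ i)⁻¹) '' Set.Icc 1 m) := fun s =>
    h.exists_mem_closure_conj t _
  have h2 : ∀ s : S, ∃ n, ∀ m ≥ n, p s ∈ Subgroup.closure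
      ((fun i : ℕ => t⁻¹ ^ i * p s * (t⁻¹ ^ i)⁻¹) '' Set.Icc 1 m) := fun s =>
    h.exists_mem_closure_conj t⁻¹ _
  choose n₁ hn₁ using h1
  choose n₂ hn₂ using h2
  have := hSfin.fintype
  set n := (∑ s, n₁ s) + ∑ s, n₂ s
  have hle₁ : ∀ s, n₁ s ≤ n := fun s =>
    (Finset.single_le_sum (f := n₁) (fun _ _ => Nat.zero_le _) (Finset.mem_univ s)).trans
      (Nat.le_add_right _ _)
  have hle₂ : ∀ s, n₂ s ≤ n := fun s =>
    (Finset.single_le_sum (f := n₂) (fun _ _ => Nat.zero_le _) (Finset.mem_univ s)).trans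
      (Nat.le_add_left _ _)
  set V : Set G := Set.range fun q : S × Fin (n + 1) => t ^ (q.2 : ℕ) * p q.1 * (t ^ (q.2 : ℕ))⁻¹
  set L := Subgroup.closure V
  have hV : ∀ s : S, ∀ i ≤ n, t ^ i * p s * (t ^ i)⁻¹ ∈ L := fun s i hi =>
    Subgroup.subset_closure ⟨(s, ⟨i, by omega⟩), rfl⟩
  have hup : ∀ x ∈ L, t * x * t⁻¹ ∈ L := by
    intro x hx
    have h3 : L ≤ L.comap (MulAut.conj t).toMonoidHom := by
      rw [Subgroup.closure_le]
      rintro _ ⟨⟨s, ⟨i, hi⟩⟩, rfl⟩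
      change t * (t ^ i * p s * (t ^ i)⁻¹) * t⁻¹ ∈ L
      rcases Nat.lt_or_ge i n with hin | hin
      · rw [show t * (t ^ i * p s * (t ^ i)⁻¹) * t⁻¹ =
          t ^ (i + 1) * p s * (t ^ (i + 1))⁻¹ by rw [pow_succ']; group]
        exact hV s _ hin
      · obtain rfl : n = i := by omega
        set i := n
        have h4 := hn₂ s (i + 1) ((hle₂ s).trans (Nat.le_succ i))
        have h5 : Subgroup.closure ((fun k : ℕ => t⁻¹ ^ k * p s * (t⁻¹ ^ k)⁻¹) ''
            Set.Icc 1 (i + 1)) ≤ L.comap (MulAut.conj (t ^ (i + 1))).toMonoidHom := by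
          rw [Subgroup.closure_le]
          rintro _ ⟨k, ⟨hk1, hk2⟩, rfl⟩
          change t ^ (i + 1) * (t⁻¹ ^ k * p s * (t⁻¹ ^ k)⁻¹) * (t ^ (i + 1))⁻¹ ∈ L
          have h6 : t ^ (i + 1) = t ^ (i + 1 - k) * t ^ k := by
            rw [← pow_add]; congr 1; omega
          rw [h6, show t ^ (i + 1 - k) * t ^ k * (t⁻¹ ^ k * p s * (t⁻¹ ^ k)⁻¹) *
            (t ^ (i + 1 - k) * t ^ k)⁻¹ = t ^ (i + 1 - k) * p s * (t ^ (i + 1 - k))⁻¹ by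
              rw [inv_pow]; group]
          exact hV s _ (by omega)
        have h6 : t ^ (i + 1) * p s * (t ^ (i + 1))⁻¹ ∈ L := h5 h4
        rwa [show t * (t ^ i * p s * (t ^ i)⁻¹) * t⁻¹ =
          t ^ (i + 1) * p s * (t ^ (i + 1))⁻¹ by rw [pow_succ']; group]
    exact h3 hx
  have hdown : ∀ x ∈ L, t⁻¹ * x * t ∈ L := by
    intro x hx
    have h3 : L ≤ L.comap (MulAut.conj t⁻¹).toMonoidHom := by
      rw [Subgroup.closure_le]
      rintro _ ⟨⟨s, ⟨i, hi⟩⟩, rfl⟩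
      change t⁻¹ * (t ^ i * p s * (t ^ i)⁻¹) * t⁻¹⁻¹ ∈ L
      rcases Nat.eq_zero_or_pos i with hi0 | hi0
      · subst hi0
        have h4 := hn₁ s n (hle₁ s)
        have h5 : Subgroup.closure ((fun k : ℕ => t ^ k * p s * (t ^ k)⁻¹) ''
            Set.Icc 1 n) ≤ L.comap (MulAut.conj t⁻¹).toMonoidHom := by
          rw [Subgroup.closure_le]
          rintro _ ⟨k, ⟨hk1, hk2⟩, rfl⟩
          change t⁻¹ * (t ^ k * p s * (t ^ k)⁻¹) * t⁻¹⁻¹ ∈ L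
          obtain ⟨k, rfl⟩ := Nat.exists_eq_add_of_le' hk1
          rw [show t⁻¹ * (t ^ (k + 1) * p s * (t ^ (k + 1))⁻¹) * t⁻¹⁻¹ =
            t ^ k * p s * (t ^ k)⁻¹ by rw [pow_succ']; group]
          exact hV s _ (by omega)
        have h6 : t⁻¹ * p s * t⁻¹⁻¹ ∈ L := h5 h4
        simpa using h6
      · obtain ⟨k, rfl⟩ := Nat.exists_eq_add_of_le' hi0
        rw [show t⁻¹ * (t ^ (k + 1) * p s * (t ^ (k + 1))⁻¹) * t⁻¹⁻¹ =
          t ^ k * p s * (t ^ k)⁻¹ by rw [pow_succ']; group]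
        exact hV s _ (by omega)
    simpa using h3 hx
  have htn : t ∈ Subgroup.normalizer (L : Set G) := by
    rw [Subgroup.mem_normalizer_iff]
    refine fun x => ⟨hup x, fun hx => ?_⟩
    have h3 := hdown _ hx
    rwa [show t⁻¹ * (t * x * t⁻¹) * t = x by group] at h3
  have hpL : ∀ s ∈ S, p s ∈ L := fun s hs => by simpa using hV ⟨s, hs⟩ 0 (Nat.zero_le _)
  have hsp : ∀ s, s = p s * t ^ (f s).toAdd := fun s => by simp [hp]
  have hnorm : Subgroup.normalizer (L : Set G) = ⊤ := by
    rw [eq_top_iff, ← hS, Subgroup.closure_le]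
    intro s hs
    rw [hsp s]
    exact mul_mem (Subgroup.le_normalizer (hpL s hs)) (zpow_mem htn _)
  have hLn : L.Normal := Subgroup.normalizer_eq_top_iff.1 hnorm
  have hsup : L ⊔ Subgroup.zpowers t = ⊤ := by
    rw [eq_top_iff, ← hS, Subgroup.closure_le]
    intro s hs
    rw [hsp s]
    exact mul_mem (Subgroup.mem_sup_left (hpL s hs))
      (Subgroup.mem_sup_right (Subgroup.zpow_mem_zpowers t _))
  have hLK : L ≤ f.ker := by
    rw [Subgroup.closure_le]
    rintro _ ⟨⟨s, i⟩, rfl⟩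
    have h3 := hfp s
    simp [MonoidHom.mem_ker, h3]
  have hKL : f.ker ≤ L := by
    intro x hx
    have h3 : x ∈ L ⊔ Subgroup.zpowers t := by rw [hsup]; trivial
    obtain ⟨y, hy, _, ⟨k, rfl⟩, rfl⟩ := Subgroup.mem_sup_of_normal_left.1 h3
    have h4 : f y = 1 := hLK hy
    have h5 : f (y * t ^ k) = 1 := hx
    rw [map_mul, h4, one_mul, map_zpow, ht, ← ofAdd_zsmul, smul_eq_mul, mul_one] at h5
    have h6 : k = 0 := h5
    simpa [h6] using hy
  rw [le_antisymm hKL hLK]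
  exact (Subgroup.fg_iff _).2 ⟨V, rfl, Set.finite_range _⟩

theorem PolyGrowth.exists_ker {d : ℕ} (h : PolyGrowth G d)
    (f : G →* Multiplicative ℤ) {t : G} (ht : f t = Multiplicative.ofAdd 1) :
    ∃ d', d = d' + 1 ∧ PolyGrowth f.ker d' := by
  have key : ∀ T : Set G, T.Finite → (∀ x ∈ T, f x = 1) → ∃ C : ℝ, ∀ n : ℕ, 1 ≤ n →
      n * ((T ^ n).ncard : ℝ) ≤ C * n ^ d := by
    intro T hT hTf
    obtain ⟨C, hC⟩ := h (T ∪ {1, t}) (hT.union (Set.toFinite _))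
    refine ⟨C * 2 ^ d, fun n hn => ?_⟩
    have h1 : ∀ k, ∀ x ∈ T ^ k, f x = 1 := by
      intro k
      induction k with
      | zero => intro x hx; rw [pow_zero, Set.mem_one] at hx; simp [hx]
      | succ k ih =>
        rintro _ hx
        rw [pow_succ] at hx
        obtain ⟨y, hy, z, hz, rfl⟩ := hx
        simp [ih y hy, hTf z hz]
    have h2 : ((fun q : G × ℕ => q.1 * t ^ q.2) '' ((T ^ n) ×ˢ (Set.Iio n))) ⊆
        (T ∪ {1, t}) ^ (2 * n) := by
      rintro _ ⟨⟨x, i⟩, ⟨hx, hi⟩, rfl⟩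
      rw [two_mul, pow_add]
      refine Set.mul_mem_mul (Set.pow_subset_pow_left Set.subset_union_left hx) ?_
      have h3 : t ^ i ∈ (T ∪ {1, t}) ^ i := Set.pow_mem_pow (by simp)
      exact Set.pow_subset_pow_right (by simp) (le_of_lt hi) h3
    have h3 : Set.InjOn (fun q : G × ℕ => q.1 * t ^ q.2) ((T ^ n) ×ˢ (Set.Iio n)) := by
      rintro ⟨x, i⟩ ⟨hx, -⟩ ⟨y, j⟩ ⟨hy, -⟩ hxy
      simp only at hxy
      have h4 := congrArg f hxy
      rw [map_mul, map_mul, h1 n x hx, h1 n y hy, map_pow, map_pow, ht, one_mul, one_mul,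
        ← ofAdd_nsmul, ← ofAdd_nsmul] at h4
      have h5 : i = j := by simpa using h4
      subst h5
      simpa using hxy
    have h4 := Set.ncard_le_ncard h2 (finite_pow (hT.union (Set.toFinite _)) _)
    rw [h3.ncard_image, Set.ncard_prod, Set.ncard_Iio_nat] at h4
    have h5 : (((T ^ n).ncard * n : ℕ) : ℝ) ≤ _ := (Nat.cast_le.2 h4).trans (hC (2 * n) (by omega))
    push_cast at h5
    rw [mul_pow, ← mul_assoc] at h5
    linarith
  have hd : d ≠ 0 := by
    rintro rfl
    obtain ⟨C, hC⟩ := key {1} (Set.finite_singleton 1) (by simp)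
    obtain ⟨n, hn⟩ := exists_nat_gt (max C 1)
    have hn1 : (1 : ℝ) < n := (le_max_right _ _).trans_lt hn
    have h1 := hC n (by exact_mod_cast hn1.le)
    simp at h1
    linarith [le_max_left C 1]
  obtain ⟨d', rfl⟩ := Nat.exists_eq_succ_of_ne_zero hd
  refine ⟨d', rfl, fun T hT => ?_⟩
  obtain ⟨C, hC⟩ := key (f.ker.subtype '' T) (hT.image _) (by rintro _ ⟨x, -, rfl⟩; exact x.2)
  refine ⟨C, fun n hn => ?_⟩
  have h1 := hC n hn
  rw [← Set.image_pow, Set.ncard_image_of_injective _ f.ker.subtype_injective, pow_succ] at h1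
  have h2 : (0 : ℝ) < n := by exact_mod_cast hn
  nlinarith

end Word

end RandomWalk

namespace RandomWalk

open scoped Pointwise commutatorElement Topology

/-- Every subgroup is finitely generated. -/
def NoethGroup (G : Type*) [Group G] : Prop := ∀ H : Subgroup G, H.FG

section Noeth

variable {G Q : Type*} [Group G] [Group Q]

theorem fg_map {P : Subgroup G} (h : P.FG) (f : G →* Q) : (P.map f).FG := by
  rw [← Group.fg_iff_subgroup_fg] at h ⊢
  exact Group.fg_of_surjective (f.subgroupMap_surjective P)

theorem NoethGroup.of_surjective (h : NoethGroup G) (f : G →* Q) (hf : Function.Surjective f) :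
    NoethGroup Q := fun H => by
  rw [← Subgroup.map_comap_eq_self_of_surjective hf H]
  exact fg_map (h _) f

theorem NoethGroup.of_ker (f : G →* Q) (hk : NoethGroup f.ker) (hQ : NoethGroup Q) :
    NoethGroup G := by
  classical
  intro H
  obtain ⟨A, hA⟩ := fg_map (hk (H.subgroupOf f.ker)) f.ker.subtype
  rw [Subgroup.subgroupOf_map_subtype] at hA
  obtain ⟨B, hB⟩ := hQ (H.map f)
  have hlift : ∀ y ∈ B, ∃ x ∈ H, f x = y := fun y hy => by
    have h1 : y ∈ H.map f := by rw [← hB]; exact Subgroup.subset_closure hy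
    exact h1
  choose! l hlH hlf using hlift
  refine ⟨A ∪ B.image l, le_antisymm ?_ ?_⟩
  · rw [Subgroup.closure_le]
    intro x hx
    rw [Finset.coe_union, Finset.coe_image] at hx
    rcases hx with hx | ⟨y, hy, rfl⟩
    · have h1 : x ∈ H ⊓ f.ker := by rw [← hA]; exact Subgroup.subset_closure hx
      exact h1.1
    · exact hlH y hy
  · intro x hx
    have h1 : (Subgroup.closure (B.image l : Set G)).map f = H.map f := by
      rw [MonoidHom.map_closure, Finset.coe_image, ← hB, Set.image_image]
      congr 1
      ext y
      constructor
      · rintro ⟨z, hz, rfl⟩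
        simpa only [hlf z hz] using hz
      · exact fun hy => ⟨y, hy, hlf y hy⟩
    have h2 : Subgroup.closure (B.image l : Set G) ≤ H := by
      rw [Subgroup.closure_le, Finset.coe_image]
      rintro _ ⟨y, hy, rfl⟩
      exact hlH y hy
    have h3 : f x ∈ (Subgroup.closure (B.image l : Set G)).map f := by
      rw [h1]
      exact Subgroup.mem_map_of_mem f hx
    obtain ⟨y, hy, hyx⟩ := h3
    have h4 : y⁻¹ * x ∈ H ⊓ f.ker :=
      Subgroup.mem_inf.2 ⟨mul_mem (inv_mem (h2 hy)) hx, by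
        rw [MonoidHom.mem_ker, map_mul, map_inv, hyx]; simp⟩
    rw [← hA] at h4
    have h5 := mul_mem (Subgroup.closure_mono (Finset.coe_subset.2 Finset.subset_union_right) hy)
      (Subgroup.closure_mono (Finset.coe_subset.2 (Finset.subset_union_left
        (s₂ := B.image l))) h4)
    simpa using h5

theorem noethGroup_of_finite [Finite G] : NoethGroup G := fun H =>
  (Group.fg_iff_subgroup_fg H).1 inferInstance

theorem noethGroup_of_isCyclic [IsCyclic G] : NoethGroup G := fun H => by
  obtain ⟨g, hg⟩ := IsCyclic.exists_generator (α := H)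
  refine (Group.fg_iff_subgroup_fg H).1 (Group.fg_iff.2 ⟨{g}, ?_, Set.finite_singleton g⟩)
  rw [← Subgroup.zpowers_eq_closure, Subgroup.eq_top_iff']
  exact hg

theorem NoethGroup.subgroup (h : NoethGroup G) (K : Subgroup G) : NoethGroup K := fun H => by
  have h1 := h (H.map K.subtype)
  rw [← Group.fg_iff_subgroup_fg] at h1 ⊢
  exact Group.fg_of_surjective (f := (H.equivMapOfInjective _ K.subtype_injective).symm.toMonoidHom)
    (MulEquiv.surjective _)

theorem NoethGroup.of_finiteIndex (K : Subgroup G) [K.FiniteIndex] (h : NoethGroup K) :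
    NoethGroup G := by
  refine NoethGroup.of_ker (QuotientGroup.mk' K.normalCore) ?_ noethGroup_of_finite
  rw [QuotientGroup.ker_mk']
  intro H
  have h1 := (h.subgroup (K.normalCore.subgroupOf K)).of_surjective
    (Subgroup.subgroupOfEquivOfLe K.normalCore_le).toMonoidHom (MulEquiv.surjective _)
  exact h1 H

end Noeth

section Characteristic

variable {K : Type*} [Group K]

theorem finite_monoidHom [hfg : Group.FG K] {F : Type*} [Group F] [Finite F] :
    Finite (K →* F) := by
  obtain ⟨S, hS, hSfin⟩ := Group.fg_iff.1 hfg
  have := hSfin.to_subtype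
  refine Finite.of_injective (fun (φ : K →* F) (s : S) => φ s) fun φ ψ h => ?_
  refine MonoidHom.eq_of_eqOn_dense hS fun s hs => congrFun h ⟨s, hs⟩

theorem exists_characteristic_le [Group.FG K] (N₀ : Subgroup K) [N₀.FiniteIndex] :
    ∃ N ≤ N₀, N.Characteristic ∧ N.FiniteIndex := by
  set F := Equiv.Perm (K ⧸ N₀)
  have := finite_monoidHom (K := K) (F := F)
  refine ⟨⨅ φ : K →* F, φ.ker, ?_, ?_, ?_⟩
  · refine (iInf_le _ (MulAction.toPermHom K (K ⧸ N₀))).trans ?_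
    rw [← Subgroup.normalCore_eq_ker]
    exact N₀.normalCore_le
  · refine Subgroup.characteristic_iff_le_comap.2 fun ϕ x hx => ?_
    rw [Subgroup.mem_comap, Subgroup.mem_iInf]
    intro φ
    exact (Subgroup.mem_iInf.1 hx) (φ.comp ϕ.toMonoidHom)
  · refine Subgroup.finiteIndex_iInf fun φ => ?_
    exact Subgroup.finiteIndex_ker φ

end Characteristic

end RandomWalk

namespace RandomWalk

open Polynomial

open scoped TensorProduct

theorem half_le_norm_of_eval₂_eq_zero {P : ℤ[X]} (h0 : P.coeff 0 = 1)
    (hc : ∀ i, |P.coeff i| ≤ 1) {z : ℂ} (hz : P.eval₂ (Int.castRingHom ℂ) z = 0) :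
    1 / 2 ≤ ‖z‖ := by
  by_contra! hlt
  rw [eval₂_eq_sum_range, Finset.sum_range_succ', h0] at hz
  simp only [eq_intCast, pow_zero, mul_one, Int.cast_one] at hz
  have h1 : ‖∑ i ∈ Finset.range P.natDegree, (P.coeff (i + 1) : ℂ) * z ^ (i + 1)‖ = 1 := by
    rw [eq_neg_of_add_eq_zero_left hz, norm_neg, norm_one]
  have h2 : ∀ n : ℕ, ∑ i ∈ Finset.range n, ((1 : ℝ) / 2) ^ (i + 1) = 1 - (1 / 2) ^ n := by
    intro n
    induction n with
    | zero => simp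
    | succ n ih => rw [Finset.sum_range_succ, ih, pow_succ]; ring
  have h3 : ‖∑ i ∈ Finset.range P.natDegree, (P.coeff (i + 1) : ℂ) * z ^ (i + 1)‖ ≤
      ∑ i ∈ Finset.range P.natDegree, ((1 : ℝ) / 2) ^ (i + 1) := by
    refine norm_sum_le_of_le _ fun i _ => ?_
    rw [norm_mul, norm_pow]
    have h4 : ‖(P.coeff (i + 1) : ℂ)‖ ≤ 1 := by
      rw [Complex.norm_intCast]
      exact_mod_cast hc (i + 1)
    calc ‖(P.coeff (i + 1) : ℂ)‖ * ‖z‖ ^ (i + 1) ≤ 1 * ‖z‖ ^ (i + 1) := by gcongr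
      _ ≤ (1 / 2) ^ (i + 1) := by rw [one_mul]; gcongr
  rw [h1, h2] at h3
  have h5 : (0 : ℝ) < (1 / 2) ^ P.natDegree := by positivity
  linarith

theorem one_le_of_half_le_pow {a : ℝ} (h0 : 0 ≤ a) (h : ∀ p : ℕ, 1 ≤ p → 1 / 2 ≤ a ^ p) :
    1 ≤ a := by
  by_contra! hlt
  obtain ⟨n, hn⟩ := exists_pow_lt_of_lt_one (show (0 : ℝ) < 1 / 2 by norm_num) hlt
  have h1 := h (n + 1) (by omega)
  have h2 : a ^ (n + 1) ≤ a ^ n := pow_le_pow_of_le_one h0 hlt.le (Nat.le_succ n)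
  linarith

section Free

variable {V : Type*} [AddCommGroup V]

/-- Every vector is killed by a polynomial in each positive power of `τ`, with constant
coefficient one and all coefficients in `{-1, 0, 1}`. -/
def SmallRelations (τ : Module.End ℤ V) : Prop :=
  ∀ p : ℕ, 1 ≤ p → ∀ v, ∃ P : ℤ[X], P.coeff 0 = 1 ∧ (∀ i, |P.coeff i| ≤ 1) ∧
    aeval (τ ^ p) P v = 0

theorem apply_aeval_eq_eval₂_mul (φ : V →+ ℂ) (τ : Module.End ℤ V) {l : ℂ}
    (hφ : ∀ v, φ (τ v) = l * φ v) (P : ℤ[X]) (v : V) :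
    φ (aeval τ P v) = P.eval₂ (Int.castRingHom ℂ) l * φ v := by
  have hpow : ∀ n v, φ ((τ ^ n) v) = l ^ n * φ v := by
    intro n
    induction n with
    | zero => simp
    | succ n ih => intro v; rw [pow_succ', Module.End.mul_apply, hφ, ih]; ring
  rw [aeval_eq_sum_range, eval₂_eq_sum_range, LinearMap.sum_apply, map_sum, Finset.sum_mul]
  refine Finset.sum_congr rfl fun i _ => ?_
  rw [LinearMap.smul_apply, map_zsmul, hpow]
  simp [mul_assoc]

theorem SmallRelations.one_le_norm {τ : Module.End ℤ V} (h : SmallRelations τ) (φ : V →+ ℂ)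
    {l : ℂ} (hφ : ∀ v, φ (τ v) = l * φ v) {v : V} (hv : φ v ≠ 0) : 1 ≤ ‖l‖ := by
  refine one_le_of_half_le_pow (norm_nonneg l) fun p hp => ?_
  obtain ⟨P, h0, hc, hP⟩ := h p hp v
  have hpow : ∀ n v, φ ((τ ^ n) v) = l ^ n * φ v := by
    intro n
    induction n with
    | zero => simp
    | succ n ih => intro v; rw [pow_succ', Module.End.mul_apply, hφ, ih]; ring
  have h1 := apply_aeval_eq_eval₂_mul φ (τ ^ p) (hpow p) P v
  rw [hP, map_zero] at h1
  rw [← norm_pow]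
  exact half_le_norm_of_eval₂_eq_zero h0 hc ((mul_eq_zero.1 h1.symm).resolve_right hv)

variable [Module.Finite ℤ V]

theorem exists_left_eigenvector [Module.Free ℤ V] (τ : Module.End ℤ V) {l : ℂ}
    (hl : (τ.charpoly.map (Int.castRingHom ℂ)).IsRoot l) :
    ∃ φ : V →+ ℂ, (∀ v, φ (τ v) = l * φ v) ∧ ∃ v, φ v ≠ 0 := by
  set T : Module.End ℂ (ℂ ⊗[ℤ] V) := τ.baseChange ℂ with hT
  have h1 : T.HasEigenvalue l := by
    rw [Module.End.hasEigenvalue_iff_isRoot_charpoly, hT, LinearMap.charpoly_baseChange]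
    exact hl
  have h2 : ¬ Function.Surjective (T - l • (1 : Module.End ℂ (ℂ ⊗[ℤ] V))) := by
    rw [← LinearMap.injective_iff_surjective]
    intro hinj
    obtain ⟨w, hw⟩ := h1.exists_hasEigenvector
    refine hw.2 (hinj ?_)
    rw [map_zero, LinearMap.sub_apply, hw.apply_eq_smul, LinearMap.smul_apply, Module.End.one_apply, sub_self]
  rw [← LinearMap.range_eq_top, ← Ne, ← lt_top_iff_ne_top] at h2
  obtain ⟨f, hf0, hf⟩ := Submodule.exists_le_ker_of_lt_top _ h2
  let φ : V →+ ℂ :=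
    { toFun := fun v => f (1 ⊗ₜ v)
      map_zero' := by simp
      map_add' := fun x y => by rw [TensorProduct.tmul_add, map_add] }
  refine ⟨φ, fun v => ?_, ?_⟩
  · have h3 := hf ⟨1 ⊗ₜ v, rfl⟩
    rw [LinearMap.mem_ker, LinearMap.sub_apply, map_sub, LinearMap.smul_apply, Module.End.one_apply, map_smul,
      sub_eq_zero, hT, LinearMap.baseChange_tmul] at h3
    exact h3
  · by_contra! hcon
    refine hf0 (LinearMap.ext fun w => ?_)
    induction w using TensorProduct.induction_on with
    | zero => simp
    | add x y hx hy => rw [map_add, hx, hy]; simp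
    | tmul c v =>
      have h3 : c ⊗ₜ[ℤ] v = c • ((1 : ℂ) ⊗ₜ[ℤ] v) := by simp [TensorProduct.smul_tmul']
      have h4 : f (1 ⊗ₜ v) = 0 := hcon v
      rw [h3, map_smul, h4]
      simp

theorem dvd_pow_of_forall_isRoot {f g : ℂ[X]} (hf : f.Monic)
    (h : ∀ z, f.IsRoot z → g.IsRoot z) : ∃ m : ℕ, f ∣ g ^ m := by
  refine ⟨f.roots.card, ?_⟩
  have h1 := (IsAlgClosed.splits f).eq_prod_roots_of_monic hf
  have h2 : ∀ s : Multiset ℂ, (∀ z ∈ s, g.IsRoot z) →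
      (s.map fun a => X - C a).prod ∣ g ^ s.card := by
    intro s
    induction s using Multiset.induction_on with
    | empty => simp
    | cons a s ih =>
      intro hs
      rw [Multiset.map_cons, Multiset.prod_cons, Multiset.card_cons, pow_succ']
      exact mul_dvd_mul (dvd_iff_isRoot.2 (hs a (Multiset.mem_cons_self a s)))
        (ih fun z hz => hs z (Multiset.mem_cons_of_mem hz))
  rw [h1]
  convert h2 f.roots fun z hz => h z (isRoot_of_mem_roots hz) using 2
  rw [← h1]

theorem SmallRelations.exists_pow_sub_one_pow_eq_zero_of_free [Module.Free ℤ V]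
    {τ τ' : Module.End ℤ V} (hτ : τ * τ' = 1) (h : SmallRelations τ) (h' : SmallRelations τ') :
    ∃ q m : ℕ, 1 ≤ q ∧ (τ ^ q - 1) ^ m = 0 := by
  set χ := τ.charpoly
  have hχ : χ.Monic := τ.charpoly_monic
  have hnorm : ∀ l : ℂ, (χ.map (Int.castRingHom ℂ)).IsRoot l → ‖l‖ = 1 := by
    intro l hl
    obtain ⟨φ, hφ, v, hv⟩ := exists_left_eigenvector τ hl
    have h1 := h.one_le_norm φ hφ hv
    have hl0 : l ≠ 0 := by
      rintro rfl
      norm_num at h1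
    have h2 : ∀ v, φ (τ' v) = l⁻¹ * φ v := fun v => by
      have h3 := hφ (τ' v)
      rw [← Module.End.mul_apply, hτ, Module.End.one_apply] at h3
      rw [h3, inv_mul_cancel_left₀ hl0]
    have h3 := h'.one_le_norm φ h2 hv
    rw [norm_inv] at h3
    exact le_antisymm ((one_le_inv₀ (by positivity)).1 h3) h1
  have hmahler : (χ.map (Int.castRingHom ℂ)).mahlerMeasure = 1 := by
    rw [mahlerMeasure_eq_leadingCoeff_mul_prod_roots, (hχ.map _).leadingCoeff, norm_one, one_mul]
    refine Multiset.prod_eq_one fun x hx => ?_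
    obtain ⟨a, ha, rfl⟩ := Multiset.mem_map.1 hx
    rw [hnorm a (isRoot_of_mem_roots ha), max_self]
  have hroot : ∀ l : ℂ, (χ.map (Int.castRingHom ℂ)).IsRoot l → ∃ n, 0 < n ∧ l ^ n = 1 := by
    intro l hl
    refine pow_eq_one_of_mahlerMeasure_eq_one hmahler ?_ ?_
    · rintro rfl
      simpa using hnorm 0 hl
    · exact (mem_roots (hχ.map _).ne_zero).2 hl
  choose! n hn0 hn using hroot
  set R := (χ.map (Int.castRingHom ℂ)).roots.toFinset
  set q := ∏ l ∈ R, n l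
  have hR : ∀ l ∈ R, (χ.map (Int.castRingHom ℂ)).IsRoot l := fun l hl =>
    isRoot_of_mem_roots (Multiset.mem_toFinset.1 hl)
  have hq : 1 ≤ q := Finset.prod_pos fun l hl => hn0 l (hR l hl)
  obtain ⟨m, hm⟩ := dvd_pow_of_forall_isRoot (hχ.map (Int.castRingHom ℂ)) (g := X ^ q - 1)
    fun l hl => by
      have h1 : l ∈ R := Multiset.mem_toFinset.2 ((mem_roots (hχ.map _).ne_zero).2 hl)
      obtain ⟨c, hc⟩ := Finset.dvd_prod_of_mem n h1
      have h2 : l ^ q = 1 := by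
        change l ^ (∏ l ∈ R, n l) = 1
        rw [hc, pow_mul, hn l hl, one_pow]
      simp [h2]
  have hdvd : χ ∣ (X ^ q - 1) ^ m := by
    rw [← map_dvd_map (Int.castRingHom ℂ) (RingHom.injective_int _) hχ]
    simpa using hm
  obtain ⟨g, hg⟩ := hdvd
  refine ⟨q, m, hq, ?_⟩
  have h1 : aeval τ ((X ^ q - 1 : ℤ[X]) ^ m) = 0 := by
    rw [hg, map_mul, LinearMap.aeval_self_charpoly, zero_mul]
  simpa using h1

theorem SmallRelations.exists_pow_sub_one_pow_eq_zero {τ τ' : Module.End ℤ V}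
    (hτ : τ * τ' = 1) (hτ' : τ' * τ = 1) (h : SmallRelations τ) (h' : SmallRelations τ') :
    ∃ q m : ℕ, 1 ≤ q ∧ (τ ^ q - 1) ^ m = 0 := by
  set T := Submodule.torsion ℤ V
  have hT : ∀ σ : Module.End ℤ V, T ≤ T.comap σ := by
    intro σ x hx
    obtain ⟨a, ha⟩ := (Submodule.mem_torsion_iff x).1 hx
    refine (Submodule.mem_torsion_iff _).2 ⟨a, ?_⟩
    rw [Submonoid.smul_def, ← map_smul, ← Submonoid.smul_def, ha, map_zero]
  let Q : Module.End ℤ V →+* Module.End ℤ (V ⧸ T) :=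
    { toFun := fun σ => T.mapQ T σ (hT σ)
      map_one' := by ext; rfl
      map_mul' := fun _ _ => by ext; rfl
      map_zero' := by ext; rfl
      map_add' := fun _ _ => by ext; rfl }
  have hQ : ∀ σ v, Q σ (T.mkQ v) = T.mkQ (σ v) := fun σ v => rfl
  have hQs : ∀ {σ}, SmallRelations σ → SmallRelations (Q σ) := by
    intro σ hσ p hp w
    obtain ⟨v, rfl⟩ := T.mkQ_surjective w
    obtain ⟨P, h0, hc, hP⟩ := hσ p hp v
    refine ⟨P, h0, hc, ?_⟩
    have h1 : aeval (Q σ ^ p) P = Q (aeval (σ ^ p) P) := by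
      rw [← map_pow]
      exact aeval_algHom_apply Q.toIntAlgHom (σ ^ p) P
    rw [h1, hQ, hP, map_zero]
  obtain ⟨q, m, hq, hqm⟩ := SmallRelations.exists_pow_sub_one_pow_eq_zero_of_free
    (by rw [← map_mul, hτ, map_one]) (hQs h) (hQs h')
  have hfin : Finite T := Module.finite_of_fg_torsion T (Submodule.torsion_isTorsion)
  let e : Equiv.Perm T :=
    { toFun := fun x => ⟨τ x, hT τ x.2⟩
      invFun := fun x => ⟨τ' x, hT τ' x.2⟩
      left_inv := fun x => Subtype.ext (LinearMap.congr_fun hτ' x)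
      right_inv := fun x => Subtype.ext (LinearMap.congr_fun hτ x) }
  have he : ∀ n (x : T), (((e ^ n) x : T) : V) = (τ ^ n) x := by
    intro n
    induction n with
    | zero => intro x; rfl
    | succ n ih =>
      intro x
      rw [pow_succ', Equiv.Perm.mul_apply, pow_succ', Module.End.mul_apply, ← ih]
      rfl
  obtain ⟨r, hr0, hr⟩ := (isOfFinOrder_of_finite e).exists_pow_eq_one
  refine ⟨q * r, m + 1, Nat.mul_pos hq hr0, ?_⟩
  have hdvd : ((X ^ q - 1 : ℤ[X]) ^ m) ∣ (X ^ (q * r) - 1) ^ m := by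
    rw [pow_mul]
    exact pow_dvd_pow_of_dvd (sub_one_dvd_pow_sub_one _ r) m
  obtain ⟨g, hg⟩ := hdvd
  have h1 : (Q τ ^ (q * r) - 1) ^ m = 0 := by
    have h2 : aeval (Q τ) ((X ^ (q * r) - 1 : ℤ[X]) ^ m) = 0 := by
      rw [hg, map_mul]
      simp [hqm]
    simpa using h2
  have hkill : ∀ x ∈ T, (τ ^ (q * r) - 1) x = 0 := by
    intro x hx
    have h2 := he (q * r) ⟨x, hx⟩
    rw [mul_comm, pow_mul, hr, one_pow, ← mul_comm q] at h2
    rw [LinearMap.sub_apply, ← h2]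
    exact sub_self x
  refine LinearMap.ext fun v => ?_
  rw [pow_succ', Module.End.mul_apply]
  refine hkill _ ?_
  rw [← Submodule.Quotient.mk_eq_zero, ← Submodule.mkQ_apply, ← hQ, map_pow, map_sub, map_pow,
    map_one, h1]
  rfl

end Free

end RandomWalk

namespace RandomWalk

open scoped Pointwise commutatorElement Topology Polynomial IsMulCommutative

section ConjEnd

variable {M : Type*} [Group M] (A : Subgroup M) [A.Normal] [IsMulCommutative A]

/-- The action of a group by conjugation on a commutative normal subgroup. -/
def conjEnd : M →* Module.End ℤ (Additive A) where
  toFun x := (MonoidHom.toAdditive (MulAut.conjNormal x : MulAut A).toMonoidHom).toIntLinearMap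
  map_one' := by ext; simp
  map_mul' x y := by ext; simp

theorem coe_conjEnd (x : M) (v : Additive A) :
    ((conjEnd A x v).toMul : M) = x * (v.toMul : M) * x⁻¹ := by
  simp [conjEnd]

theorem word_eq_conjEnd (t : M) (u : Additive A) (e : ℕ → ℕ) (m : ℕ) :
    word t (u.toMul : M) e m =
      ((∑ i ∈ Finset.range m, e i • (conjEnd A t ^ (i + 1)) u : Additive A).toMul : M) * t ^ m := by
  induction m with
  | zero => simp [word]
  | succ m ih =>
    rw [word, ih, Finset.sum_range_succ, toMul_add, toMul_nsmul, Subgroup.coe_mul, Subgroup.coe_pow,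
      ← map_pow, coe_conjEnd, conj_pow]
    group

theorem aeval_relation {V : Type*} [AddCommGroup V] (τ : Module.End ℤ V) (m : ℕ) (a : ℕ → ℤ)
    (v : V) :
    Polynomial.aeval τ (1 + ∑ i ∈ Finset.range m, Polynomial.C (a i) * Polynomial.X ^ (i + 1)) v =
      v + ∑ i ∈ Finset.range m, a i • (τ ^ (i + 1)) v := by
  simp

theorem coeff_relation (m : ℕ) (a : ℕ → ℤ) (ha : ∀ i, |a i| ≤ 1) :
    (1 + ∑ i ∈ Finset.range m, Polynomial.C (a i) * Polynomial.X ^ (i + 1) : ℤ[X]).coeff 0 = 1 ∧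
    ∀ j, |(1 + ∑ i ∈ Finset.range m, Polynomial.C (a i) * Polynomial.X ^ (i + 1) : ℤ[X]).coeff j|
      ≤ 1 := by
  have h0 : (1 + ∑ i ∈ Finset.range m, Polynomial.C (a i) * Polynomial.X ^ (i + 1) : ℤ[X]).coeff 0
      = 1 := by
    simp [Polynomial.coeff_X_pow]
  refine ⟨h0, fun j => ?_⟩
  cases j with
  | zero => rw [h0, abs_one]
  | succ j =>
    rw [Polynomial.coeff_add, Polynomial.finsetSum_coeff]
    simp only [Polynomial.coeff_C_mul, Polynomial.coeff_X_pow, Polynomial.coeff_one,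
      add_left_inj, mul_ite, mul_one, mul_zero, Finset.sum_ite_eq, Finset.mem_range]
    split_ifs <;> simp_all

theorem PolyGrowth.smallRelations {d : ℕ} (h : PolyGrowth M d) (t : M) :
    SmallRelations (conjEnd A t) := by
  intro p hp v
  obtain ⟨m, e, e', he, he', hw⟩ := h.exists_word_eq (t ^ p) (v.toMul : M)
  refine ⟨1 + ∑ i ∈ Finset.range m,
    Polynomial.C ((e i : ℤ) - (e' i : ℤ)) * Polynomial.X ^ (i + 1), ?_⟩
  have h1 := coeff_relation m (fun i => (e i : ℤ) - (e' i : ℤ)) fun i => by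
    have h1 := he i
    have h2 := he' i
    rw [abs_le]; omega
  refine ⟨h1.1, h1.2, ?_⟩
  rw [aeval_relation]
  rw [word_eq_conjEnd, word_eq_conjEnd, ← mul_assoc] at hw
  have h2 := mul_right_cancel hw
  rw [← Subgroup.coe_mul, SetLike.coe_eq_coe, ← toMul_ofMul (v.toMul), ← toMul_add, ofMul_toMul] at h2
  have h3 := Additive.toMul.injective h2
  simp only [sub_smul, Finset.sum_sub_distrib, natCast_zsmul, ← map_pow] at h3 ⊢
  rw [← add_sub_assoc, h3, sub_self]

theorem finite_additive (hA : A.FG) : Module.Finite ℤ (Additive A) := by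
  rw [Module.Finite.iff_addGroup_fg]
  have := (Group.fg_iff_subgroup_fg A).2 hA
  exact AddGroup.fg_iff_mul_fg.2 this

/-- The kernels of the powers of an endomorphism of a commutative subgroup. -/
def kerPow (s : Module.End ℤ (Additive A)) (j : ℕ) : Subgroup M where
  carrier := {x | ∃ v : Additive A, (v.toMul : M) = x ∧ (s ^ j) v = 0}
  one_mem' := ⟨0, by simp, by simp⟩
  mul_mem' := by
    rintro _ _ ⟨v, rfl, hv⟩ ⟨w, rfl, hw⟩
    exact ⟨v + w, by simp, by rw [map_add, hv, hw, add_zero]⟩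
  inv_mem' := by
    rintro _ ⟨v, rfl, hv⟩
    exact ⟨-v, by simp, by rw [map_neg, hv, neg_zero]⟩

/-- The elements acting on a commutative normal subgroup trivially up to a multiple of `s`. -/
def congrOne (s : Module.End ℤ (Additive A)) : Subgroup M where
  carrier := {x | ∃ S, Commute S s ∧ conjEnd A x = 1 + S * s}
  one_mem' := ⟨0, Commute.zero_left _, by simp⟩
  mul_mem' := by
    rintro x y ⟨S, hS, hx⟩ ⟨S', hS', hy⟩
    refine ⟨S + S' + S * S' * s, ?_, ?_⟩
    · exact (hS.add_left hS').add_left ((hS.mul_left hS').mul_left rfl)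
    · rw [map_mul, hx, hy]
      have : s * (S' * s) = S' * s * s := by rw [← mul_assoc, hS'.eq]
      simp only [mul_add, add_mul, mul_one, one_mul]
      rw [mul_assoc S s, this]
      simp only [mul_assoc]
      abel
  inv_mem' := by
    rintro x ⟨S, hS, hx⟩
    have h1 : Commute (conjEnd A x) s := by
      rw [hx]
      exact (Commute.one_left s).add_left (hS.mul_left rfl)
    have h2 : conjEnd A x⁻¹ * conjEnd A x = 1 := by rw [← map_mul]; simp
    have h3 : conjEnd A x * conjEnd A x⁻¹ = 1 := by rw [← map_mul]; simp
    have h4 : Commute (conjEnd A x⁻¹) s := by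
      have : conjEnd A x⁻¹ * s = conjEnd A x⁻¹ * (s * conjEnd A x) * conjEnd A x⁻¹ := by
        rw [mul_assoc, mul_assoc, h3, mul_one]
      rw [← h1.eq, ← mul_assoc, h2, one_mul] at this
      exact this
    refine ⟨-(conjEnd A x⁻¹ * S), (h4.mul_left hS).neg_left, ?_⟩
    have h5 : conjEnd A x⁻¹ * (1 + S * s) = 1 := by rw [← hx, h2]
    rw [mul_add, mul_one, ← mul_assoc] at h5
    rw [neg_mul, ← sub_eq_add_neg]
    exact eq_sub_of_add_eq h5

theorem commutator_mem_kerPow {s : Module.End ℤ (Additive A)} {x b : M} (hx : x ∈ congrOne A s)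
    {j : ℕ} (hb : b ∈ kerPow A s (j + 1)) : ⁅b, x⁆ ∈ kerPow A s j := by
  obtain ⟨S, hS, hx⟩ := hx
  obtain ⟨v, rfl, hv⟩ := hb
  refine ⟨v - conjEnd A x v, ?_, ?_⟩
  · rw [toMul_sub, Subgroup.coe_div, coe_conjEnd, commutatorElement_def]
    simp [div_eq_mul_inv, mul_assoc]
  · rw [hx, LinearMap.add_apply, Module.End.one_apply, sub_add_cancel_left, map_neg,
      ← Module.End.mul_apply, ← mul_assoc, ← ((hS.pow_right j).eq), mul_assoc, ← pow_succ,
      Module.End.mul_apply, hv, map_zero, neg_zero]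

theorem PolyGrowth.exists_chain {d : ℕ} (h : PolyGrowth M d) (hA : A.FG) (t : M) :
    ∃ (q m : ℕ) (B : ℕ → Subgroup M), 1 ≤ q ∧ B 0 = ⊥ ∧ A ≤ B m ∧
      ∀ j, ∀ x ∈ Subgroup.centralizer (A : Set M) ⊔ Subgroup.zpowers (t ^ q), ∀ b ∈ B (j + 1),
        ⁅b, x⁆ ∈ B j := by
  have := finite_additive A hA
  obtain ⟨q, m, hq, hm⟩ := SmallRelations.exists_pow_sub_one_pow_eq_zero
    (τ := conjEnd A t) (τ' := conjEnd A t⁻¹) (by rw [← map_mul]; simp) (by rw [← map_mul]; simp)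
    (h.smallRelations A t) (h.smallRelations A t⁻¹)
  set s := conjEnd A t ^ q - 1 with hs
  refine ⟨q, m, kerPow A s, hq, ?_, ?_, fun j x hx b hb => commutator_mem_kerPow A ?_ hb⟩
  · rw [eq_bot_iff]
    rintro _ ⟨v, rfl, hv⟩
    rw [pow_zero, Module.End.one_apply] at hv
    simp [hv]
  · intro a ha
    exact ⟨Additive.ofMul ⟨a, ha⟩, rfl, by rw [hm, LinearMap.zero_apply]⟩
  · revert x
    change Subgroup.centralizer (A : Set M) ⊔ Subgroup.zpowers (t ^ q) ≤ congrOne A s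
    rw [sup_le_iff, Subgroup.zpowers_le]
    refine ⟨fun x hx => ⟨0, Commute.zero_left _, ?_⟩, 1, Commute.one_left _, ?_⟩
    · rw [zero_mul, add_zero]
      ext v
      rw [coe_conjEnd, Module.End.one_apply, mul_inv_eq_iff_eq_mul]
      exact (Subgroup.mem_centralizer_iff.1 hx _ (SetLike.coe_mem _)).symm
    · rw [map_pow, one_mul, hs, add_sub_cancel]

end ConjEnd

section Extension

variable {M : Type*} [Group M]

theorem PolyGrowth.exists_chain_between {d : ℕ} (h : PolyGrowth M d) (hM : NoethGroup M)
    {L U N : Subgroup M} [L.Normal] [U.Normal] (hUN : U ≤ N)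
    (hc : ∀ u ∈ U, ∀ n ∈ N, ⁅u, n⁆ ∈ L) (t : M) :
    ∃ (q m : ℕ) (B : ℕ → Subgroup M), 1 ≤ q ∧ B 0 = L ∧ U ≤ B m ∧
      ∀ j, ∀ x ∈ N ⊔ Subgroup.zpowers (t ^ q), ∀ b ∈ B (j + 1), ⁅b, x⁆ ∈ B j := by
  set π := QuotientGroup.mk' L
  have hπ : Function.Surjective π := QuotientGroup.mk'_surjective L
  have : (U.map π).Normal := Subgroup.Normal.map ‹_› _ hπ
  have hcomm : ∀ u ∈ U, ∀ n ∈ N, π u * π n = π n * π u := fun u hu n hn => by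
    rw [← commutatorElement_eq_one_iff_mul_comm, ← map_commutatorElement, ← MonoidHom.mem_ker,
      QuotientGroup.ker_mk']
    exact hc u hu n hn
  have : IsMulCommutative (U.map π) := by
    refine ⟨⟨?_⟩⟩
    rintro ⟨_, u, hu, rfl⟩ ⟨_, v, hv, rfl⟩
    exact Subtype.ext (hcomm u hu v (hUN hv))
  obtain ⟨q, m, B, hq, hB0, hBm, hB⟩ :=
    (h.of_surjective π hπ).exists_chain (U.map π) (fg_map (hM U) π) (π t)
  refine ⟨q, m, fun j => (B j).comap π, hq, ?_, ?_, ?_⟩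
  · change (B 0).comap π = L
    rw [hB0, MonoidHom.comap_bot, QuotientGroup.ker_mk']
  · exact Subgroup.map_le_iff_le_comap.1 hBm
  · intro j x hx b hb
    rw [Subgroup.mem_comap, map_commutatorElement]
    refine hB j _ ?_ _ hb
    have h1 : N ⊔ Subgroup.zpowers (t ^ q) ≤
        (Subgroup.centralizer ((U.map π : Subgroup (M ⧸ L)) : Set (M ⧸ L)) ⊔
          Subgroup.zpowers (π t ^ q)).comap π := by
      rw [sup_le_iff, Subgroup.zpowers_le, Subgroup.mem_comap, map_pow]
      refine ⟨fun n hn => Subgroup.mem_comap.2 (Subgroup.mem_sup_left ?_),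
        Subgroup.mem_sup_right (Subgroup.mem_zpowers _)⟩
      rw [Subgroup.mem_centralizer_iff]
      rintro _ ⟨u, hu, rfl⟩
      exact hcomm u hu n hn
    exact h1 hx

theorem finiteIndex_sup_zpowers_pow {N : Subgroup M} [N.Normal] {t : M}
    (ht : N ⊔ Subgroup.zpowers t = ⊤) {q : ℕ} (hq : 1 ≤ q) :
    (N ⊔ Subgroup.zpowers (t ^ q)).FiniteIndex := by
  have : Finite (M ⧸ (N ⊔ Subgroup.zpowers (t ^ q))) := by
    refine Finite.of_surjective
      (fun r : Fin q => (QuotientGroup.mk (t ^ (r : ℕ)) : M ⧸ (N ⊔ Subgroup.zpowers (t ^ q)))) ?_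
    intro y
    obtain ⟨x, rfl⟩ := QuotientGroup.mk_surjective y
    have hx : x⁻¹ ∈ N ⊔ Subgroup.zpowers t := ht ▸ Subgroup.mem_top _
    obtain ⟨n, hn, z, hz, hnz⟩ := Subgroup.mem_sup_of_normal_left.1 hx
    obtain ⟨k, rfl⟩ := Subgroup.mem_zpowers_iff.1 hz
    have hq0 : (q : ℤ) ≠ 0 := by positivity
    have h1 := Int.emod_nonneg (-k) hq0
    have h2 := Int.emod_lt_of_pos (-k) (by positivity : (0 : ℤ) < q)
    refine ⟨⟨((-k) % q).toNat, by omega⟩, ?_⟩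
    change (QuotientGroup.mk (t ^ ((-k) % (q : ℤ)).toNat) : M ⧸ _) = _
    rw [eq_comm, QuotientGroup.eq, ← hnz, ← zpow_natCast t ((-k) % (q : ℤ)).toNat, Int.toNat_of_nonneg h1, mul_assoc,
      ← zpow_add]
    refine mul_mem (Subgroup.mem_sup_left hn) (Subgroup.mem_sup_right ?_)
    refine Subgroup.mem_zpowers_iff.2 ⟨-((-k) / q), ?_⟩
    rw [← zpow_natCast, ← zpow_mul]
    congr 1
    have := Int.emod_add_mul_ediv (-k) q
    linarith
  exact Subgroup.finiteIndex_of_finite_quotient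

theorem PolyGrowth.exists_nilpotent_of_sup_zpowers {d : ℕ} (h : PolyGrowth M d) (hM : NoethGroup M)
    (N : Subgroup M) [hN : N.Normal] [hnil : Group.IsNilpotent N] {t : M}
    (ht : N ⊔ Subgroup.zpowers t = ⊤) :
    ∃ H : Subgroup M, H.FiniteIndex ∧ Group.IsNilpotent H := by
  obtain ⟨c, hc⟩ := hnil.nilpotent
  set Z : ℕ → Subgroup M := fun i => (Subgroup.upperCentralSeries N i).map N.subtype with hZ
  have hnorm : ∀ i, (Z i).Normal := fun i => ConjAct.normal_of_characteristic_of_normal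
  have hZN : ∀ i, Z i ≤ N := fun i => Subgroup.map_subtype_le _
  have key : ∀ i, i ≤ c → ∃ (H : Subgroup M) (k : ℕ), H.FiniteIndex ∧
      H.lowerCentralSeries k ≤ Z (c - i) := by
    intro i
    induction i with
    | zero =>
      intro _
      refine ⟨⊤, 1, inferInstance, ?_⟩
      have h1 : Z c = N := by
        change (Subgroup.upperCentralSeries N c).map N.subtype = N
        rw [hc, ← MonoidHom.range_eq_map, Subgroup.range_subtype]
      rw [Nat.sub_zero, h1, Subgroup.lowerCentralSeries_succ, Subgroup.commutator_le]
      have h2 : ∀ x : M, ∃ a : ℤ, QuotientGroup.mk' N x = QuotientGroup.mk' N t ^ a := by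
        intro x
        have hx : x ∈ N ⊔ Subgroup.zpowers t := ht ▸ Subgroup.mem_top _
        obtain ⟨n, hn, z, hz, rfl⟩ := Subgroup.mem_sup_of_normal_left.1 hx
        obtain ⟨a, rfl⟩ := Subgroup.mem_zpowers_iff.1 hz
        refine ⟨a, ?_⟩
        rw [map_mul, map_zpow, (QuotientGroup.eq_one_iff n).2 hn |> fun h =>
          (h : QuotientGroup.mk' N n = 1), one_mul]
      intro x _ y _
      obtain ⟨a, ha⟩ := h2 x
      obtain ⟨b, hb⟩ := h2 y
      rw [← QuotientGroup.ker_mk' N, MonoidHom.mem_ker, map_commutatorElement, ha, hb,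
        commutatorElement_eq_one_iff_mul_comm, ← zpow_add, ← zpow_add, add_comm]
    | succ i ih =>
      intro hi
      obtain ⟨H, k, hH, hk⟩ := ih (by omega)
      obtain ⟨l, hl, hl'⟩ : ∃ l, c - i = l + 1 ∧ c - (i + 1) = l := ⟨c - (i + 1), by omega, rfl⟩
      rw [hl] at hk
      rw [hl']
      have hnl := hnorm l
      have hnl1 := hnorm (l + 1)
      obtain ⟨q, m, B, hq, hB0, hBm, hB⟩ := h.exists_chain_between hM (L := Z l) (U := Z (l + 1))
        (N := N) (hZN _) (by
          rintro _ ⟨u, hu, rfl⟩ n hn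
          exact ⟨_, Subgroup.mem_upperCentralSeries_succ_iff.1 hu ⟨n, hn⟩, rfl⟩) t
      have hfin := finiteIndex_sup_zpowers_pow ht hq
      refine ⟨H ⊓ (N ⊔ Subgroup.zpowers (t ^ q)), k + m, inferInstance, ?_⟩
      have hj : ∀ j ≤ m, (H ⊓ (N ⊔ Subgroup.zpowers (t ^ q))).lowerCentralSeries (k + j) ≤
          B (m - j) := by
        intro j
        induction j with
        | zero =>
          intro _
          exact (Subgroup.lowerCentralSeries_mono k inf_le_left).trans (hk.trans hBm)
        | succ j ihj =>
          intro hj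
          rw [← add_assoc, Subgroup.lowerCentralSeries_succ, Subgroup.commutator_le]
          intro b hb x hx
          refine hB _ x (Subgroup.mem_inf.1 hx).2 b ?_
          rw [show m - (j + 1) + 1 = m - j by omega]
          exact ihj (by omega) hb
      simpa [hB0] using hj m le_rfl
  obtain ⟨H, k, hH, hk⟩ := key c le_rfl
  refine ⟨H, hH, (Subgroup.isNilpotent_iff_lowerCentralSeries H).2 ⟨k, ?_⟩⟩
  rw [eq_bot_iff]
  refine hk.trans ?_
  rw [Nat.sub_self, hZ]
  simp

end Extension

end RandomWalk

namespace RandomWalk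

open scoped Pointwise commutatorElement Topology

section Gromov

universe u

/-- The group has a nilpotent subgroup of finite index. -/
def VirtNilpotent (G : Type*) [Group G] : Prop :=
  ∃ H : Subgroup G, H.FiniteIndex ∧ Group.IsNilpotent H

theorem isNilpotent_mono {G : Type*} [Group G] {H K : Subgroup G} (hK : Group.IsNilpotent K)
    (h : H ≤ K) : Group.IsNilpotent H := by
  rw [Subgroup.isNilpotent_iff_lowerCentralSeries] at hK ⊢
  obtain ⟨n, hn⟩ := hK
  exact ⟨n, eq_bot_iff.2 ((Subgroup.lowerCentralSeries_mono n h).trans hn.le)⟩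

theorem isNilpotent_map {G Q : Type*} [Group G] [Group Q] {H : Subgroup G}
    (hH : Group.IsNilpotent H) (f : G →* Q) : Group.IsNilpotent (H.map f) := by
  rw [Subgroup.isNilpotent_iff_lowerCentralSeries] at hH ⊢
  obtain ⟨n, hn⟩ := hH
  exact ⟨n, by rw [← Subgroup.map_lowerCentralSeries, hn, Subgroup.map_bot]⟩

theorem VirtNilpotent.of_finiteIndex {G : Type*} [Group G] (K : Subgroup G) [hK : K.FiniteIndex]
    (h : VirtNilpotent K) : VirtNilpotent G := by
  obtain ⟨H, hH, hnil⟩ := h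
  refine ⟨H.map K.subtype, ⟨?_⟩, isNilpotent_map hnil _⟩
  rw [Subgroup.index_map_subtype]
  exact mul_ne_zero hH.index_ne_zero hK.index_ne_zero

theorem virtNilpotent_of_finite (G : Type*) [Group G] [Finite G] : VirtNilpotent G :=
  ⟨⊥, inferInstance, inferInstance⟩

theorem finiteIndex_sup_zpowers {G : Type*} [Group G] (f : G →* Multiplicative ℤ) {t : G}
    (ht : f t = Multiplicative.ofAdd 1) (N : Subgroup f.ker) [N.FiniteIndex] :
    (N.map f.ker.subtype ⊔ Subgroup.zpowers t).FiniteIndex := by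
  set M := N.map f.ker.subtype ⊔ Subgroup.zpowers t
  have : Finite (G ⧸ M) := by
    refine Finite.of_surjective
      (fun c : f.ker ⧸ N => (QuotientGroup.mk (c.out : G) : G ⧸ M)) fun y => ?_
    obtain ⟨x, rfl⟩ := QuotientGroup.mk_surjective y
    have hk : x * (t ^ (f x).toAdd)⁻¹ ∈ f.ker := by
      rw [MonoidHom.mem_ker, map_mul, map_inv, map_zpow, ht, ← ofAdd_zsmul]
      simp
    refine ⟨QuotientGroup.mk ⟨_, hk⟩, ?_⟩
    obtain ⟨n, hn⟩ := QuotientGroup.mk_out_eq_mul N ⟨_, hk⟩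
    change (QuotientGroup.mk _ : G ⧸ M) = _
    rw [hn, eq_comm, QuotientGroup.eq, Subgroup.coe_mul]
    have : x⁻¹ * (x * (t ^ (f x).toAdd)⁻¹ * ((n : f.ker) : G)) =
      (t ^ (f x).toAdd)⁻¹ * ((n : f.ker) : G) := by group
    rw [this]
    exact mul_mem (inv_mem (Subgroup.mem_sup_right (Subgroup.zpow_mem_zpowers _ _)))
      (Subgroup.mem_sup_left ⟨n, n.2, rfl⟩)
  exact Subgroup.finiteIndex_of_finite_quotient

theorem PolyGrowth.virtNilpotent_and_noeth (d : ℕ) : ∀ (G : Type u) [Group G] [Group.FG G],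
    PolyGrowth G d → VirtNilpotent G ∧ NoethGroup G := by
  induction d with
  | zero =>
    intro G _ _ h
    cases finite_or_infinite G with
    | inl hfin => exact ⟨virtNilpotent_of_finite G, noethGroup_of_finite⟩
    | inr hinf =>
      obtain ⟨G₁, hG₁, f, hf⟩ := h.virtuallyOntoInt
      obtain ⟨t, ht⟩ := hf (Multiplicative.ofAdd 1)
      have := Subgroup.fg_of_index_ne_zero G₁
      obtain ⟨d', hd', -⟩ := (h.subgroup G₁).exists_ker f ht
      omega
  | succ d ih =>
    intro G _ _ h
    cases finite_or_infinite G with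
    | inl hfin => exact ⟨virtNilpotent_of_finite G, noethGroup_of_finite⟩
    | inr hinf =>
      obtain ⟨G₁, hG₁, f, hf⟩ := h.virtuallyOntoInt
      obtain ⟨t, ht⟩ := hf (Multiplicative.ofAdd 1)
      have := Subgroup.fg_of_index_ne_zero G₁
      have h1 := h.subgroup G₁
      obtain ⟨d', hd', hK⟩ := h1.exists_ker f ht
      obtain rfl : d = d' := by omega
      have hKfg : Group.FG f.ker := (Group.fg_iff_subgroup_fg _).2 (h1.ker_fg f ht)
      obtain ⟨⟨N₀, hN₀, hN₀nil⟩, hKn⟩ := ih f.ker hK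
      have hG₁n : NoethGroup G₁ := NoethGroup.of_ker f hKn noethGroup_of_isCyclic
      refine ⟨?_, hG₁n.of_finiteIndex⟩
      obtain ⟨N, hN, hNchar, hNfin⟩ := exists_characteristic_le N₀
      have hnorm : (N.map f.ker.subtype).Normal := ConjAct.normal_of_characteristic_of_normal
      have hfin := finiteIndex_sup_zpowers f ht N
      set M := N.map f.ker.subtype ⊔ Subgroup.zpowers t with hM
      have hnil : Group.IsNilpotent (N.map f.ker.subtype) :=
        isNilpotent_map (isNilpotent_mono hN₀nil hN) _
      have hnil' : Group.IsNilpotent ((N.map f.ker.subtype).subgroupOf M) :=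
        Group.nilpotent_of_mulEquiv (Subgroup.subgroupOfEquivOfLe le_sup_left).symm
      have htM : t ∈ M := Subgroup.mem_sup_right (Subgroup.mem_zpowers t)
      have hvn : VirtNilpotent M := by
        refine (h1.subgroup M).exists_nilpotent_of_sup_zpowers (hG₁n.subgroup M)
          ((N.map f.ker.subtype).subgroupOf M) (t := ⟨t, htM⟩) ?_
        apply Subgroup.map_injective M.subtype_injective
        rw [Subgroup.map_sup, Subgroup.map_subgroupOf_eq_of_le le_sup_left, MonoidHom.map_zpowers,
          ← MonoidHom.range_eq_map, Subgroup.range_subtype]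
        rfl
      exact (hvn.of_finiteIndex).of_finiteIndex

theorem PolyGrowth.virtNilpotent {G : Type u} [Group G] [Group.FG G] {d : ℕ}
    (h : PolyGrowth G d) : VirtNilpotent G :=
  (PolyGrowth.virtNilpotent_and_noeth d G h).1

end Gromov

end RandomWalk

namespace RandomWalk

open scoped Pointwise commutatorElement Topology

section Geom

variable {Γ : Type*} [Group Γ] [PseudoMetricSpace Γ] [IsIsometricSMul Γ Γ] {δ : ℝ}

/-- The four-point condition, for pseudometric spaces. -/
def FourPoint (Γ : Type*) [PseudoMetricSpace Γ] (δ : ℝ) : Prop :=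
  ∀ x y z w : Γ, dist x y + dist z w ≤ max (dist x z + dist y w) (dist x w + dist y z) + 2 * δ

/-- Balls around the identity are finite. -/
def FiniteBalls (Γ : Type*) [Group Γ] [PseudoMetricSpace Γ] : Prop :=
  ∀ R : ℝ, {g : Γ | dist 1 g ≤ R}.Finite

theorem dist_eq_dist_one (a b : Γ) : dist a b = dist 1 (a⁻¹ * b) := by
  rw [← dist_mul_left a 1 (a⁻¹ * b)]; simp

theorem dist_one_inv (a : Γ) : dist 1 a⁻¹ = dist 1 a := by
  rw [← dist_mul_left a 1 a⁻¹]; simp [dist_comm]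

theorem dist_one_mul_le (a b : Γ) : dist 1 (a * b) ≤ dist 1 a + dist 1 b := by
  refine (dist_triangle 1 a _).trans ?_
  rw [dist_eq_dist_one a (a * b), inv_mul_cancel_left]

theorem dist_one_pow_le (a : Γ) (n : ℕ) : dist 1 (a ^ n) ≤ n * dist 1 a := by
  induction n with
  | zero => simp
  | succ n ih =>
    rw [pow_succ]
    have := dist_one_mul_le (a ^ n) a
    push_cast; linarith

theorem dist_one_zpow (a : Γ) (n : ℤ) : dist 1 (a ^ n) = dist 1 (a ^ n.natAbs) := by
  cases n with
  | ofNat n => simp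
  | negSucc n => rw [zpow_negSucc, dist_one_inv]; rfl

theorem dist_zpow_zpow (a : Γ) (m n : ℤ) : dist (a ^ m) (a ^ n) = dist 1 (a ^ (n - m)) := by
  rw [dist_eq_dist_one, ← zpow_neg, ← zpow_add]; congr 2; ring

/-- The orbit of an isometry escapes at definite speed, with increments at least `3 * δ`. -/
def Steep (δ : ℝ) (f : Γ) : Prop := ∀ m : ℕ, dist 1 (f ^ m) + 3 * δ ≤ dist 1 (f ^ (m + 1))

theorem FourPoint.exists_steep (hyp : FourPoint Γ δ) {h : Γ} {n : ℕ}
    (hn : dist 1 (h ^ n) + 2 * δ < dist 1 (h ^ (2 * n))) : ∃ q, 1 ≤ q ∧ Steep δ (h ^ q) := by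
  have hn0 : 1 ≤ n := by
    by_contra h0
    obtain rfl : n = 0 := by omega
    have := hyp 1 1 1 1
    simp at hn this
    linarith
  set k := h ^ n with hk
  set η := dist 1 (k ^ 2) - dist 1 k - 2 * δ with hη
  have hη0 : 0 < η := by rw [hη, hk, ← pow_mul, mul_comm n 2]; linarith
  have hd : ∀ i j : ℕ, dist (k ^ i) (k ^ (i + j)) = dist 1 (k ^ j) := fun i j => by
    rw [dist_eq_dist_one, pow_add, inv_mul_cancel_left]
  have h1 : ∀ m : ℕ, dist 1 (k ^ m) ≤ dist 1 (k ^ (m + 1)) ∧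
      dist 1 (k ^ (m + 1)) + η ≤ dist 1 (k ^ (m + 2)) := by
    intro m
    induction m with
    | zero =>
      simp only [pow_zero, dist_self, zero_add, pow_one]
      have h2 := hyp 1 1 1 1
      refine ⟨dist_nonneg, ?_⟩
      simp at h2
      rw [hη]; linarith
    | succ m ih =>
      have h2 : dist 1 (k ^ (m + 1)) ≤ dist 1 (k ^ (m + 1 + 1)) := by linarith [ih.2]
      refine ⟨h2, ?_⟩
      have h3 := hyp 1 (k ^ 2) k (k ^ (1 + (m + 2)))
      have h4 := hd 1 (m + 2)
      have h5 := hd 2 (m + 1)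
      have h6 := hd 1 1
      rw [pow_one] at h4 h6
      rw [show 2 + (m + 1) = 1 + (m + 2) by ring] at h5
      rw [show 1 + 1 = 2 by rfl, dist_comm] at h6
      rw [h4, h5, h6] at h3
      rw [show m + 1 + 1 = m + 2 by ring, show m + 1 + 2 = 1 + (m + 2) by ring]
      rcases max_cases (dist 1 k + dist 1 (k ^ (m + 1)))
        (dist 1 (k ^ (1 + (m + 2))) + dist 1 k) with h | h <;> rw [h.1] at h3
      · rw [show m + 1 + 1 = m + 2 by ring] at h2
        linarith [ih.2]
      · linarith
  have h2 : ∀ m q : ℕ, dist 1 (k ^ m) + q * η ≤ dist 1 (k ^ (m + (q + 1))) := by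
    intro m q
    induction q with
    | zero => simpa using (h1 m).1
    | succ q ih =>
      have := (h1 (m + q)).2
      rw [show m + (q + 1 + 1) = m + q + 2 by ring]
      rw [show m + (q + 1) = m + q + 1 by ring] at ih
      push_cast; linarith
  obtain ⟨q, hq⟩ := exists_nat_ge (3 * δ / η)
  rw [div_le_iff₀ hη0] at hq
  refine ⟨n * (q + 1), Nat.mul_pos hn0 (by omega), fun m => ?_⟩
  rw [pow_mul h n (q + 1), ← hk, ← pow_mul k, ← pow_mul k,
    show (q + 1) * (m + 1) = (q + 1) * m + (q + 1) by ring]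
  linarith [h2 ((q + 1) * m) q]

namespace Steep

variable {f : Γ}

theorem add_mul_le (hf : Steep δ f) (m j : ℕ) :
    dist 1 (f ^ m) + j * (3 * δ) ≤ dist 1 (f ^ (m + j)) := by
  induction j with
  | zero => simp
  | succ j ih =>
    have := hf (m + j)
    rw [show m + (j + 1) = m + j + 1 by ring]
    push_cast; linarith

theorem mul_le (hf : Steep δ f) (j : ℕ) : j * (3 * δ) ≤ dist 1 (f ^ j) := by
  simpa using hf.add_mul_le 0 j

theorem pow (hf : Steep δ f) (hδ : 0 < δ) {p : ℕ} (hp : 1 ≤ p) : Steep δ (f ^ p) := by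
  intro m
  rw [← pow_mul, ← pow_mul, mul_add, mul_one]
  have h1 := hf.add_mul_le (p * m) p
  have h2 : (1 : ℝ) ≤ p := by exact_mod_cast hp
  nlinarith

theorem inv (hf : Steep δ f) : Steep δ f⁻¹ := by
  intro m
  rw [inv_pow, inv_pow, dist_one_inv, dist_one_inv]
  exact hf m

theorem superadd (hf : Steep δ f) (hδ : 0 < δ) (hyp : FourPoint Γ δ) (i j : ℕ) :
    dist 1 (f ^ i) + dist 1 (f ^ j) ≤ dist 1 (f ^ (i + j)) + (dist 1 f + 2 * δ) := by
  have hd : ∀ i j : ℕ, dist (f ^ i) (f ^ (i + j)) = dist 1 (f ^ j) := fun i j => by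
    rw [dist_eq_dist_one, pow_add, inv_mul_cancel_left]
  have h0 := dist_nonneg (x := 1) (y := f)
  cases j with
  | zero => simp; linarith
  | succ j =>
    have h1 := hyp 1 (f ^ (i + 1)) (f ^ i) (f ^ (i + (j + 1)))
    have h2 := hd (i + 1) j
    have h3 := hd i 1
    rw [pow_one, dist_comm] at h3
    rw [show i + 1 + j = i + (j + 1) by ring] at h2
    rw [hd, h2, h3] at h1
    have h4 := hf i
    have h5 := hf j
    rcases max_cases (dist 1 (f ^ i) + dist 1 (f ^ j))
      (dist 1 (f ^ (i + (j + 1))) + dist 1 f) with h | h <;> rw [h.1] at h1 <;> linarith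

theorem escape (hf : Steep δ f) (hδ : 0 < δ) (hyp : FourPoint Γ δ) {i : ℕ}
    (hi : dist 1 f + 4 * δ + 1 < dist 1 (f ^ i)) {y : Γ} (hy : dist 1 y ≤ dist (f ^ i) y + 1)
    {N : ℕ} (hN : i ≤ N) :
    dist 1 y + dist 1 (f ^ N) ≤ dist (f ^ N) y + (dist 1 (f ^ i) + 1 + 2 * δ) := by
  have h1 := hyp 1 (f ^ N) (f ^ i) y
  have h2 := hf.superadd hδ hyp i (N - i)
  rw [show i + (N - i) = N by omega] at h2
  have h3 : dist (f ^ N) (f ^ i) = dist 1 (f ^ (N - i)) := by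
    rw [dist_comm, dist_eq_dist_one, ← pow_sub_mul_pow f hN, ← pow_mul_comm, inv_mul_cancel_left]
  rw [h3] at h1
  rcases max_cases (dist 1 (f ^ i) + dist (f ^ N) y)
    (dist 1 y + dist 1 (f ^ (N - i))) with h | h <;> rw [h.1] at h1 <;> linarith

theorem exists_near (hf : Steep δ f) (hδ : 0 < δ) (hyp : FourPoint Γ δ) :
    ∃ C, ∀ z, (∀ n : ℕ, dist z (f ^ n * z) ≤ dist 1 (f ^ n)) → ∃ i : ℤ, dist (f ^ i) z ≤ C := by
  obtain ⟨i, hi⟩ := exists_nat_gt ((dist 1 f + 4 * δ + 1) / (3 * δ))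
  rw [div_lt_iff₀ (by positivity)] at hi
  replace hi : dist 1 f + 4 * δ + 1 < dist 1 (f ^ i) := hi.trans_le (hf.mul_le i)
  have hi' : dist 1 f⁻¹ + 4 * δ + 1 < dist 1 (f⁻¹ ^ i) := by
    rwa [inv_pow, dist_one_inv, dist_one_inv]
  set C := dist 1 (f ^ i) + 1 + 2 * δ with hC
  refine ⟨C + δ, fun z hz => ?_⟩
  obtain ⟨k, hk⟩ : ∃ k : ℤ, ∀ j : ℤ, dist (f ^ k) z ≤ dist (f ^ j) z + 1 := by
    have hbdd : BddBelow (Set.range fun j : ℤ => dist (f ^ j) z) :=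
      ⟨0, by rintro _ ⟨j, rfl⟩; exact dist_nonneg⟩
    obtain ⟨k, hk⟩ := exists_lt_of_ciInf_lt (lt_add_one (⨅ j : ℤ, dist (f ^ j) z))
    exact ⟨k, fun j => hk.le.trans (by linarith [ciInf_le hbdd j])⟩
  refine ⟨k, ?_⟩
  set y := f ^ (-k) * z with hy
  have hyd : ∀ j : ℤ, dist (f ^ j) y = dist (f ^ (k + j)) z := fun j => by
    rw [hy, ← dist_mul_left (f ^ k), ← mul_assoc, ← zpow_add, ← zpow_add]; simp
  have hy1 : dist 1 y = dist (f ^ k) z := by simpa using hyd 0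
  have hyy : ∀ n : ℕ, dist y (f ^ n * y) ≤ dist 1 (f ^ n) := fun n => by
    refine le_trans (le_of_eq ?_) (hz n)
    rw [hy, ← mul_assoc, ← zpow_natCast, ← zpow_add, add_comm, zpow_add, mul_assoc, dist_mul_left]
  obtain ⟨N, hN⟩ := exists_nat_gt ((C + δ) / (3 * δ))
  rw [div_lt_iff₀ (by positivity)] at hN
  have hNi : dist 1 (f ^ N) ≤ dist 1 (f ^ (N + i)) := by
    have h1 := hf.add_mul_le N i
    have h2 : 0 ≤ (i : ℝ) * (3 * δ) := by positivity
    linarith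
  replace hN := (hN.trans_le (hf.mul_le N)).trans_le hNi
  have h1 := hf.escape hδ hyp hi (y := y) (N := N + i) (by
    rw [hy1, ← zpow_natCast, hyd]; exact hk _) (by omega)
  have h2 := hf.inv.escape hδ hyp hi' (y := y) (N := N + i) (by
    rw [hy1, inv_pow, ← zpow_natCast, ← zpow_neg, hyd]; exact hk _) (by omega)
  simp only [inv_pow, dist_one_inv] at h2
  have h3 : dist (f ^ (N + i))⁻¹ y = dist 1 (f ^ (N + i) * y) := by
    rw [← dist_mul_left (f ^ (N + i))]; simp
  rw [h3] at h2
  have h4 := hyp y (f ^ (N + i)) 1 (f ^ (N + i) * y)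
  have h5 := hyy (N + i)
  have h6 : dist (f ^ (N + i)) (f ^ (N + i) * y) = dist 1 y := by
    rw [dist_eq_dist_one, inv_mul_cancel_left]
  rw [h6, dist_comm y 1, dist_comm y (f ^ (N + i)), dist_comm (f ^ (N + i)) 1] at h4
  rw [← hy1]
  rcases max_cases (dist 1 y + dist 1 y)
    (dist y (f ^ (N + i) * y) + dist 1 (f ^ (N + i))) with h | h <;> rw [h.1] at h4 <;> linarith

theorem exists_pow_eq_zpow (hf : Steep δ f) (hδ : 0 < δ) (hyp : FourPoint Γ δ)
    (hfin : FiniteBalls Γ) {c : Γ} (hc : Commute c f) : ∃ r, 1 ≤ r ∧ ∃ s : ℤ, c ^ r = f ^ s := by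
  obtain ⟨C, hC⟩ := hf.exists_near hδ hyp
  have h1 : ∀ m : ℕ, ∃ i : ℤ, dist (f ^ i) (c ^ m) ≤ C := fun m => hC _ fun n => by
    rw [← (hc.pow_pow m n).eq, dist_eq_dist_one, inv_mul_cancel_left]
  choose i hi using h1
  have h2 : ∀ m, (f ^ i m)⁻¹ * c ^ m ∈ {g : Γ | dist 1 g ≤ C} := fun m => by
    rw [Set.mem_ofPred_eq, ← dist_eq_dist_one]
    exact hi m
  obtain ⟨m, n, hmn, h⟩ := (hfin C).exists_lt_map_eq_of_forall_mem h2
  refine ⟨n - m, by omega, i n - i m, ?_⟩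
  have h3 : c ^ n = c ^ (n - m) * c ^ m := by rw [← pow_add]; congr 1; omega
  rw [inv_mul_eq_iff_eq_mul, h3, ← mul_assoc, ← mul_assoc] at h
  have h4 := mul_right_cancel ((one_mul (c ^ m)).trans h)
  rw [← zpow_neg, ← zpow_add] at h4
  rw [← inv_inj, ← zpow_neg, neg_sub, sub_eq_add_neg, inv_eq_iff_mul_eq_one]
  rw [← mul_eq_one_comm]
  exact h4.symm

theorem natAbs_le (hf : Steep δ f) (hδ : 0 < δ) {w : Γ} {a s : ℤ} (h : w * f ^ a * w⁻¹ = f ^ s) :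
    s.natAbs ≤ a.natAbs := by
  by_contra! hlt
  obtain ⟨k, hk⟩ := Nat.exists_eq_add_of_lt hlt
  obtain ⟨n, hn⟩ := exists_nat_gt (2 * dist 1 w / (3 * δ))
  rw [div_lt_iff₀ (by positivity)] at hn
  have h1 : f ^ (s * n) = w * f ^ (a * n) * w⁻¹ := by
    rw [zpow_mul, ← h, zpow_natCast, conj_pow, zpow_mul, zpow_natCast]
  have h2 := dist_one_mul_le (w * f ^ (a * n)) w⁻¹
  have h3 := dist_one_mul_le w (f ^ (a * n))
  rw [← h1, dist_one_inv, dist_one_zpow, Int.natAbs_mul, Int.natAbs_natCast] at h2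
  rw [dist_one_zpow f (a * n), Int.natAbs_mul, Int.natAbs_natCast] at h3
  have h4 := hf.add_mul_le (a.natAbs * n) ((k + 1) * n)
  rw [← add_mul, ← add_assoc, ← hk] at h4
  have h5 : (n : ℝ) ≤ ((k + 1) * n : ℕ) := by
    exact_mod_cast Nat.le_mul_of_pos_left n (by omega)
  have h6 := mul_le_mul_of_nonneg_right h5 (by positivity : (0 : ℝ) ≤ 3 * δ)
  linarith

theorem natAbs_eq (hf : Steep δ f) (hδ : 0 < δ) {w : Γ} {a s : ℤ} (h : w * f ^ a * w⁻¹ = f ^ s) :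
    a.natAbs = s.natAbs := by
  refine le_antisymm (hf.natAbs_le hδ (w := w⁻¹) ?_) (hf.natAbs_le hδ h)
  rw [← h]; group

end Steep

end Geom

end RandomWalk

namespace RandomWalk

open scoped Pointwise commutatorElement Topology

section Chain

variable {Γ : Type*} [Group Γ] [PseudoMetricSpace Γ] [IsIsometricSMul Γ Γ]

/-- Balls of radius `n * r + 2 * r` around the identity can be coloured with `P ^ n` colours so that
points of the same colour are at distance at most `4 * r`. -/
def Colorable (Γ : Type*) [Group Γ] [PseudoMetricSpace Γ] (P : ℕ) (r : ℝ) : Prop :=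
  ∀ n : ℕ, ∃ κ : Γ → Fin (P ^ n), ∀ a b : Γ, dist 1 a ≤ n * r + 2 * r → dist 1 b ≤ n * r + 2 * r →
    κ a = κ b → dist a b ≤ 4 * r

theorem exists_lt_le_map_eq {α : Type*} [Fintype α] (F : ℕ → α) {N : ℕ}
    (h : Fintype.card α ≤ N) : ∃ i j, i < j ∧ j ≤ N ∧ F i = F j := by
  obtain ⟨i, j, hij, h⟩ := Fintype.exists_ne_map_eq_of_card_lt (fun i : Fin (N + 1) => F i)
    (by rw [Fintype.card_fin]; omega)
  rcases lt_or_gt_of_ne hij with h1 | h1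
  · exact ⟨i, j, h1, by omega, h⟩
  · exact ⟨j, i, h1, by omega, h.symm⟩

theorem dist_one_pow_le_one {g : Γ} {e : ℝ} (hg : dist 1 g ≤ e) {i N : ℕ} (hi : i ≤ N)
    (hN : N * e ≤ 1) : dist 1 (g ^ i) ≤ 1 := by
  have h1 := dist_one_pow_le g i
  have h2 : (i : ℝ) ≤ N := by exact_mod_cast hi
  have h3 := mul_le_mul h2 hg dist_nonneg (by positivity)
  linarith

theorem dist_pow_mul_pow_mul (g a : Γ) {i j : ℕ} (hij : i ≤ j) :
    dist (g ^ i * a) (g ^ j * a) = dist a (g ^ (j - i) * a) := by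
  rw [← dist_mul_left (g ^ i) a, ← mul_assoc, ← pow_add]
  congr 3; omega

theorem Colorable.exists_conj_pow {P : ℕ} {r e : ℝ} (hcol : Colorable Γ P r) {g : Γ}
    (hg : dist 1 g ≤ e) {n : ℕ} (hn : ((P ^ n : ℕ) : ℝ) * e ≤ 1) {a : Γ}
    (ha : dist 1 a + 1 ≤ n * r + 2 * r) : ∃ k, 1 ≤ k ∧ dist 1 (a * g ^ k * a⁻¹) ≤ 4 * r := by
  obtain ⟨κ, hκ⟩ := hcol n
  obtain ⟨i, j, hij, hj, h⟩ := exists_lt_le_map_eq (fun i => κ (g ^ i * a⁻¹)) (N := P ^ n) (by simp)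
  have h1 : ∀ i ≤ P ^ n, dist 1 (g ^ i * a⁻¹) ≤ n * r + 2 * r := fun i hi => by
    have h1 := dist_one_mul_le (g ^ i) a⁻¹
    have h2 := dist_one_pow_le_one hg hi hn
    rw [dist_one_inv] at h1
    linarith
  have h2 := hκ _ _ (h1 i (by omega)) (h1 j hj) h
  rw [dist_pow_mul_pow_mul _ _ hij.le] at h2
  refine ⟨j - i, by omega, le_trans (le_of_eq ?_) h2⟩
  rw [dist_eq_dist_one a⁻¹, inv_inv, mul_assoc]

/-- The element moves both `1` and `g ^ n` a bounded amount. -/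
def MovesLittle (g : Γ) (D : ℝ) (n : ℕ) (c : Γ) : Prop :=
  dist 1 c ≤ D ∧ dist (g ^ n) (c * g ^ n) ≤ D

theorem Colorable.exists_movesLittle_succ {P : ℕ} {r e : ℝ} (hcol : Colorable Γ P r) {g : Γ}
    (hg : dist 1 g ≤ e) (he : e ≤ 1) {n₀ : ℕ} (hn₀ : ((P ^ n₀ * P ^ n₀ : ℕ) : ℝ) * e ≤ 1)
    (hr : 4 * r + 3 ≤ n₀ * r + 2 * r) {n : ℕ} {c : Γ} (hc : MovesLittle g (4 * r) n c) :
    ∃ k, 1 ≤ k ∧ MovesLittle g (4 * r) (n + 1) (c * g ^ k * c⁻¹) := by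
  obtain ⟨κ, hκ⟩ := hcol n₀
  obtain ⟨i, j, hij, hj, h⟩ := exists_lt_le_map_eq
    (fun i => (κ (g ^ i * c⁻¹), κ (g⁻¹ ^ (n + 1) * (g ^ i * (c⁻¹ * g ^ (n + 1))))))
    (N := P ^ n₀ * P ^ n₀) (by simp)
  rw [Prod.mk.injEq] at h
  have h1 : ∀ i ≤ P ^ n₀ * P ^ n₀, dist 1 (g ^ i * c⁻¹) ≤ n₀ * r + 2 * r := fun i hi => by
    have h1 := dist_one_mul_le (g ^ i) c⁻¹
    have h2 := dist_one_pow_le_one hg hi hn₀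
    rw [dist_one_inv] at h1
    linarith [hc.1]
  have h2 : ∀ i ≤ P ^ n₀ * P ^ n₀,
      dist 1 (g⁻¹ ^ (n + 1) * (g ^ i * (c⁻¹ * g ^ (n + 1)))) ≤ n₀ * r + 2 * r := fun i hi => by
    have h2 := dist_one_pow_le_one hg hi hn₀
    have h3 : g⁻¹ ^ (n + 1) * (g ^ i * (c⁻¹ * g ^ (n + 1))) =
        g ^ i * (g⁻¹ * ((c * g ^ n)⁻¹ * g ^ n * g)) := by
      have : g⁻¹ ^ (n + 1) * g ^ i = g ^ i * (g⁻¹ * (g ^ n)⁻¹) := by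
        rw [inv_pow, ← mul_inv_rev, ← pow_succ, ((Commute.refl g).pow_pow _ _).inv_left.eq]
      rw [← mul_assoc, this, mul_inv_rev, pow_succ]
      group
    have h4 := dist_one_mul_le (g ^ i) (g⁻¹ * ((c * g ^ n)⁻¹ * g ^ n * g))
    have h5 := dist_one_mul_le g⁻¹ ((c * g ^ n)⁻¹ * g ^ n * g)
    have h6 := dist_one_mul_le ((c * g ^ n)⁻¹ * g ^ n) g
    have h7 := hc.2
    rw [dist_comm, dist_eq_dist_one] at h7
    rw [dist_one_inv] at h5
    rw [h3]
    linarith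
  have h3 := hκ _ _ (h1 i (by omega)) (h1 j hj) h.1
  have h4 := hκ _ _ (h2 i (by omega)) (h2 j hj) h.2
  rw [dist_pow_mul_pow_mul _ _ hij.le] at h3
  rw [dist_mul_left, dist_pow_mul_pow_mul _ _ hij.le] at h4
  refine ⟨j - i, by omega, le_trans (le_of_eq ?_) h3, le_trans (le_of_eq ?_) h4⟩
  · rw [dist_eq_dist_one c⁻¹, inv_inv, mul_assoc]
  · rw [← dist_mul_left c (c⁻¹ * _), mul_inv_cancel_left]
    simp only [mul_assoc]

theorem Colorable.forall_of_conj_closed {P : ℕ} {r e : ℝ} (hcol : Colorable Γ P r)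
    (hfin : FiniteBalls Γ) {g : Γ} (hg : dist 1 g ≤ e) (he : e ≤ 1) {n₀ : ℕ}
    (hn₀ : ((P ^ n₀ * P ^ n₀ : ℕ) : ℝ) * e ≤ 1) (hr : 4 * r + 3 ≤ n₀ * r + 2 * r) {Q : Γ → Prop}
    (h1 : ∀ c, ∀ j : ℕ, 1 ≤ j → Commute c (g ^ j) → Q c)
    (h2 : ∀ w, ∀ k : ℕ, 1 ≤ k → Q (w * g ^ k * w⁻¹) → Q w) {c : Γ} (hc : dist 1 c ≤ 4 * r) :
    Q c := by
  have hstep : ∀ (n : ℕ) (c : {c : Γ // MovesLittle g (4 * r) n c}),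
      ∃ d : {d : Γ // MovesLittle g (4 * r) (n + 1) d},
        ∃ k, 1 ≤ k ∧ (d : Γ) = c * g ^ k * (c : Γ)⁻¹ := fun n c => by
    obtain ⟨k, hk, h⟩ := hcol.exists_movesLittle_succ hg he hn₀ hr c.2
    exact ⟨⟨_, h⟩, k, hk, rfl⟩
  choose F k hk hF using hstep
  let s : (n : ℕ) → {c : Γ // MovesLittle g (4 * r) n c} :=
    fun n => Nat.rec ⟨c, hc, by simpa using hc⟩ (fun n d => F n d) n
  have hs : ∀ n, (s (n + 1)).1 = (s n).1 * g ^ k n (s n) * (s n).1⁻¹ := fun n => hF n (s n)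
  have hdesc : ∀ n, Q (s n).1 → Q c := by
    intro n
    induction n with
    | zero => exact id
    | succ n ih => exact fun h => ih (h2 _ _ (hk n (s n)) (hs n ▸ h))
  have hmem : ∀ n, ((s n).1, (g ^ n)⁻¹ * (s n).1 * g ^ n) ∈
      {g : Γ | dist 1 g ≤ 4 * r} ×ˢ {g : Γ | dist 1 g ≤ 4 * r} := fun n => by
    refine ⟨(s n).2.1, le_trans (le_of_eq ?_) (s n).2.2⟩
    rw [dist_eq_dist_one (g ^ n), mul_assoc]
  obtain ⟨n, m, hnm, h⟩ :=
    ((hfin (4 * r)).prod (hfin (4 * r))).exists_lt_map_eq_of_forall_mem hmem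
  rw [Prod.mk.injEq] at h
  refine hdesc n (h1 _ (m - n) (by omega) ?_)
  obtain ⟨h3, h4⟩ := h
  rw [← h3, show g ^ m = g ^ n * g ^ (m - n) by rw [← pow_add]; congr 1; omega] at h4
  rw [mul_inv_rev] at h4
  have h5 : Commute (g ^ n) (g ^ (m - n)) := (Commute.refl g).pow_pow _ _
  generalize (s n).1 = c' at h4 ⊢
  generalize g ^ n = x at h4 h5 ⊢
  generalize g ^ (m - n) = y at h4 h5 ⊢
  have h6 : Commute (x⁻¹ * c' * x) y := by
    rw [Commute, SemiconjBy]
    nth_rewrite 2 [h4]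
    group
  have h7 : c' = x * (x⁻¹ * c' * x) * x⁻¹ := by group
  rw [h7]
  exact (h5.mul_left h6).mul_left h5.inv_left

end Chain

end RandomWalk

namespace RandomWalk

open scoped Pointwise commutatorElement Topology

section Lox

variable {Γ : Type*} [Group Γ] [PseudoMetricSpace Γ] [IsIsometricSMul Γ Γ] {δ : ℝ}

/-- The element conjugates some power of `g` to itself or its inverse. -/
def PreservesAxis (g w : Γ) : Prop :=
  ∃ p : ℕ, 1 ≤ p ∧ (w * g ^ p * w⁻¹ = g ^ p ∨ w * g ^ p * w⁻¹ = (g ^ p)⁻¹)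

theorem conj_pow_eq_or_of_dvd {g w : Γ} {p p' : ℕ} (hp : p ∣ p')
    (h : w * g ^ p * w⁻¹ = g ^ p ∨ w * g ^ p * w⁻¹ = (g ^ p)⁻¹) :
    w * g ^ p' * w⁻¹ = g ^ p' ∨ w * g ^ p' * w⁻¹ = (g ^ p')⁻¹ := by
  obtain ⟨k, rfl⟩ := hp
  rw [pow_mul, ← conj_pow]
  rcases h with h | h
  · left; rw [h]
  · right; rw [h, inv_pow]

theorem PreservesAxis.of_conj {g : Γ} {q : ℕ} (hg : Steep δ (g ^ q)) (hδ : 0 < δ)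
    (hyp : FourPoint Γ δ) (hfin : FiniteBalls Γ) {w : Γ} {k : ℕ} (hk : 1 ≤ k)
    (h : PreservesAxis g (w * g ^ k * w⁻¹)) : PreservesAxis g w := by
  obtain ⟨p, hp, h⟩ := h
  set c := w * g ^ k * w⁻¹ with hc
  have h1 : c ^ 2 * g ^ p * (c ^ 2)⁻¹ = g ^ p := by
    have h1 : c ^ 2 * g ^ p * (c ^ 2)⁻¹ = c * (c * g ^ p * c⁻¹) * c⁻¹ := by
      rw [pow_two]; group
    rw [h1]
    rcases h with h | h
    · rw [h, h]
    · rw [h, ← conj_inv, h, inv_inv]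
  have h2 : Commute (c ^ 2) (g ^ p) := by
    rw [mul_inv_eq_iff_eq_mul] at h1
    exact h1
  have hf : Steep δ (g ^ (q * p)) := by rw [pow_mul]; exact hg.pow hδ hp
  have h3 : Commute (c ^ 2) (g ^ (q * p)) := by
    rw [mul_comm, pow_mul]; exact h2.pow_right q
  obtain ⟨r, hr, s, hs⟩ := hf.exists_pow_eq_zpow hδ hyp hfin h3
  rw [hc, conj_pow, conj_pow, ← pow_mul, ← pow_mul, ← zpow_natCast g (q * p), ← zpow_mul] at hs
  set t : ℤ := ((q * p : ℕ) : ℤ) * s with ht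
  set a := k * (2 * r) with ha
  have h4 : w * (g ^ q) ^ (a : ℤ) * w⁻¹ = (g ^ q) ^ t := by
    rw [zpow_natCast, ← pow_mul, mul_comm, pow_mul, ← conj_pow, hs, ← zpow_natCast g q,
      ← zpow_natCast (g ^ t), ← zpow_mul, mul_comm, zpow_mul]
  have h5 := hg.natAbs_eq hδ h4
  rw [Int.natAbs_natCast] at h5
  refine ⟨a, Nat.mul_pos hk (by omega), ?_⟩
  rw [hs, h5]
  rcases Int.natAbs_eq t with h6 | h6
  · left; rw [← zpow_natCast, ← h6]
  · right; rw [← zpow_natCast, ← zpow_neg, ← h6]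

theorem virtNilpotent_closure_of_preservesAxis {g : Γ} {q : ℕ}
    (hg : Steep δ (g ^ q)) (hδ : 0 < δ) (hyp : FourPoint Γ δ) (hfin : FiniteBalls Γ) {S : Set Γ}
    (hS : S.Finite) (h : ∀ a ∈ S, PreservesAxis g a) : VirtNilpotent (Subgroup.closure S) := by
  choose! p hp hpa using h
  set N := ∏ a ∈ hS.toFinset, p a with hN
  have hN1 : 1 ≤ N :=
    Nat.one_le_iff_ne_zero.2 (Finset.prod_ne_zero_iff.2 fun a ha =>
      Nat.one_le_iff_ne_zero.1 (hp a (hS.mem_toFinset.1 ha)))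
  have h1 : ∀ a ∈ S, a * g ^ N * a⁻¹ = g ^ N ∨ a * g ^ N * a⁻¹ = (g ^ N)⁻¹ := fun a ha =>
    conj_pow_eq_or_of_dvd (Finset.dvd_prod_of_mem p (hS.mem_toFinset.2 ha)) (hpa a ha)
  have h2 : ∀ a ∈ Subgroup.closure S, a * g ^ N * a⁻¹ = g ^ N ∨ a * g ^ N * a⁻¹ = (g ^ N)⁻¹ := by
    intro a ha
    induction ha using Subgroup.closure_induction with
    | mem a ha => exact h1 a ha
    | one => left; simp
    | mul a b _ _ ha hb =>
      have h3 : a * b * g ^ N * (a * b)⁻¹ = a * (b * g ^ N * b⁻¹) * a⁻¹ := by group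
      rw [h3]
      rcases hb with hb | hb <;> rw [hb]
      · exact ha
      · rw [← conj_inv]
        rcases ha with ha | ha <;> rw [ha] <;> simp
    | inv a _ ha =>
      rcases ha with ha | ha
      · left
        nth_rewrite 1 [← ha]; group
      · right
        rw [← inv_eq_iff_eq_inv, conj_inv, ← ha]; group
  set f := g ^ (q * N) with hfdef
  have hf : Steep δ f := by rw [hfdef, pow_mul]; exact hg.pow hδ hN1
  obtain ⟨C, hC⟩ := hf.exists_near hδ hyp
  have h3 : ∀ a ∈ Subgroup.closure S, ∃ i : ℤ, dist (f ^ i) a ≤ C := fun a ha => by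
    refine hC a fun n => ?_
    have h4 := conj_pow_eq_or_of_dvd (g := g) (w := a⁻¹) (p' := q * N * n)
      ⟨q * n, by ring⟩ (h2 a⁻¹ (inv_mem ha))
    rw [inv_inv, pow_mul, ← hfdef] at h4
    rw [dist_eq_dist_one, ← mul_assoc]
    rcases h4 with h4 | h4 <;> rw [h4]
    rw [dist_one_inv]
  have h4 : ∀ a : Subgroup.closure S, ∃ i : ℤ, dist (f ^ i) (a⁻¹ : Γ) ≤ C := fun a =>
    h3 _ (inv_mem a.2)
  choose i hi using h4
  have hfi : ((Subgroup.zpowers f).subgroupOf (Subgroup.closure S)).FiniteIndex := by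
    have : Finite {u : Γ | dist 1 u ≤ C} := hfin C
    have : Finite (Subgroup.closure S ⧸ (Subgroup.zpowers f).subgroupOf (Subgroup.closure S)) := by
      refine Finite.of_injective (β := {u : Γ | dist 1 u ≤ C}) (fun x => ⟨(f ^ i x.out)⁻¹ * (x.out)⁻¹, by
        rw [Set.mem_ofPred_eq, ← dist_eq_dist_one]; exact hi _⟩) fun x y hxy => ?_
      rw [Subtype.mk.injEq] at hxy
      rw [← x.out_eq', ← y.out_eq', QuotientGroup.eq, Subgroup.mem_subgroupOf]
      rw [inv_mul_eq_iff_eq_mul] at hxy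
      refine ⟨i x.out - i y.out, ?_⟩
      simp only [Subgroup.coe_mul, Subgroup.coe_inv] at hxy ⊢
      rw [hxy, zpow_sub]
      group
    exact Subgroup.finiteIndex_of_finite_quotient
  refine ⟨_, hfi, ?_⟩
  have : IsMulCommutative ((Subgroup.zpowers f).subgroupOf (Subgroup.closure S)) := inferInstance
  open scoped IsMulCommutative in infer_instance

end Lox

end RandomWalk

namespace RandomWalk

open scoped Pointwise commutatorElement Topology

section Par

variable {Γ : Type*} [Group Γ] [PseudoMetricSpace Γ] [IsIsometricSMul Γ Γ] {δ : ℝ}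

theorem FiniteBalls.tendsto_dist_pow (hfin : FiniteBalls Γ) {g : Γ} (hg : ¬ IsOfFinOrder g) :
    Tendsto (fun n : ℕ => dist 1 (g ^ n)) atTop atTop := by
  rw [Filter.tendsto_atTop]
  intro M
  have h1 : {n : ℕ | dist 1 (g ^ n) ≤ M}.Finite :=
    (hfin M).preimage (f := fun n : ℕ => g ^ n) (injective_pow_iff_not_isOfFinOrder.2 hg).injOn
  rw [← Nat.cofinite_eq_atTop]
  filter_upwards [h1.compl_mem_cofinite] with n hn
  by_contra! h
  exact hn h.le

/-- The elements `w` for which the Gromov product of `w * g ^ n` and `g ^ n` tends to infinity. -/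
def limitStabilizer (g : Γ) (hyp : FourPoint Γ δ)
    (hg : Tendsto (fun n : ℕ => dist 1 (g ^ n)) atTop atTop) : Subgroup Γ where
  carrier := {w | ∀ M : ℝ, ∀ᶠ n : ℕ in atTop, dist (w * g ^ n) (g ^ n) ≤ 2 * dist 1 (g ^ n) - M}
  one_mem' M := by
    filter_upwards [hg.eventually_ge_atTop M] with n hn
    rw [one_mul, dist_self]
    linarith [dist_nonneg (x := 1) (y := g ^ n)]
  inv_mem' {w} hw M := by
    filter_upwards [hw M] with n hn
    rwa [← dist_mul_left w, mul_inv_cancel_left, dist_comm]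
  mul_mem' {w w'} hw hw' M := by
    filter_upwards [hw (M + dist 1 w + dist 1 (w * w') + 2 * δ),
      hw' (M + dist 1 w + dist 1 (w * w') + 2 * δ)] with n hn hn'
    have h1 := hyp (w * w' * g ^ n) (g ^ n) 1 (w * g ^ n)
    rw [mul_assoc w w', dist_mul_left, dist_comm _ (w * g ^ n), ← mul_assoc,
      dist_comm (g ^ n) (w * g ^ n)] at h1
    have h2 := dist_one_mul_le (w * w') (g ^ n)
    have h3 := dist_one_mul_le w⁻¹ (w * g ^ n)
    rw [inv_mul_cancel_left, dist_one_inv] at h3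
    rw [dist_comm (w * w' * g ^ n) 1, dist_comm (g ^ n) 1, dist_comm (w * g ^ n) 1] at h1
    have h4 := dist_nonneg (x := 1) (y := w * w')
    rcases max_cases (dist 1 (w * w' * g ^ n) + dist (w * g ^ n) (g ^ n))
      (dist (w' * g ^ n) (g ^ n) + dist 1 (g ^ n)) with h | h <;> rw [h.1] at h1 <;> linarith

variable {g : Γ} (hyp : FourPoint Γ δ) (hg : Tendsto (fun n : ℕ => dist 1 (g ^ n)) atTop atTop)

theorem mem_limitStabilizer {w : Γ} : w ∈ limitStabilizer g hyp hg ↔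
    ∀ M : ℝ, ∀ᶠ n : ℕ in atTop, dist (w * g ^ n) (g ^ n) ≤ 2 * dist 1 (g ^ n) - M := Iff.rfl

theorem mem_limitStabilizer_of_commute {c : Γ} {j : ℕ} (hj : 1 ≤ j) (hc : Commute c (g ^ j)) :
    c ∈ limitStabilizer g hyp hg := by
  intro M
  filter_upwards [hg.eventually_ge_atTop (M + dist 1 c + j * dist 1 g + j * dist 1 g)] with n hn
  have h1 : dist (c * g ^ n) (g ^ n) = dist (c * g ^ (n % j)) (g ^ (n % j)) := by
    have h2 : g ^ n = (g ^ j) ^ (n / j) * g ^ (n % j) := by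
      rw [← pow_mul, ← pow_add, Nat.div_add_mod]
    rw [h2, ← mul_assoc, (hc.pow_right _).eq, mul_assoc, dist_mul_left]
  have h3 := dist_triangle (c * g ^ (n % j)) 1 (g ^ (n % j))
  have h4 := dist_one_mul_le c (g ^ (n % j))
  have h5 := dist_one_pow_le g (n % j)
  have h6 : ((n % j : ℕ) : ℝ) ≤ j := by exact_mod_cast (Nat.mod_lt n hj).le
  have h7 := mul_le_mul_of_nonneg_right h6 (dist_nonneg (x := 1) (y := g))
  have h8 := dist_nonneg (x := 1) (y := g ^ n)
  rw [dist_comm _ 1] at h3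
  have h9 : 0 ≤ dist 1 c := dist_nonneg
  rw [h1]
  linarith

/-- A Busemann function for the sequence `g ^ n`. -/
structure IsBusemann (g : Γ) (U : Ultrafilter ℕ) (b : Γ → ℝ) : Prop where
  le_atTop : (U : Filter ℕ) ≤ atTop
  tendsto : ∀ u, Tendsto (fun n : ℕ => dist u (g ^ n) - dist 1 (g ^ n)) U (𝓝 (b u))

theorem exists_isBusemann (g : Γ) : ∃ U b, IsBusemann g U b := by
  have h1 : ∀ u : Γ, ∃ x : ℝ, Tendsto (fun n : ℕ => dist u (g ^ n) - dist 1 (g ^ n))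
      (hyperfilter ℕ) (𝓝 x) := fun u => by
    obtain ⟨x, -, hx⟩ := (isCompact_Icc (a := -dist 1 u) (b := dist 1 u)).ultrafilter_le_nhds
      ((hyperfilter ℕ).map fun n : ℕ => dist u (g ^ n) - dist 1 (g ^ n)) (by
        rw [le_principal_iff]
        refine Ultrafilter.mem_map.2 (Filter.mem_of_superset univ_mem fun n _ => ?_)
        have h2 := dist_triangle u 1 (g ^ n)
        have h3 := dist_triangle 1 u (g ^ n)
        rw [dist_comm u 1] at h2
        constructor <;> linarith)
    exact ⟨x, hx⟩
  choose b hb using h1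
  exact ⟨hyperfilter ℕ, b, by rw [← Nat.cofinite_eq_atTop]; exact hyperfilter_le_cofinite, hb⟩

namespace IsBusemann

variable {U : Ultrafilter ℕ} {b : Γ → ℝ} {hyp hg}

theorem le_dist (hb : IsBusemann g U b) (u : Γ) : b u ≤ dist 1 u := by
  refine le_of_tendsto (hb.tendsto u) (Eventually.of_forall fun n => ?_)
  have h2 := dist_triangle u 1 (g ^ n)
  rw [dist_comm u 1] at h2
  linarith

theorem one (hb : IsBusemann g U b) : b 1 = 0 :=
  tendsto_nhds_unique (hb.tendsto 1) (by simp)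

theorem dist_le (hb : IsBusemann g U b) (hyp : FourPoint Γ δ) (u v : Γ) :
    dist u v ≤ max (dist 1 u + b v) (dist 1 v + b u) + 2 * δ := by
  have h1 := ((((hb.tendsto v).const_add (dist 1 u)).max
    ((hb.tendsto u).const_add (dist 1 v))).add_const (2 * δ))
  refine ge_of_tendsto h1 (Eventually.of_forall fun n => ?_)
  have h2 := hyp u v 1 (g ^ n)
  rw [dist_comm u 1, dist_comm v 1] at h2
  rcases max_cases (dist 1 u + dist v (g ^ n)) (dist u (g ^ n) + dist 1 v) with h | h <;>
    rw [h.1] at h2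
  · linarith [le_max_left (dist 1 u + (dist v (g ^ n) - dist 1 (g ^ n)))
      (dist 1 v + (dist u (g ^ n) - dist 1 (g ^ n)))]
  · linarith [le_max_right (dist 1 u + (dist v (g ^ n) - dist 1 (g ^ n)))
      (dist 1 v + (dist u (g ^ n) - dist 1 (g ^ n)))]

theorem mul_le (hb : IsBusemann g U b) {h : Γ} (hh : h ∈ limitStabilizer g hyp hg) (u : Γ) :
    b (h * u) ≤ b h + b u + 2 * δ := by
  refine le_of_tendsto_of_tendsto (hb.tendsto (h * u))
    (((hb.tendsto h).add (hb.tendsto u)).add_const (2 * δ)) (hb.le_atTop ?_)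
  filter_upwards [hh (dist 1 u + dist 1 (h * u) + 2 * δ + 1)] with n hn
  have h1 := hyp (h * u) (g ^ n) h (h * g ^ n)
  have h2 : dist (h * u) h = dist 1 u := by
    rw [dist_comm, dist_eq_dist_one, inv_mul_cancel_left]
  have h3 : dist h (h * g ^ n) = dist 1 (g ^ n) := by rw [dist_eq_dist_one, inv_mul_cancel_left]
  rw [h2, h3, dist_mul_left, dist_comm _ (h * g ^ n), dist_comm _ h] at h1
  have h4 := dist_triangle 1 (h * u) (g ^ n)
  rcases max_cases (dist 1 u + dist (h * g ^ n) (g ^ n))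
    (dist u (g ^ n) + dist h (g ^ n)) with h | h <;> rw [h.1] at h1 <;> linarith

theorem le_mul (hb : IsBusemann g U b) {h : Γ} (hh : h ∈ limitStabilizer g hyp hg) (u : Γ) :
    b h + b u ≤ b (h * u) + 2 * δ := by
  refine le_of_tendsto_of_tendsto ((hb.tendsto h).add (hb.tendsto u))
    ((hb.tendsto (h * u)).add_const (2 * δ)) (hb.le_atTop ?_)
  filter_upwards [hh (dist 1 u + dist 1 u + dist 1 h + 2 * δ + 1)] with n hn
  have h1 := hyp (h * u) (h * g ^ n) h (g ^ n)
  have h2 : dist (h * u) h = dist 1 u := by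
    rw [dist_comm, dist_eq_dist_one, inv_mul_cancel_left]
  have h3 : dist (h * g ^ n) h = dist 1 (g ^ n) := by
    rw [dist_comm, dist_eq_dist_one, inv_mul_cancel_left]
  rw [h2, h3, dist_mul_left] at h1
  have h4 := dist_triangle 1 u (g ^ n)
  have h5 := dist_triangle 1 h (g ^ n)
  rcases max_cases (dist 1 u + dist (h * g ^ n) (g ^ n))
    (dist (h * u) (g ^ n) + dist 1 (g ^ n)) with h | h <;> rw [h.1] at h1 <;> linarith

end IsBusemann

theorem dist_one_pow_two_pow_le {h : Γ} (hh : ∀ n, dist 1 (h ^ (2 * n)) ≤ dist 1 (h ^ n) + 2 * δ)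
    (r k : ℕ) : dist 1 (h ^ (r * 2 ^ k)) ≤ dist 1 (h ^ r) + k * (2 * δ) := by
  induction k with
  | zero => simp
  | succ k ih =>
    have h1 := hh (r * 2 ^ k)
    rw [show 2 * (r * 2 ^ k) = r * 2 ^ (k + 1) by ring] at h1
    push_cast; linarith

theorem not_steep_of_mem_limitStabilizer (hδ : 0 < δ) (hfin : FiniteBalls Γ)
    (hfo : ¬ IsOfFinOrder g)
    (hpar : ∀ n, dist 1 (g ^ (2 * n)) ≤ dist 1 (g ^ n) + 2 * δ) {f : Γ}
    (hfE : f ∈ limitStabilizer g hyp hg) : ¬ Steep δ f := by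
  intro hf
  obtain ⟨U, b, hb⟩ := exists_isBusemann g
  have hgE : g ∈ limitStabilizer g hyp hg :=
    mem_limitStabilizer_of_commute hyp hg (j := 1) le_rfl (by simp)
  set K := dist 1 f + 2 * δ with hK
  have h1 : ∀ m : ℕ, ∃ e : ℤ, e.natAbs = m ∧ b (f ^ e) ≤ - dist 1 (f ^ m) + (K + 4 * δ) := by
    intro m
    have h2 := hb.dist_le hyp (f ^ (-m : ℤ)) (f ^ (m : ℤ))
    rw [dist_zpow_zpow, dist_one_zpow f (-m), dist_one_zpow f m,
      dist_one_zpow, show (m - -m : ℤ).natAbs = m + m by omega, Int.natAbs_neg,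
      Int.natAbs_natCast] at h2
    have h3 := hf.superadd hδ hyp m m
    have h4 := hb.le_mul (zpow_mem hfE m) (f ^ (-m : ℤ))
    rw [← zpow_add, add_neg_cancel, zpow_zero, hb.one] at h4
    rcases max_cases (dist 1 (f ^ m) + b (f ^ (m : ℤ)))
      (dist 1 (f ^ m) + b (f ^ (-m : ℤ))) with h | h <;> rw [h.1] at h2
    · exact ⟨-m, by simp, by linarith⟩
    · exact ⟨m, by simp, by linarith⟩
  choose e he hbe using h1
  have h2 : ∀ m : ℕ, (f ^ e m)⁻¹ * (g * f ^ e m) ∈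
      {u : Γ | dist 1 u ≤ K + 4 * δ + dist 1 g + 4 * δ} := fun m => by
    rw [Set.mem_ofPred_eq, ← dist_eq_dist_one]
    have h3 := hb.dist_le hyp (f ^ e m) (g * f ^ e m)
    have h4 := hb.mul_le hgE (f ^ e m)
    have h5 := hb.le_dist g
    have h6 := dist_one_mul_le g (f ^ e m)
    have h7 := hbe m
    have h8 := dist_one_zpow f (e m)
    rw [he] at h8
    rcases max_cases (dist 1 (f ^ e m) + b (g * f ^ e m))
      (dist 1 (g * f ^ e m) + b (f ^ e m)) with h | h <;> rw [h.1] at h3 <;> linarith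
  obtain ⟨m, n, hmn, h⟩ := (hfin _).exists_lt_map_eq_of_forall_mem h2
  have h3 : Commute g (f ^ (e n - e m)) := by
    have h4 : g * f ^ e n = f ^ e n * ((f ^ e m)⁻¹ * (g * f ^ e m)) := by rw [h]; group
    rw [Commute, SemiconjBy, zpow_sub, ← mul_assoc, h4]
    group
  set t := (e n - e m).natAbs with ht
  have ht1 : 1 ≤ t := by
    have h4 := he n
    have h5 := he m
    omega
  have h4 : Commute g (f ^ t) := by
    rcases Int.natAbs_eq (e n - e m) with h5 | h5
    · rwa [h5, ← ht, zpow_natCast] at h3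
    · rwa [h5, ← ht, zpow_neg, zpow_natCast, Commute.inv_right_iff] at h3
  have hF := hf.pow hδ ht1
  obtain ⟨r, hr, s, hs⟩ := hF.exists_pow_eq_zpow hδ hyp hfin h4
  have hs0 : s ≠ 0 := by
    rintro rfl
    rw [zpow_zero] at hs
    exact hfo (isOfFinOrder_iff_pow_eq_one.2 ⟨r, hr, hs⟩)
  obtain ⟨k, hk⟩ := exists_nat_gt (dist 1 (g ^ r) / δ)
  rw [div_lt_iff₀ hδ] at hk
  have h5 := dist_one_pow_two_pow_le hpar r k
  rw [pow_mul, hs, ← zpow_natCast, ← zpow_mul, dist_one_zpow, Int.natAbs_mul,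
    Int.natAbs_natCast] at h5
  have h6 := hF.mul_le (s.natAbs * 2 ^ k)
  have h7 : k + 1 ≤ s.natAbs * 2 ^ k := by
    have h8 : k < 2 ^ k := Nat.lt_two_pow_self
    have h9 : 1 ≤ s.natAbs := by omega
    nlinarith
  have h8 : ((k + 1 : ℕ) : ℝ) ≤ (s.natAbs * 2 ^ k : ℕ) := by exact_mod_cast h7
  have h9 := mul_le_mul_of_nonneg_right h8 (by positivity : 0 ≤ 3 * δ)
  push_cast at h5 h6 h9
  rw [hs] at hk
  nlinarith

theorem dist_one_mul_le_max (hδ : 0 < δ) (hfin : FiniteBalls Γ) (hfo : ¬ IsOfFinOrder g)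
    (hpar : ∀ n, dist 1 (g ^ (2 * n)) ≤ dist 1 (g ^ n) + 2 * δ) {u v : Γ}
    (hu : u ∈ limitStabilizer g hyp hg) (hv : v ∈ limitStabilizer g hyp hg) :
    dist 1 (u * v) ≤ max (dist 1 u) (dist 1 v) + 4 * δ := by
  obtain ⟨U, b, hb⟩ := exists_isBusemann g
  have h1 : ∀ h ∈ limitStabilizer g hyp hg, b h ≤ 2 * δ := by
    intro h hh
    have h2 : ∀ n, dist 1 (h ^ (2 * n)) ≤ dist 1 (h ^ n) + 2 * δ := fun n => by
      by_contra! h3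
      obtain ⟨q, -, hq⟩ := hyp.exists_steep h3
      exact not_steep_of_mem_limitStabilizer hyp hg hδ hfin hfo hpar (pow_mem hh q) hq
    have h3 : ∀ k : ℕ, 2 ^ k * (b h - 2 * δ) ≤ b (h ^ (2 ^ k)) - 2 * δ := by
      intro k
      induction k with
      | zero => simp
      | succ k ih =>
        have h4 := hb.le_mul (pow_mem hh (2 ^ k)) (h ^ (2 ^ k))
        rw [← pow_add, ← two_mul, ← two_mul, ← pow_succ'] at h4
        rw [pow_succ' (2 : ℝ)]
        linarith
    by_contra! h4
    have h5 : 0 < b h - 2 * δ := by linarith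
    obtain ⟨j, hj⟩ := exists_nat_ge ((dist 1 h + 4 * δ) / (b h - 2 * δ))
    rw [div_le_iff₀ h5] at hj
    have h6 := h3 (2 * j)
    have h7 := dist_one_pow_two_pow_le h2 1 (2 * j)
    rw [one_mul, pow_one] at h7
    have h8 := hb.le_dist (h ^ (2 ^ (2 * j)))
    have h9 : ((j : ℝ) + 1) * (j + 1) ≤ 2 ^ (2 * j) := by
      have h10 : j + 1 ≤ 2 ^ j := Nat.lt_two_pow_self
      have h11 := Nat.mul_le_mul h10 h10
      rw [← pow_add, ← two_mul] at h11
      exact_mod_cast h11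
    have h10 := mul_le_mul_of_nonneg_right h9 h5.le
    have h11 : ((j : ℝ) + 1) * (dist 1 h + 4 * δ) ≤ (j + 1) * ((j + 1) * (b h - 2 * δ)) := by
      refine mul_le_mul_of_nonneg_left ?_ (by positivity)
      linarith
    have h12 : 0 ≤ (j : ℝ) * dist 1 h := by positivity
    push_cast at h7
    linarith
  have h2 := hb.dist_le hyp u⁻¹ v
  rw [dist_eq_dist_one u⁻¹ v, inv_inv, dist_one_inv] at h2
  have h3 := h1 _ (inv_mem hu)
  have h4 := h1 _ hv
  rcases max_cases (dist 1 u + b v) (dist 1 v + b u⁻¹) with h | h <;> rw [h.1] at h2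
  · linarith [le_max_left (dist 1 u) (dist 1 v)]
  · linarith [le_max_right (dist 1 u) (dist 1 v)]

theorem mem_limitStabilizer_of_conj (hδ : 0 < δ) (hfin : FiniteBalls Γ) (hfo : ¬ IsOfFinOrder g)
    (hpar : ∀ n, dist 1 (g ^ (2 * n)) ≤ dist 1 (g ^ n) + 2 * δ) {w : Γ} {k : ℕ} (hk : 1 ≤ k)
    (hw : w * g ^ k * w⁻¹ ∈ limitStabilizer g hyp hg) : w ∈ limitStabilizer g hyp hg := by
  intro M
  have hgE : g ∈ limitStabilizer g hyp hg :=
    mem_limitStabilizer_of_commute hyp hg (j := 1) le_rfl (by simp)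
  have hmax := fun u v => dist_one_mul_le_max (u := u) (v := v) hyp hg hδ hfin hfo hpar
  obtain ⟨N, hN⟩ := eventually_atTop.1 (hg.eventually_ge_atTop (M + 3 * dist 1 w + 6 * δ))
  set c := w * g ^ (k * N) * w⁻¹ with hc
  have hcE : c ∈ limitStabilizer g hyp hg := by
    rw [hc, pow_mul, ← conj_pow]
    exact pow_mem hw N
  have h1 : M + dist 1 w + 6 * δ ≤ dist 1 c := by
    have h2 := hN (k * N) (Nat.le_mul_of_pos_left N hk)
    have h3 : g ^ (k * N) = w⁻¹ * c * w := by rw [hc]; group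
    have h4 := dist_one_mul_le (w⁻¹ * c) w
    have h5 := dist_one_mul_le w⁻¹ c
    rw [dist_one_inv] at h5
    rw [← h3] at h4
    linarith
  filter_upwards [hg.eventually_ge_atTop (dist 1 c), hg.eventually_ge_atTop (dist 1 (g ^ (k * N)))]
    with n hn hn'
  have h2 := hmax _ _ (inv_mem (pow_mem hgE n)) hcE
  have h3 := hmax _ _ (inv_mem (pow_mem hgE n)) (pow_mem hgE (k * N))
  rw [dist_one_inv, max_eq_left hn, ← dist_eq_dist_one] at h2
  rw [dist_one_inv, max_eq_left hn', ← dist_eq_dist_one] at h3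
  have h4 : dist (w * g ^ n) c ≤ dist (g ^ n) (g ^ (k * N)) + dist 1 w := by
    rw [hc, mul_assoc, dist_mul_left]
    refine (dist_triangle _ (g ^ (k * N)) _).trans (le_of_eq ?_)
    rw [dist_eq_dist_one (g ^ (k * N)), inv_mul_cancel_left, dist_one_inv]
  have h5 := hyp (w * g ^ n) (g ^ n) 1 c
  have h6 := dist_one_mul_le w (g ^ n)
  rw [dist_comm (w * g ^ n) 1, dist_comm (g ^ n) 1] at h5
  rcases max_cases (dist 1 (w * g ^ n) + dist (g ^ n) c)
    (dist (w * g ^ n) c + dist 1 (g ^ n)) with h | h <;> rw [h.1] at h5 <;> linarith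

end Par

end RandomWalk

namespace RandomWalk

open scoped Pointwise commutatorElement Topology

section Thin

universe u

variable {Γ : Type u} [Group Γ] [PseudoMetricSpace Γ] [IsIsometricSMul Γ Γ] {δ : ℝ}

theorem Colorable.ncard_le {P : ℕ} {r : ℝ} (hcol : Colorable Γ P r) (hfin : FiniteBalls Γ)
    (n : ℕ) : {a : Γ | dist 1 a ≤ n * r + 2 * r}.ncard ≤
      P ^ n * {a : Γ | dist 1 a ≤ 4 * r}.ncard := by
  classical
  obtain ⟨κ, hκ⟩ := hcol n
  have h1 := hfin (n * r + 2 * r)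
  have h2 := hfin (4 * r)
  rw [Set.ncard_eq_toFinset_card _ h1, Set.ncard_eq_toFinset_card _ h2]
  have h3 := Finset.card_le_mul_card_image_of_maps_to (s := h1.toFinset)
    (t := (Finset.univ : Finset (Fin (P ^ n)))) (f := κ) (fun _ _ => Finset.mem_univ _)
    h2.toFinset.card (fun b _ => ?_)
  · simpa [mul_comm] using h3
  · rcases (h1.toFinset.filter fun a => κ a = b).eq_empty_or_nonempty with h4 | ⟨a, ha⟩
    · simp [h4]
    · simp only [Finset.mem_filter, Set.Finite.mem_toFinset, Set.mem_ofPred_eq] at ha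
      refine Finset.card_le_card_of_injOn (fun c => a⁻¹ * c) (fun c hc => ?_)
        (mul_right_injective _).injOn
      simp only [Finset.coe_filter, Set.Finite.mem_toFinset, Set.mem_ofPred_eq] at hc
      simp only [Set.Finite.coe_toFinset, Set.mem_ofPred_eq]
      rw [← dist_eq_dist_one]
      exact hκ _ _ ha.1 hc.1 (ha.2.trans hc.2.symm)

theorem Colorable.polyGrowth {P : ℕ} {r : ℝ} (hr : 0 < r)
    (hcol : Colorable Γ P r) (hfin : FiniteBalls Γ) (E : Subgroup Γ)
    (hE : ∀ u ∈ E, ∀ v ∈ E, dist 1 (u * v) ≤ max (dist 1 u) (dist 1 v) + 4 * δ) :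
    PolyGrowth E (P * ⌈4 * δ / r⌉₊) := by
  intro T hT
  obtain ⟨ρ, hρ0, hρ⟩ : ∃ ρ : ℝ, 0 ≤ ρ ∧ ∀ t ∈ T, dist 1 (t : Γ) ≤ ρ := by
    obtain ⟨ρ, hρ⟩ := (hT.image fun t : E => dist 1 (t : Γ)).bddAbove
    exact ⟨max 0 ρ, le_max_left _ _, fun t ht => le_max_of_le_right (hρ ⟨t, ht, rfl⟩)⟩
  have h1 : ∀ k n : ℕ, n ≤ 2 ^ k → ∀ x ∈ T ^ n, dist 1 (x : Γ) ≤ ρ + k * (4 * δ) := by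
    intro k
    induction k with
    | zero =>
      intro n hn x hx
      rw [pow_zero] at hn
      interval_cases n
      · rw [pow_zero, Set.mem_one] at hx
        rw [hx]; simpa using hρ0
      · rw [pow_one] at hx
        simpa using hρ x hx
    | succ k ih =>
      intro n hn x hx
      rw [pow_succ] at hn
      rw [show n = n / 2 + (n - n / 2) by omega, pow_add] at hx
      obtain ⟨y, hy, z, hz, rfl⟩ := hx
      have h2 := ih _ (by omega) y hy
      have h3 := ih _ (by omega) z hz
      have h4 := hE y y.2 z z.2
      have h5 := max_le h2 h3
      push_cast
      linarith
  set D := ⌈4 * δ / r⌉₊ with hD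
  set A := ⌈ρ / r⌉₊ with hA
  set B := {a : Γ | dist 1 a ≤ 4 * r}.ncard with hB
  refine ⟨P ^ A * 2 ^ (P * D) * B, fun n hn => ?_⟩
  set k := Nat.clog 2 n with hk
  have hk1 : n ≤ 2 ^ k := Nat.le_pow_clog one_lt_two n
  have hk2 : 2 ^ k ≤ 2 * n := by
    rcases Nat.lt_or_ge 1 n with h | h
    · have h2 := Nat.pow_pred_clog_lt_self one_lt_two h
      have h3 : 0 < k := Nat.clog_pos one_lt_two h
      rw [← hk] at h2
      have h4 : 2 ^ k = 2 * 2 ^ k.pred := by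
        rw [← pow_succ', ← Nat.succ_eq_add_one, Nat.succ_pred h3.ne']
      omega
    · obtain rfl : n = 1 := by omega
      simp [hk]
  have h2 : (T ^ n).ncard ≤ P ^ (A + D * k) * B := by
    refine le_trans ?_ (hcol.ncard_le hfin (A + D * k))
    rw [← Set.ncard_image_of_injective _ (Subtype.val_injective (p := fun x => x ∈ E))]
    refine Set.ncard_le_ncard ?_ (hfin _)
    rintro _ ⟨x, hx, rfl⟩
    have h3 := h1 k n hk1 x hx
    have h4 := (div_le_iff₀ hr).1 (Nat.le_ceil (ρ / r))
    have h5 := (div_le_iff₀ hr).1 (Nat.le_ceil (4 * δ / r))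
    rw [← hA] at h4
    rw [← hD] at h5
    have h6 := mul_le_mul_of_nonneg_left h5 (Nat.cast_nonneg k (α := ℝ))
    rw [Set.mem_ofPred_eq]
    push_cast
    linarith
  have h3 : P ^ (A + D * k) ≤ P ^ A * 2 ^ (P * D) * n ^ (P * D) := by
    rw [pow_add, mul_assoc, ← mul_pow]
    refine Nat.mul_le_mul_left _ ?_
    calc P ^ (D * k) ≤ (2 ^ P) ^ (D * k) := Nat.pow_le_pow_left Nat.lt_two_pow_self.le _
      _ = (2 ^ k) ^ (P * D) := by rw [← pow_mul, ← pow_mul]; congr 1; ring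
      _ ≤ _ := Nat.pow_le_pow_left hk2 _
  have h4 := h2.trans (Nat.mul_le_mul_right B h3)
  have h5 : ((T ^ n).ncard : ℝ) ≤ (P ^ A * 2 ^ (P * D) * n ^ (P * D) * B : ℕ) := by
    exact_mod_cast h4
  push_cast at h5
  linarith

theorem Colorable.virtNilpotent_closure {P : ℕ} {r e R : ℝ} (hr : 0 < r) (hδ : 0 < δ)
    (hcol : Colorable Γ P r) (hfin : FiniteBalls Γ) (hyp : FourPoint Γ δ) {g : Γ}
    (hfo : ¬ IsOfFinOrder g) (hg : dist 1 g ≤ e) (he : e ≤ 1) {n₀ n : ℕ}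
    (hn₀ : ((P ^ n₀ * P ^ n₀ : ℕ) : ℝ) * e ≤ 1) (hr₀ : 4 * r + 3 ≤ n₀ * r + 2 * r)
    (hn : ((P ^ n : ℕ) : ℝ) * e ≤ 1) (hR : R + 1 ≤ n * r + 2 * r) :
    VirtNilpotent (Subgroup.closure {a : Γ | dist 1 a ≤ R}) := by
  have key : ∀ Q : Γ → Prop, (∀ c, ∀ j : ℕ, 1 ≤ j → Commute c (g ^ j) → Q c) →
      (∀ w, ∀ k : ℕ, 1 ≤ k → Q (w * g ^ k * w⁻¹) → Q w) → ∀ a ∈ {a : Γ | dist 1 a ≤ R}, Q a := by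
    intro Q h1 h2 a ha
    rw [Set.mem_ofPred_eq] at ha
    obtain ⟨k, hk, h⟩ := hcol.exists_conj_pow hg hn (a := a) (by linarith)
    exact h2 a k hk (hcol.forall_of_conj_closed hfin hg he hn₀ hr₀ h1 h2 h)
  by_cases hpar : ∀ m, dist 1 (g ^ (2 * m)) ≤ dist 1 (g ^ m) + 2 * δ
  · have hg' := hfin.tendsto_dist_pow hfo
    have h1 := key (fun w => w ∈ limitStabilizer g hyp hg')
      (fun c j hj hc => mem_limitStabilizer_of_commute hyp hg' hj hc)
      (fun w k hk hw => mem_limitStabilizer_of_conj hyp hg' hδ hfin hfo hpar hk hw)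
    have h2 : Subgroup.closure {a : Γ | dist 1 a ≤ R} ≤ limitStabilizer g hyp hg' :=
      (Subgroup.closure_le _).2 h1
    have h3 := hcol.polyGrowth hr hfin (Subgroup.closure {a : Γ | dist 1 a ≤ R})
      fun u hu v hv => dist_one_mul_le_max hyp hg' hδ hfin hfo hpar (h2 hu) (h2 hv)
    have : Group.FG (Subgroup.closure {a : Γ | dist 1 a ≤ R}) := by
      rw [Group.fg_iff_subgroup_fg, Subgroup.fg_iff]
      exact ⟨_, rfl, hfin R⟩
    exact h3.virtNilpotent
  · push Not at hpar
    obtain ⟨m, hm⟩ := hpar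
    obtain ⟨q, -, hq⟩ := hyp.exists_steep hm
    refine virtNilpotent_closure_of_preservesAxis hq hδ hyp hfin (hfin R) (key _ ?_ ?_)
    · exact fun c j hj hc => ⟨j, hj, Or.inl (by rw [hc.eq, mul_inv_cancel_right])⟩
    · exact fun w k hk hw => PreservesAxis.of_conj hq hδ hyp hfin hk hw

end Thin

end RandomWalk

namespace RandomWalk

open scoped Pointwise commutatorElement Topology

theorem VirtNilpotent.of_mulEquiv {G G' : Type*} [Group G] [Group G'] (e : G ≃* G')
    (h : VirtNilpotent G) : VirtNilpotent G' := by
  obtain ⟨H, hH, hn⟩ := h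
  refine ⟨H.map e.toMonoidHom, ⟨?_⟩, isNilpotent_map hn e.toMonoidHom⟩
  rw [MulEquiv.toMonoidHom_eq_coe, Subgroup.index_map_equiv]
  exact hH.index_ne_zero

section Packing

variable {X : Type*} [MetricSpace X] {P₀ r : ℝ}

theorem _root_.IsPacked.exists_net (hX : IsPacked X P₀ r) (x : X) :
    ∃ S : Finset X, S.card ≤ ⌈P₀⌉₊ ∧ ∀ y ∈ closedBall x (3 * r), ∃ s ∈ S, dist y s ≤ 2 * r := by
  classical
  set good : Finset X → Prop := fun S => (↑S ⊆ closedBall x (3 * r)) ∧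
    ∀ a ∈ S, ∀ b ∈ S, a ≠ b → 2 * r < dist a b
  have hcard : ∀ S, good S → S.card ≤ ⌈P₀⌉₊ := fun S hS => by
    exact_mod_cast (hX x S hS.1 hS.2).trans (Nat.le_ceil P₀)
  have hbdd : BddAbove {n | ∃ S, good S ∧ S.card = n} :=
    ⟨⌈P₀⌉₊, by rintro _ ⟨S, hS, rfl⟩; exact hcard S hS⟩
  obtain ⟨S, hS, hmax⟩ := Nat.sSup_mem (s := {n | ∃ S, good S ∧ S.card = n})
    ⟨0, ∅, ⟨by simp, by simp⟩, rfl⟩ hbdd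
  refine ⟨S, hcard S hS, fun y hy => ?_⟩
  by_contra! hfar
  have hyS : y ∉ S ∨ r < 0 := by
    by_contra! h
    have := hfar y h.1
    rw [dist_self] at this
    linarith
  rcases hyS with hyS | hr
  · have h1 : good (insert y S) := by
      refine ⟨?_, fun a ha b hb hab => ?_⟩
      · rw [Finset.coe_insert]
        exact Set.insert_subset hy hS.1
      · rw [Finset.mem_insert] at ha hb
        rcases ha with rfl | ha <;> rcases hb with rfl | hb
        · exact absurd rfl hab
        · exact hfar b hb
        · rw [dist_comm]; exact hfar a ha
        · exact hS.2 a ha b hb hab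
    have h2 := le_csSup hbdd ⟨_, h1, rfl⟩
    rw [Finset.card_insert_of_notMem hyS] at h2
    omega
  · rw [mem_closedBall] at hy
    linarith [dist_nonneg (x := y) (y := x)]

theorem _root_.IsGCB.exists_between {σ : X → X → ℝ → X} (hσ : IsGCB σ) {a : ℝ} (hr : 0 < r)
    (ha : 0 ≤ a) {x y : X} (h : dist x y ≤ a + r) : ∃ z, dist x z ≤ a ∧ dist y z ≤ r := by
  rcases le_or_gt (dist x y) r with h1 | h1
  · exact ⟨x, by rwa [dist_self], by rwa [dist_comm]⟩
  · have h2 : 0 < dist x y := hr.trans h1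
    have h3 : r / dist x y ≤ 1 := (div_le_one h2).2 h1.le
    have h4 : 0 ≤ r / dist x y := by positivity
    have h5 : r / dist x y * dist x y = r := div_mul_cancel₀ _ h2.ne'
    have h6 : (1 - r / dist x y) ∈ Set.Icc (0 : ℝ) 1 := ⟨by linarith, by linarith⟩
    refine ⟨σ x y (1 - r / dist x y), ?_, ?_⟩
    · have h7 := hσ.geodesic x y 0 (by simp) _ h6
      rw [hσ.source, zero_sub, abs_neg, abs_of_nonneg h6.1, sub_mul, h5] at h7
      linarith
    · have h7 := hσ.geodesic x y 1 (by simp) _ h6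
      rw [hσ.target, sub_sub_cancel, abs_of_nonneg h4, h5] at h7
      exact h7.le

theorem _root_.IsPacked.exists_cover (hX : IsPacked X P₀ r) {σ : X → X → ℝ → X} (hσ : IsGCB σ)
    (hr : 0 < r) (x : X) (n : ℕ) : ∃ C : Finset X, C.card ≤ ⌈P₀⌉₊ ^ n ∧
      ∀ y, dist x y ≤ n * r + 2 * r → ∃ c ∈ C, dist y c ≤ 2 * r := by
  classical
  induction n with
  | zero => exact ⟨{x}, by simp, fun y hy => ⟨x, by simp, by rw [dist_comm]; simpa using hy⟩⟩
  | succ n ih =>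
    obtain ⟨C, hC, hcov⟩ := ih
    choose S hS hnet using hX.exists_net
    refine ⟨C.biUnion S, ?_, fun y hy => ?_⟩
    · rw [pow_succ]
      exact (Finset.card_biUnion_le_card_mul C S _ fun c _ => hS c).trans
        (Nat.mul_le_mul_right _ hC)
    · push_cast at hy
      obtain ⟨z, hz, hyz⟩ := hσ.exists_between (a := n * r + 2 * r) hr (by positivity)
        (x := x) (y := y) (by linarith)
      obtain ⟨c, hc, hzc⟩ := hcov z hz
      obtain ⟨s, hs, hys⟩ := hnet c y (by
        rw [mem_closedBall]
        linarith [dist_triangle y z c])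
      exact ⟨s, Finset.mem_biUnion.2 ⟨c, hc, hs⟩, hys⟩

theorem _root_.IsPacked.exists_colouring (hX : IsPacked X P₀ r) {σ : X → X → ℝ → X} (hσ : IsGCB σ)
    (hr : 0 < r) (x : X) (n : ℕ) : ∃ κ : X → Fin (⌈P₀⌉₊ ^ n), ∀ y z, dist x y ≤ n * r + 2 * r →
      dist x z ≤ n * r + 2 * r → κ y = κ z → dist y z ≤ 4 * r := by
  obtain ⟨C, hC, hcov⟩ := hX.exists_cover hσ hr x n
  have h1 : ∀ y, ∃ c : C, dist x y ≤ n * r + 2 * r → dist y c ≤ 2 * r := fun y => by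
    by_cases h : dist x y ≤ n * r + 2 * r
    · obtain ⟨c, hc, h2⟩ := hcov y h
      exact ⟨⟨c, hc⟩, fun _ => h2⟩
    · obtain ⟨c, hc, -⟩ := hcov x (by rw [dist_self]; positivity)
      exact ⟨⟨c, hc⟩, fun h' => absurd h' h⟩
  choose f hf using h1
  obtain ⟨e⟩ := Function.Embedding.nonempty_of_card_le (α := C) (β := Fin (⌈P₀⌉₊ ^ n)) (by simpa)
  refine ⟨fun y => e (f y), fun y z hy hz h => ?_⟩
  have h2 := hf y hy
  have h3 := hf z hz
  rw [← e.injective h] at h3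
  linarith [dist_triangle_right y z (f y : X)]

theorem isVirtuallyNilpotent_almostStabilizer {δ : ℝ} (hr : 0 < r) (hδ : 0 < δ)
    {σ : X → X → ℝ → X} (hσ : IsGCB σ) (hyp : IsDeltaHyperbolic X δ) (hX : IsPacked X P₀ r)
    {Γ : Subgroup (X ≃ᵢ X)} (hΓ : IsDiscreteSubgroup Γ) {x : X} {g : X ≃ᵢ X} (hgΓ : g ∈ Γ)
    (hfo : ¬ IsOfFinOrder g) {e R : ℝ} (hg : dist x (g x) ≤ e) (he : e ≤ 1) {n₀ n : ℕ}
    (hn₀ : ((⌈P₀⌉₊ ^ n₀ * ⌈P₀⌉₊ ^ n₀ : ℕ) : ℝ) * e ≤ 1) (hr₀ : 4 * r + 3 ≤ n₀ * r + 2 * r)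
    (hn : ((⌈P₀⌉₊ ^ n : ℕ) : ℝ) * e ≤ 1) (hR : R + 1 ≤ n * r + 2 * r) :
    IsVirtuallyNilpotent (almostStabilizer Γ R x) := by
  let : PseudoMetricSpace Γ :=
    PseudoMetricSpace.induced (fun g : Γ => (g : X ≃ᵢ X) x) inferInstance
  have hdist : ∀ a b : Γ, dist a b = dist ((a : X ≃ᵢ X) x) ((b : X ≃ᵢ X) x) := fun a b => rfl
  have hone : ∀ a : Γ, dist 1 a = dist x ((a : X ≃ᵢ X) x) := fun a => rfl
  have : IsIsometricSMul Γ Γ := ⟨fun c => Isometry.of_dist_eq fun a b =>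
    (c : X ≃ᵢ X).dist_eq _ _⟩
  have hfin : FiniteBalls Γ := fun R =>
    Set.Finite.of_finite_image ((hΓ x R).subset (by
      rintro _ ⟨a, ha, rfl⟩
      exact ⟨a.2, ha⟩)) Subtype.val_injective.injOn
  have hcol : Colorable Γ ⌈P₀⌉₊ r := fun n => by
    obtain ⟨κ, hκ⟩ := hX.exists_colouring hσ hr x n
    exact ⟨fun a => κ ((a : X ≃ᵢ X) x), fun a b ha hb h => hκ _ _ ha hb h⟩
  have hfo' : ¬ IsOfFinOrder (⟨g, hgΓ⟩ : Γ) := by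
    rwa [← Submonoid.isOfFinOrder_coe]
  have h1 := hcol.virtNilpotent_closure hr hδ hfin
    (fun a b c d => hyp _ _ _ _) hfo' hg he hn₀ hr₀ hn hR
  have h2 : almostStabilizer Γ R x = (Subgroup.closure {a : Γ | dist 1 a ≤ R}).map Γ.subtype := by
    rw [MonoidHom.map_closure, almostStabilizer]
    congr 1
    ext a
    constructor
    · rintro ⟨ha, h⟩
      exact ⟨⟨a, ha⟩, h, rfl⟩
    · rintro ⟨a, h, rfl⟩
      exact ⟨a.2, h⟩
  rw [h2]
  exact h1.of_mulEquiv (Subgroup.equivMapOfInjective _ _ Γ.subtype_injective)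

end Packing

theorem exists_scale_constant {P : ℕ} (hP : 1 ≤ P) {r : ℝ} (hr : 0 < r) (n₀ : ℕ) :
    ∃ H : ℝ, 0 < H ∧ ∀ ε : ℝ, 0 < ε → 0 ≤ Real.log (1 / (ε * H)) / H →
      ((P ^ n₀ * P ^ n₀ : ℕ) : ℝ) * ε ≤ 1 ∧
      ((P ^ ⌈(Real.log (1 / (ε * H)) / H + 1) / r⌉₊ : ℕ) : ℝ) * ε ≤ 1 := by
  have hP0 : (0 : ℝ) < P := by exact_mod_cast hP
  have hL : 0 ≤ Real.log P := Real.log_nonneg (by exact_mod_cast hP)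
  set L := Real.log P with hLdef
  set H := L / r + Real.exp ((1 / r + 1) * L) + ((P ^ n₀ * P ^ n₀ : ℕ) : ℝ) with hHdef
  have hexp := Real.exp_pos ((1 / r + 1) * L)
  have hLr : 0 ≤ L / r := by positivity
  have hPn : (0 : ℝ) ≤ ((P ^ n₀ * P ^ n₀ : ℕ) : ℝ) := Nat.cast_nonneg _
  have hH : 0 < H := by linarith
  refine ⟨H, hH, fun ε hε hR => ?_⟩
  have hεH : 0 < ε * H := by positivity
  set R := Real.log (1 / (ε * H)) / H with hRdef
  have hRH : R * H = Real.log (1 / (ε * H)) := div_mul_cancel₀ _ hH.ne'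
  have h1 : ε * H ≤ 1 := by
    have h2 : 0 ≤ Real.log (1 / (ε * H)) := by rw [← hRH]; positivity
    rw [one_div, Real.log_inv] at h2
    by_contra! h3
    linarith [Real.log_pos h3]
  constructor
  · refine le_trans ?_ h1
    rw [mul_comm]
    exact mul_le_mul_of_nonneg_left (by linarith) hε.le
  · set n := ⌈(R + 1) / r⌉₊ with hn
    have h2 : (n : ℝ) ≤ (R + 1) / r + 1 := (Nat.ceil_lt_add_one (by positivity)).le
    have h3 : ((P ^ n : ℕ) : ℝ) = Real.exp (n * L) := by
      rw [mul_comm, Real.exp_mul, hLdef, Real.exp_log hP0, Real.rpow_natCast, Nat.cast_pow]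
    have h4 : n * L ≤ R * H + (1 / r + 1) * L := by
      have h5 := mul_le_mul_of_nonneg_right h2 hL
      have h6 : R * (L / r) ≤ R * H := mul_le_mul_of_nonneg_left (by linarith) hR
      have h7 : ((R + 1) / r + 1) * L = R * (L / r) + (1 / r + 1) * L := by ring
      linarith
    have h5 : Real.exp (n * L) ≤ 1 / (ε * H) * H := by
      refine (Real.exp_le_exp.2 h4).trans ?_
      rw [Real.exp_add, hRH, Real.exp_log (by positivity)]
      exact mul_le_mul_of_nonneg_left (by linarith) (by positivity)
    rw [h3]
    calc _ ≤ 1 / (ε * H) * H * ε := mul_le_mul_of_nonneg_right h5 hε.le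
      _ = 1 := by field_simp

end RandomWalk

/-- **Lemma 6.6**: almost-stabilizers of points displaced less than `ε < ε₀` by some
infinite-order element are elementary (virtually nilpotent) up to scale
`R_ε = (1/H₀)·log(1/(ε·H₀))`. -/
theorem thin_points_almost_stabilizer_elementary
    (P₀ r₀ : ℝ) (hP₀ : 0 < P₀) (hr₀ : 0 < r₀) :
    ∃ ε₀ : ℝ, 0 < ε₀ ∧
      ∀ δ : ℝ, 0 < δ →
        ∃ H₀ : ℝ, 0 < H₀ ∧
          ∀ (X : Type*) [MetricSpace X] [CompleteSpace X] (σ : X → X → ℝ → X),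
            IsGCB σ → IsDeltaHyperbolic X δ → IsPacked X P₀ r₀ →
            ∀ Γ : Subgroup (X ≃ᵢ X), (∀ g ∈ Γ, IsSigmaIsometry σ g) →
              IsDiscreteSubgroup Γ →
              ∀ ε : ℝ, 0 < ε → ε < ε₀ →
                ∀ x : X, (∃ g ∈ Γ, ¬ IsOfFinOrder g ∧ dist x (g x) < ε) →
                  IsVirtuallyNilpotent
                    ↥(almostStabilizer Γ (Real.log (1 / (ε * H₀)) / H₀) x) := by
  refine ⟨1, one_pos, fun δ hδ => ?_⟩
  have hP : 1 ≤ ⌈P₀⌉₊ := Nat.one_le_ceil_iff.2 hP₀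
  obtain ⟨H, hH, hconst⟩ := RandomWalk.exists_scale_constant hP hr₀ (⌈3 / r₀⌉₊ + 2)
  refine ⟨H, hH, fun X _ _ σ hσ hyp hX Γ _ hΓ ε hε hε1 x hx => ?_⟩
  obtain ⟨g, hgΓ, hfo, hg⟩ := hx
  rcases lt_or_ge (Real.log (1 / (ε * H)) / H) 0 with hR | hR
  · have h1 : {g : X ≃ᵢ X | g ∈ Γ ∧ dist x (g x) ≤ Real.log (1 / (ε * H)) / H} = ∅ := by
      refine Set.eq_empty_of_forall_notMem fun a ha => ?_
      exact absurd (dist_nonneg.trans ha.2) (not_le.2 hR)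
    rw [almostStabilizer, h1, Subgroup.closure_empty]
    exact RandomWalk.virtNilpotent_of_finite _
  · obtain ⟨h1, h2⟩ := hconst ε hε hR
    refine RandomWalk.isVirtuallyNilpotent_almostStabilizer hr₀ hδ hσ hyp hX hΓ hgΓ hfo hg.le hε1.le h1
      ?_ h2 ?_
    · have h3 := (div_le_iff₀ hr₀).1 (Nat.le_ceil (3 / r₀))
      push_cast
      linarith
    · have h3 := (div_le_iff₀ hr₀).1 (Nat.le_ceil ((Real.log (1 / (ε * H)) / H + 1) / r₀))
      linarith
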